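/- Let Ω ⊂ ℝ² be a bounded connected open set whose boundary is C^{1,α} for some α > 0, except possibly at finitely many corner points of opening angle βπ with 0 < β ≤ 2 (the value β = 2 corresponding to a crack). Then the multiplicity of the second Dirichlet eigenvalue of Ω is at most 3, i.e., λ₂(Ω) < λ₅(Ω). -/

import Mathlib

open MeasureTheory Real Set

noncomputable section

/-- A Dirichlet test function on `ω`: smooth, compactly supported, with support in `ω`. -/
def testFun (ω : Set (ℝ × ℝ)) (u : (ℝ × ℝ) → ℝ) : Prop :=
  ContDiff ℝ (⊤ : ℕ∞) u ∧ HasCompactSupport u ∧ tsupport u ⊆ ω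

/-- `|∇u|²` at a point. -/
def gradSq (u : (ℝ × ℝ) → ℝ) (x : ℝ × ℝ) : ℝ :=
  fderiv ℝ u x (1, 0) ^ 2 + fderiv ℝ u x (0, 1) ^ 2

/-- The Rayleigh quotient of `u` on `ω`. -/
def rayleigh (ω : Set (ℝ × ℝ)) (u : (ℝ × ℝ) → ℝ) : ℝ :=
  (∫ x in ω, gradSq u x) / ∫ x in ω, u x ^ 2

/-- The `k`-th Dirichlet eigenvalue of `ω` (`k ≥ 1`), via the Courant–Fischer
min-max formula over `k`-dimensional subspaces of `C_c^∞(ω)`. -/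
def dirichletEV (ω : Set (ℝ × ℝ)) (k : ℕ) : ℝ :=
  sInf {l | ∃ V : Submodule ℝ ((ℝ × ℝ) → ℝ),
    (V : Set ((ℝ × ℝ) → ℝ)) ⊆ {u | testFun ω u} ∧ Module.finrank ℝ V = k ∧
    l = sSup {r | ∃ u ∈ V, u ≠ 0 ∧ r = rayleigh ω u}}

/-- The open disk `B_R` centered at the origin. -/
def disk (R : ℝ) : Set (ℝ × ℝ) := {x | x.1 ^ 2 + x.2 ^ 2 < R ^ 2}

/-- The open annulus `M_{R₁,R₂} = B_{R₂} \ closure (B_{R₁})`. -/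
def annulus (R₁ R₂ : ℝ) : Set (ℝ × ℝ) := disk R₂ \ closure (disk R₁)

/-- `D_{R₁,R₂} = B_{R₁} ∪ M_{R₁,R₂}`. -/
def diskUnionAnnulus (R₁ R₂ : ℝ) : Set (ℝ × ℝ) := disk R₁ ∪ annulus R₁ R₂

/-- The cracked domain `𝔇(N,ε)`. -/
def crackedDomain (R₁ R₂ : ℝ) (N : ℕ) (ε : ℝ) : Set (ℝ × ℝ) :=
  diskUnionAnnulus R₁ R₂ ∪
    ⋃ j ∈ Finset.range N, {x | ∃ θ : ℝ, θ ∈ Set.Ioo (2 * π * j / N - ε) (2 * π * j / N + ε) ∧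
      x = (R₁ * Real.cos θ, R₁ * Real.sin θ)}

/-- The open sector of opening angle `β·π` at the origin (for `β = 1` a half-plane,
for `β = 2` the plane with a crack removed). -/
def sector (β : ℝ) : Set (ℝ × ℝ) :=
  {x | ∃ ρ θ : ℝ, 0 < ρ ∧ θ ∈ Set.Ioo 0 (β * π) ∧ x = (ρ * Real.cos θ, ρ * Real.sin θ)}

/-- The Euclidean dot product on `ℝ × ℝ`. -/
def dotp (v w : ℝ × ℝ) : ℝ := v.1 * w.1 + v.2 * w.2

/-- `Ω` is, near the boundary point `p`, the image of a sector of opening `β·π` under a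
`C^{1,α}` diffeomorphism whose differential at the tip is a similarity (so that the opening
angle `β·π` is well defined).  The case `β = 1` expresses that the boundary is locally a
`C^{1,α}` curve, and `β = 2` is the crack case. -/
def IsLocalSectorModel (Ω : Set (ℝ × ℝ)) (α : NNReal) (p : ℝ × ℝ) (β : ℝ) : Prop :=
  ∃ (r : ℝ) (Φ : ℝ × ℝ → ℝ × ℝ) (C : NNReal),
    0 < r ∧ Φ 0 = p ∧
    ContDiffOn ℝ 1 Φ (Metric.ball 0 r) ∧
    Set.InjOn Φ (Metric.ball 0 r) ∧
    HolderOnWith C α (fun x => fderivWithin ℝ Φ (Metric.ball 0 r) x) (Metric.ball 0 r) ∧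
    (∃ c : ℝ, 0 < c ∧ ∀ v w : ℝ × ℝ,
      dotp (fderivWithin ℝ Φ (Metric.ball 0 r) 0 v) (fderivWithin ℝ Φ (Metric.ball 0 r) 0 w)
        = c * dotp v w) ∧
    IsOpen (Φ '' Metric.ball 0 r) ∧
    Ω ∩ Φ '' Metric.ball 0 r = Φ '' (sector β ∩ Metric.ball 0 r)

/-- On a preconnected set, a continuous logarithm of a constant is constant. -/
theorem eq_of_exp_eq_const {S : Set ℂ} (hS : IsPreconnected S) {f : ℂ → ℂ} (hf : ContinuousOn f S)
    {c : ℂ} (hc : ∀ z ∈ S, Complex.exp (f z) = c) {x y : ℂ} (hx : x ∈ S) (hy : y ∈ S) :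
    f x = f y := by
  set φ : ℂ → ℝ := fun z => ((f z - f y) / (2 * π * Complex.I)).re with hφ
  have h2 : (2 * π * Complex.I : ℂ) ≠ 0 := Complex.two_pi_I_ne_zero
  have key : ∀ z ∈ S, ∃ n : ℤ, (f z - f y) / (2 * π * Complex.I) = n := by
    intro z hz
    obtain ⟨n, hn⟩ := Complex.exp_eq_exp_iff_exists_int.1 ((hc z hz).trans (hc y hy).symm)
    exact ⟨n, by rw [hn]; field_simp; ring⟩
  have hcont : ContinuousOn φ S :=
    Complex.continuous_re.comp_continuousOn ((hf.sub continuousOn_const).div_const _)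
  have hmaps : MapsTo φ S (range ((↑) : ℤ → ℝ)) := by
    intro z hz
    obtain ⟨n, hn⟩ := key z hz
    exact ⟨n, by simp only [hφ, hn]; simp⟩
  have hdisc : IsDiscrete (range ((↑) : ℤ → ℝ)) :=
    Int.isClosedEmbedding_coe_real.isEmbedding.isInducing.isDiscrete_range
  have := hS.constant_of_mapsTo hdisc hcont hmaps hx hy
  obtain ⟨n, hn⟩ := key x hx
  have h0 : φ y = 0 := by simp [hφ]
  have hn0 : (n : ℝ) = 0 := by
    have : φ x = n := by simp only [hφ, hn]; simp
    linarith
  have : n = 0 := by exact_mod_cast hn0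
  rw [this] at hn
  simp only [Int.cast_zero, div_eq_zero_iff, h2, or_false] at hn
  exact sub_eq_zero.1 hn

/-- Points in a connected set disjoint from a compact set `K` give quotients
`(z - a) / (z - b)` admitting a continuous logarithm on `K`. -/
theorem exists_log_quotient {N K : Set ℂ} (hN : IsPreconnected N) (hK : IsCompact K)
    (hNK : Disjoint N K) {a b : ℂ} (ha : a ∈ N) (hb : b ∈ N) :
    ∃ g : ℂ → ℂ, ContinuousOn g K ∧ ∀ z ∈ K, Complex.exp (g z) = (z - a) / (z - b) := by
  have hne : ∀ x ∈ N, ∀ z ∈ K, z - x ≠ 0 := by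
    intro x hx z hz h
    rw [sub_eq_zero.1 h] at hz
    exact hNK.le_bot ⟨hx, hz⟩
  refine hN.induction₂ (fun a b => ∃ g : ℂ → ℂ, ContinuousOn g K ∧
    ∀ z ∈ K, Complex.exp (g z) = (z - a) / (z - b)) ?_ ?_ ?_ ha hb
  · intro x hx
    have hxK : x ∈ Kᶜ := fun h => hNK.le_bot ⟨hx, h⟩
    obtain ⟨ε, hε, hball⟩ := Metric.isOpen_iff.1 hK.isClosed.isOpen_compl x hxK
    filter_upwards [self_mem_nhdsWithin, nhdsWithin_le_nhds (Metric.ball_mem_nhds x hε)]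
      with y hy hyx
    have hs : ∀ z ∈ K, (z - y) / (z - x) ∈ Complex.slitPlane := by
      intro z hz
      have h1 : (z - y) / (z - x) = 1 + (x - y) / (z - x) := by
        have := hne x hx z hz
        field_simp
        ring
      rw [h1]
      apply Complex.mem_slitPlane_of_norm_lt_one
      have h2 : ε ≤ ‖z - x‖ := by
        by_contra h
        push Not at h
        exact hball (by simpa [dist_eq_norm] using h) hz
      have h3 : ‖x - y‖ < ε := by rwa [Metric.mem_ball, dist_comm, dist_eq_norm] at hyx
      rw [norm_div, div_lt_one (by linarith)]
      linarith
    refine ⟨fun z => - Complex.log ((z - y) / (z - x)), ?_, ?_⟩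
    · refine ContinuousOn.neg (ContinuousOn.clog ?_ hs)
      exact (continuousOn_id.sub continuousOn_const).div (continuousOn_id.sub continuousOn_const)
        (fun z hz => hne x hx z hz)
    · intro z hz
      rw [Complex.exp_neg, Complex.exp_log (Complex.slitPlane_ne_zero (hs z hz)), inv_div]
  · rintro x y w hx hy hw ⟨g, hg, hg'⟩ ⟨k, hk, hk'⟩
    refine ⟨fun z => g z + k z, hg.add hk, fun z hz => ?_⟩
    rw [Complex.exp_add, hg' z hz, hk' z hz]
    have := hne x hx z hz
    have := hne y hy z hz
    have := hne w hw z hz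
    field_simp
  · rintro x y hx hy ⟨g, hg, hg'⟩
    refine ⟨fun z => - g z, hg.neg, fun z hz => ?_⟩
    rw [Complex.exp_neg, hg' z hz, inv_div]

theorem log_neg_exp_of_pos {r φ : ℝ} (hr : 0 < r) (h0 : 0 < φ) (h1 : φ < 2 * π) :
    -((r : ℂ) * Complex.exp (φ * Complex.I)) ∈ Complex.slitPlane ∧
    (Complex.log (-((r : ℂ) * Complex.exp (φ * Complex.I)))).im = φ - π := by
  have he : -((r : ℂ) * Complex.exp (φ * Complex.I))
      = r * (Complex.cos ((φ - π : ℝ) : ℂ) + Complex.sin ((φ - π : ℝ) : ℂ) * Complex.I) := by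
    rw [Complex.exp_mul_I]
    push_cast
    rw [Complex.cos_sub_pi, Complex.sin_sub_pi]
    ring
  have harg : (-((r : ℂ) * Complex.exp (φ * Complex.I))).arg = φ - π := by
    rw [he]
    exact Complex.arg_mul_cos_add_sin_mul_I hr ⟨by linarith, by linarith⟩
  refine ⟨?_, by rw [Complex.log_im, harg]⟩
  rw [Complex.mem_slitPlane_iff_arg, harg]
  refine ⟨by linarith, ?_⟩
  simp [hr.ne']

theorem log_neg_exp_of_neg {r φ : ℝ} (hr : 0 < r) (h0 : φ < 0) (h1 : -(2 * π) < φ) :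
    -((r : ℂ) * Complex.exp (φ * Complex.I)) ∈ Complex.slitPlane ∧
    (Complex.log (-((r : ℂ) * Complex.exp (φ * Complex.I)))).im = φ + π := by
  have h := log_neg_exp_of_pos (φ := φ + 2 * π) hr (by linarith) (by linarith)
  have he : Complex.exp ((φ + 2 * π : ℝ) * Complex.I) = Complex.exp (φ * Complex.I) := by
    push_cast
    rw [add_mul, Complex.exp_add, Complex.exp_two_pi_mul_I, mul_one]
  rw [he] at h
  exact ⟨h.1, by rw [h.2]; ring⟩

/-- Two disjoint connected sets, one open, cannot alternately contain four rays issued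
from a common point. -/
theorem false_of_alternating_rays {P N : Set ℂ} (hPo : IsOpen P) (hP : IsPreconnected P)
    (hN : IsPreconnected N) (hPN : Disjoint P N) (h0P : (0 : ℂ) ∉ P) (h0N : (0 : ℂ) ∉ N)
    {θ₁ θ₂ θ₃ θ₄ r : ℝ} (hr : 0 < r) (h12 : θ₁ < θ₂) (h23 : θ₂ < θ₃) (h34 : θ₃ < θ₄)
    (h41 : θ₄ < θ₁ + 2 * π)
    (H1 : ∀ t : ℝ, 0 < t → t ≤ r → (t : ℂ) * Complex.exp (θ₁ * Complex.I) ∈ P)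
    (H2 : ∀ t : ℝ, 0 < t → t ≤ r → (t : ℂ) * Complex.exp (θ₂ * Complex.I) ∈ N)
    (H3 : ∀ t : ℝ, 0 < t → t ≤ r → (t : ℂ) * Complex.exp (θ₃ * Complex.I) ∈ P)
    (H4 : ∀ t : ℝ, 0 < t → t ≤ r → (t : ℂ) * Complex.exp (θ₄ * Complex.I) ∈ N) : False := by
  set e : ℝ → ℂ := fun θ => Complex.exp (θ * Complex.I) with he
  have hee : ∀ θ φ : ℝ, e θ * e φ = e (θ + φ) := by
    intro θ φ
    simp only [he]
    rw [← Complex.exp_add]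
    push_cast
    ring_nf
  have he0 : ∀ θ, e θ ≠ 0 := fun θ => Complex.exp_ne_zero _
  set z₁ : ℂ := r * e θ₁ with hz₁
  set z₃ : ℂ := r * e θ₃ with hz₃
  have hPc : IsPathConnected P :=
    hPo.isConnected_iff_isPathConnected.1 ⟨⟨z₁, H1 r hr le_rfl⟩, hP⟩
  obtain ⟨γ, hγ⟩ := hPc.joinedIn z₁ (H1 r hr le_rfl) z₃ (H3 r hr le_rfl)
  set K₂ : Set ℂ := range γ with hK₂
  have hK₂P : K₂ ⊆ P := by rintro _ ⟨t, rfl⟩; exact hγ t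
  have hK₂c : IsCompact K₂ := isCompact_range γ.continuous
  have hK₂conn : IsPreconnected K₂ := isPreconnected_range γ.continuous
  set K₁ : Set ℂ := (fun t : ℝ => (t : ℂ) * e θ₁) '' Icc 0 r ∪
    (fun t : ℝ => (t : ℂ) * e θ₃) '' Icc 0 r
    with hK₁
  have hcont : ∀ θ, Continuous (fun t : ℝ => (t : ℂ) * e θ) := fun θ => by fun_prop
  have hK₁c : IsCompact K₁ :=
    (isCompact_Icc.image (hcont _)).union (isCompact_Icc.image (hcont _))
  have hK₁conn : IsPreconnected K₁ := by
    refine IsPreconnected.union 0 ⟨0, by simp [hr.le]⟩ ⟨0, by simp [hr.le]⟩ ?_ ?_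
    · exact isPreconnected_Icc.image _ (hcont _).continuousOn
    · exact isPreconnected_Icc.image _ (hcont _).continuousOn
  have hNK : Disjoint N (K₁ ∪ K₂) := by
    rw [Set.disjoint_left]
    rintro x hx ((⟨t, ⟨ht0, htr⟩, rfl⟩ | ⟨t, ⟨ht0, htr⟩, rfl⟩) | h)
    · rcases ht0.eq_or_lt with rfl | ht
      · simp at hx; exact h0N hx
      · exact hPN.le_bot ⟨H1 t ht htr, hx⟩
    · rcases ht0.eq_or_lt with rfl | ht
      · simp at hx; exact h0N hx
      · exact hPN.le_bot ⟨H3 t ht htr, hx⟩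
    · exact hPN.le_bot ⟨hK₂P h, hx⟩
  have hz₁K₁ : z₁ ∈ K₁ := Or.inl ⟨r, ⟨hr.le, le_rfl⟩, rfl⟩
  have hz₃K₁ : z₃ ∈ K₁ := Or.inr ⟨r, ⟨hr.le, le_rfl⟩, rfl⟩
  have hz₁K₂ : z₁ ∈ K₂ := ⟨0, by simp⟩
  have hz₃K₂ : z₃ ∈ K₂ := ⟨1, by simp⟩
  have h0K₂ : (0 : ℂ) ∈ K₂ᶜ := fun h => h0P (hK₂P h)
  obtain ⟨δ, hδ, hball⟩ := Metric.isOpen_iff.1 hK₂c.isClosed.isOpen_compl 0 h0K₂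
  have hK₂δ : ∀ z ∈ K₂, δ ≤ ‖z‖ := by
    intro z hz
    by_contra h
    push Not at h
    exact hball (by simpa using h) hz
  have hpi := Real.pi_pos
  have rot : ∀ (t s θ φ : ℝ), -((t * e θ - s * e φ) * e (-φ)) = -(t * e (θ - φ)) + s := by
    intro t s θ φ
    have h1 : e θ * e (-φ) = e (θ - φ) := by rw [hee]; ring_nf
    have h2 : e φ * e (-φ) = 1 := by rw [hee]; simp [he]
    calc -((t * e θ - s * e φ) * e (-φ)) = -(t * (e θ * e (-φ))) + s * (e φ * e (-φ)) := by ring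
      _ = _ := by rw [h1, h2, mul_one]
  have slitpos : ∀ (t s φ : ℝ), 0 ≤ t → 0 < s → 0 < φ → φ < 2 * π →
      -(t * e φ) + s ∈ Complex.slitPlane := by
    intro t s φ ht hs h0 h1
    rcases ht.eq_or_lt with rfl | ht
    · simp [hs]
    · rcases Complex.mem_slitPlane_iff.1 (log_neg_exp_of_pos ht h0 h1).1 with h | h
      · exact Complex.mem_slitPlane_iff.2 (Or.inl (by
          rw [Complex.add_re, Complex.ofReal_re]; exact add_pos h hs))
      · exact Complex.mem_slitPlane_iff.2 (Or.inr (by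
          rw [Complex.add_im, Complex.ofReal_im, add_zero]; exact h))
  have slitneg : ∀ (t s φ : ℝ), 0 ≤ t → 0 < s → φ < 0 → -(2 * π) < φ →
      -(t * e φ) + s ∈ Complex.slitPlane := by
    intro t s φ ht hs h0 h1
    have := slitpos t s (φ + 2 * π) ht hs (by linarith) (by linarith)
    have he : e (φ + 2 * π) = e φ := by
      simp only [he]
      push_cast
      rw [add_mul, Complex.exp_add, Complex.exp_two_pi_mul_I, mul_one]
    rwa [he] at this
  set F : ℝ → ℂ → ℂ := fun s z =>
    Complex.log (-((z - s * e θ₂) * e (-θ₂))) - Complex.log (-((z - s * e θ₄) * e (-θ₄))) with hF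
  set Q : ℝ → ℂ → ℂ := fun s z => Complex.log ((z - s * e θ₂) / (z - s * e θ₄)) with hQ
  have main : ∀ s : ℝ, 0 < s → s ≤ r → s < δ / 4 → F s z₁ - F s z₃ = Q s z₁ - Q s z₃ := by
    intro s hs hsr hsδ
    obtain ⟨g, hg, hg'⟩ := exists_log_quotient hN (hK₁c.union hK₂c) hNK (H2 s hs hsr) (H4 s hs hsr)
    have hn2 : ‖(s : ℂ) * e θ₂‖ = s := by simp [he, Complex.norm_exp, abs_of_pos hs]
    have hn4 : ‖(s : ℂ) * e θ₄‖ = s := by simp [he, Complex.norm_exp, abs_of_pos hs]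
    have hslit₂ : ∀ z ∈ K₁, -((z - s * e θ₂) * e (-θ₂)) ∈ Complex.slitPlane := by
      rintro z (⟨t, ⟨ht0, -⟩, rfl⟩ | ⟨t, ⟨ht0, -⟩, rfl⟩) <;> dsimp only <;> rw [rot]
      · exact slitneg t s _ ht0 hs (by linarith) (by linarith)
      · exact slitpos t s _ ht0 hs (by linarith) (by linarith)
    have hslit₄ : ∀ z ∈ K₁, -((z - s * e θ₄) * e (-θ₄)) ∈ Complex.slitPlane := by
      rintro z (⟨t, ⟨ht0, -⟩, rfl⟩ | ⟨t, ⟨ht0, -⟩, rfl⟩) <;> dsimp only <;> rw [rot]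
      · exact slitneg t s _ ht0 hs (by linarith) (by linarith)
      · exact slitneg t s _ ht0 hs (by linarith) (by linarith)
    have hFcont : ContinuousOn (F s) K₁ := by
      refine ContinuousOn.sub (ContinuousOn.clog (by fun_prop) hslit₂)
        (ContinuousOn.clog (by fun_prop) hslit₄)
    have hne4 : ∀ z ∈ K₁ ∪ K₂, z - s * e θ₄ ≠ 0 := by
      intro z hz h
      rw [sub_eq_zero.1 h] at hz
      exact hNK.le_bot ⟨H4 s hs hsr, hz⟩
    have hne2 : ∀ z ∈ K₁ ∪ K₂, z - s * e θ₂ ≠ 0 := by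
      intro z hz h
      rw [sub_eq_zero.1 h] at hz
      exact hNK.le_bot ⟨H2 s hs hsr, hz⟩
    have hslitQ : ∀ z ∈ K₂, (z - s * e θ₂) / (z - s * e θ₄) ∈ Complex.slitPlane := by
      intro z hz
      have h4 := hne4 z (Or.inr hz)
      have h1 : (z - s * e θ₂) / (z - s * e θ₄)
          = 1 + (s * e θ₄ - s * e θ₂) / (z - s * e θ₄) := by
        field_simp
        ring
      have hzδ := hK₂δ z hz
      have hnum : ‖(s : ℂ) * e θ₄ - s * e θ₂‖ ≤ 2 * s := by
        refine (norm_sub_le _ _).trans ?_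
        rw [hn2, hn4]
        linarith
      have hden : δ - s ≤ ‖z - s * e θ₄‖ := by
        have := norm_sub_norm_le z (s * e θ₄)
        rw [hn4] at this
        linarith
      rw [h1]
      apply Complex.mem_slitPlane_of_norm_lt_one
      rw [norm_div, div_lt_one (by linarith)]
      linarith
    have hQcont : ContinuousOn (Q s) K₂ := by
      refine ContinuousOn.clog ?_ hslitQ
      exact ContinuousOn.div (by fun_prop) (by fun_prop) (fun z hz => hne4 z (Or.inr hz))
    have c1 : g z₁ - F s z₁ = g z₃ - F s z₃ := by
      refine eq_of_exp_eq_const (f := fun z => g z - F s z) (c := e (θ₂ - θ₄)) hK₁conn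
        ((hg.mono subset_union_left).sub hFcont) ?_ hz₁K₁ hz₃K₁
      intro z hz
      have h2 := Complex.exp_log (Complex.slitPlane_ne_zero (hslit₂ z hz))
      have h4 := Complex.exp_log (Complex.slitPlane_ne_zero (hslit₄ z hz))
      have hgz : Complex.exp (g z) = (z - s * e θ₂) / (z - s * e θ₄) := hg' z (Or.inl hz)
      simp only [hF]
      rw [Complex.exp_sub, Complex.exp_sub, h2, h4, hgz]
      have := hne2 z (Or.inl hz)
      have := hne4 z (Or.inl hz)
      have h5 : e (θ₂ - θ₄) * e (-θ₂) = e (-θ₄) := by rw [hee]; ring_nf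
      have := he0 (-θ₂)
      have := he0 (-θ₄)
      rw [← h5]
      have h6 : e (θ₂ - θ₄) ≠ 0 := he0 _
      field_simp
    have c2 : g z₁ - Q s z₁ = g z₃ - Q s z₃ := by
      refine eq_of_exp_eq_const (f := fun z => g z - Q s z) (c := 1) hK₂conn
        ((hg.mono subset_union_right).sub hQcont) ?_ hz₁K₂ hz₃K₂
      intro z hz
      have h2 := Complex.exp_log (Complex.slitPlane_ne_zero (hslitQ z hz))
      simp only [hQ]
      rw [Complex.exp_sub, h2, hg' z (Or.inr hz), div_self]
      exact div_ne_zero (hne2 z (Or.inr hz)) (hne4 z (Or.inr hz))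
    linear_combination c2 - c1
  have hs2 : ∀ θ φ : ℝ, -((r * e θ - (0:ℝ) * e φ) * e (-φ)) = -(r * e (θ - φ)) := by
    intro θ φ; rw [rot]; simp
  have hlim : Filter.Tendsto (fun s => F s z₁ - F s z₃) (nhdsWithin 0 (Ioi 0))
      (nhds (F 0 z₁ - F 0 z₃)) := by
    have : ContinuousAt (fun s => F s z₁ - F s z₃) 0 := by
      simp only [hF]
      refine ContinuousAt.sub (ContinuousAt.sub ?_ ?_) (ContinuousAt.sub ?_ ?_) <;>
        refine ContinuousAt.clog (by fun_prop) ?_ <;> simp only [hz₁, hz₃] <;> rw [hs2]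
      · exact (log_neg_exp_of_neg hr (by linarith) (by linarith)).1
      · exact (log_neg_exp_of_neg hr (by linarith) (by linarith)).1
      · exact (log_neg_exp_of_pos hr (by linarith) (by linarith)).1
      · exact (log_neg_exp_of_neg hr (by linarith) (by linarith)).1
    exact this.tendsto.mono_left nhdsWithin_le_nhds
  have hlim2 : Filter.Tendsto (fun s => F s z₁ - F s z₃) (nhdsWithin 0 (Ioi 0)) (nhds 0) := by
    have hne : ∀ θ : ℝ, (r : ℂ) * e θ ≠ 0 := fun θ =>
      mul_ne_zero (by exact_mod_cast hr.ne') (he0 θ)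
    have h1 : ContinuousAt (fun s => Q s z₁ - Q s z₃) 0 := by
      simp only [hQ]
      refine ContinuousAt.sub ?_ ?_ <;> refine ContinuousAt.clog (ContinuousAt.div (by fun_prop)
        (by fun_prop) ?_) ?_ <;> simp [hz₁, hz₃, hr.ne', he0]
    have h2 : Q 0 z₁ - Q 0 z₃ = 0 := by simp [hQ, hz₁, hz₃, hr.ne', he0]
    have h3 := h1.tendsto.mono_left (nhdsWithin_le_nhds (s := Ioi 0))
    rw [h2] at h3
    refine h3.congr' ?_
    have : Ioo 0 (min r (δ / 4)) ∈ nhdsWithin (0:ℝ) (Ioi 0) :=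
      Ioo_mem_nhdsGT (lt_min hr (by linarith))
    filter_upwards [this] with s hs
    exact (main s hs.1 (hs.2.le.trans (min_le_left _ _)) (hs.2.trans_le (min_le_right _ _))).symm
  have hfin := tendsto_nhds_unique hlim hlim2
  have him := congrArg Complex.im hfin
  simp only [hF, hz₁, hz₃, hs2, Complex.sub_im, Complex.zero_im] at him
  rw [(log_neg_exp_of_neg (φ := θ₁ - θ₂) hr (by linarith) (by linarith)).2,
    (log_neg_exp_of_neg (φ := θ₁ - θ₄) hr (by linarith) (by linarith)).2,
    (log_neg_exp_of_pos (φ := θ₃ - θ₂) hr (by linarith) (by linarith)).2,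
    (log_neg_exp_of_neg (φ := θ₃ - θ₄) hr (by linarith) (by linarith)).2] at him
  linarith

section Spectral

open scoped InnerProductSpace

variable {H : Type*} [NormedAddCommGroup H] [InnerProductSpace ℝ H]

/-- A compact positive definite operator attains its largest Rayleigh quotient. -/
theorem exists_top_eigenvector [CompleteSpace H] [Nontrivial H] (T : H →L[ℝ] H)
    (hc : IsCompactOperator T) (hs : T.IsSymmetric) (hpos : ∀ x, x ≠ 0 → 0 < ⟪T x, x⟫_ℝ) :
    ∃ (x : H) (m : ℝ), ‖x‖ = 1 ∧ T x = m • x ∧ ∀ y, ⟪T y, y⟫_ℝ ≤ m * ‖y‖ ^ 2 := by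
  have hT0 : 0 < ‖T‖ := by
    obtain ⟨x, hx⟩ := exists_ne (0 : H)
    rw [norm_pos_iff]
    rintro rfl
    simpa using hpos x hx
  have hle : ∀ y, ⟪T y, y⟫_ℝ ≤ ‖T‖ * ‖y‖ ^ 2 := fun y => by
    calc ⟪T y, y⟫_ℝ ≤ ‖T y‖ * ‖y‖ := real_inner_le_norm _ _
      _ ≤ (‖T‖ * ‖y‖) * ‖y‖ := by gcongr; exact T.le_opNorm y
      _ = _ := by ring
  have hspec : Module.End.HasEigenvalue (T : Module.End ℝ H) ‖T‖ := by
    refine (hc.hasEigenvalue_or_mem_resolventSet hT0.ne').resolve_right fun hres => ?_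
    obtain ⟨ε, hε, hbd⟩ := T.rayleighQuotient_le_of_norm_mem_resolventSet (𝕜 := ℝ) hres
    have hsup := T.norm_eq_iSup_rayleighQuotient hs
    have : (⨆ x, |T.rayleighQuotient x|) ≤ ‖T‖ - ε := by
      refine ciSup_le fun x => ?_
      rw [abs_of_nonneg]
      · exact hbd x
      · rcases eq_or_ne x 0 with rfl | hx
        · simp
        · exact div_nonneg (hpos x hx).le (by positivity)
    linarith
  obtain ⟨v, hv⟩ := hspec.exists_hasEigenvector
  have hv0 : ‖v‖ ≠ 0 := norm_ne_zero_iff.2 hv.2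
  refine ⟨‖v‖⁻¹ • v, ‖T‖, by simp [norm_smul, hv0], ?_, hle⟩
  have := hv.apply_eq_smul
  rw [map_smul, smul_comm]
  exact congrArg _ this

theorem exists_eigenvector_orthogonal [CompleteSpace H] (hinf : ¬ FiniteDimensional ℝ H)
    (T : H →L[ℝ] H) (hc : IsCompactOperator T) (hs : T.IsSymmetric)
    (hpos : ∀ x, x ≠ 0 → 0 < ⟪T x, x⟫_ℝ) (W : Submodule ℝ H) [FiniteDimensional ℝ W]
    (hW : ∀ x ∈ W, T x ∈ W) :
    ∃ (x : H) (m : ℝ), x ∈ Wᗮ ∧ ‖x‖ = 1 ∧ T x = m • x ∧ ∀ y ∈ Wᗮ, ⟪T y, y⟫_ℝ ≤ m * ‖y‖ ^ 2 := by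
  have hinv : ∀ x ∈ Wᗮ, T x ∈ Wᗮ := by
    intro x hx
    rw [Submodule.mem_orthogonal] at hx ⊢
    intro u hu
    rw [← hx (T u) (hW u hu)]
    exact (hs u x).symm
  have hnt : Nontrivial Wᗮ := by
    rw [Submodule.nontrivial_iff_ne_bot]
    intro h
    rw [Submodule.orthogonal_eq_bot_iff] at h
    subst h
    exact hinf (Module.Finite.equiv (Submodule.topEquiv (R := ℝ) (M := H)))
  obtain ⟨x, m, hx, hxm, hm⟩ := exists_top_eigenvector (H := Wᗮ) (T.restrict hinv)
    (hc.restrict' hinv) (hs.restrict_invariant hinv) (fun x hx => hpos x (by simpa using hx))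
  exact ⟨x, m, x.2, hx, congrArg Subtype.val hxm, fun y hy => hm ⟨y, hy⟩⟩

theorem exists_leading_eigenvectors [CompleteSpace H] (hinf : ¬ FiniteDimensional ℝ H)
    (T : H →L[ℝ] H) (hc : IsCompactOperator T) (hs : T.IsSymmetric)
    (hpos : ∀ x, x ≠ 0 → 0 < ⟪T x, x⟫_ℝ) (n : ℕ) :
    ∃ (e : ℕ → H) (μ : ℕ → ℝ), (∀ i < n, ‖e i‖ = 1) ∧ (∀ i < n, ∀ j < i, ⟪e j, e i⟫_ℝ = 0) ∧
      (∀ i < n, T (e i) = μ i • e i) ∧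
      ∀ i < n, ∀ x, (∀ j < i, ⟪e j, x⟫_ℝ = 0) → ⟪T x, x⟫_ℝ ≤ μ i * ‖x‖ ^ 2 := by
  induction n with
  | zero => exact ⟨fun _ => 0, fun _ => 0, by simp, by simp, by simp, by simp⟩
  | succ n ih =>
    obtain ⟨e, μ, h1, h2, h3, h4⟩ := ih
    set W : Submodule ℝ H := Submodule.span ℝ (e '' Iio n) with hWdef
    have : FiniteDimensional ℝ W :=
      FiniteDimensional.span_of_finite ℝ ((Set.finite_Iio n).image e)
    have hW : ∀ x ∈ W, T x ∈ W := by
      intro x hx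
      induction hx using Submodule.span_induction with
      | mem x hx =>
        obtain ⟨i, hi, rfl⟩ := hx
        rw [h3 i hi]
        exact W.smul_mem _ (Submodule.subset_span ⟨i, hi, rfl⟩)
      | zero => simp
      | add x y _ _ hx hy => rw [map_add]; exact W.add_mem hx hy
      | smul a x _ hx => rw [map_smul]; exact W.smul_mem _ hx
    have hWo : ∀ x, x ∈ Wᗮ ↔ ∀ j < n, ⟪e j, x⟫_ℝ = 0 := by
      intro x
      rw [Submodule.mem_orthogonal]
      refine ⟨fun h j hj => h _ (Submodule.subset_span ⟨j, hj, rfl⟩), fun h u hu => ?_⟩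
      induction hu using Submodule.span_induction with
      | mem x hx => obtain ⟨i, hi, rfl⟩ := hx; exact h i hi
      | zero => simp
      | add x y _ _ hx hy => rw [inner_add_left, hx, hy, add_zero]
      | smul a x _ hx => rw [inner_smul_left, hx, mul_zero]
    obtain ⟨x, m, hxW, hx1, hxm, hxmax⟩ :=
      exists_eigenvector_orthogonal hinf T hc hs hpos W hW
    rw [hWo] at hxW
    have hu : ∀ i < n, Function.update e n x i = e i := fun i hi =>
      Function.update_of_ne hi.ne _ _
    have hv : ∀ i < n, Function.update μ n m i = μ i := fun i hi =>
      Function.update_of_ne hi.ne _ _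
    refine ⟨Function.update e n x, Function.update μ n m, ?_, ?_, ?_, ?_⟩ <;> intro i hi <;>
      rcases Nat.lt_succ_iff_lt_or_eq.1 hi with h | rfl
    · rw [hu i h]; exact h1 i h
    · simpa using hx1
    · intro j hj
      rw [hu i h, hu j (hj.trans h)]; exact h2 i h j hj
    · intro j hj
      rw [hu j hj, Function.update_self]; exact hxW j hj
    · rw [hu i h, hv i h]; exact h3 i h
    · simpa using hxm
    · intro y hy
      rw [hv i h]
      exact h4 i h y (fun j hj => by rw [← hu j (hj.trans h)]; exact hy j hj)
    · intro y hy
      rw [Function.update_self]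
      exact hxmax y ((hWo y).2 (fun j hj => by rw [← hu j hj]; exact hy j hj))

/-- A maximizer of the Rayleigh quotient under an orthogonality constraint to an eigenvector is an
eigenvector. -/
theorem eigenvector_of_rayleigh_eq (T : H →L[ℝ] H) (hs : T.IsSymmetric) {e : H} {a m : ℝ}
    (he : T e = a • e)
    (hmax : ∀ y, ⟪e, y⟫_ℝ = 0 → ⟪T y, y⟫_ℝ ≤ m * ‖y‖ ^ 2) {x : H} (hx : ⟪e, x⟫_ℝ = 0)
    (hxm : ⟪T x, x⟫_ℝ = m * ‖x‖ ^ 2) : T x = m • x := by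
  set z := m • x - T x with hz
  have hez : ⟪e, z⟫_ℝ = 0 := by
    have : ⟪T e, x⟫_ℝ = ⟪e, T x⟫_ℝ := hs e x
    rw [hz, inner_sub_right, inner_smul_right, hx, ← this, he, inner_smul_left, hx]
    simp
  have hxz : ⟪T x, z⟫_ℝ = m * ⟪x, z⟫_ℝ - ‖z‖ ^ 2 := by
    have : T x = m • x - z := by rw [hz]; abel
    rw [this, inner_sub_left, inner_smul_left, real_inner_self_eq_norm_sq]
    simp
  have hzx : ⟪T z, x⟫_ℝ = ⟪T x, z⟫_ℝ := by
    rw [real_inner_comm]; exact (hs x z).symm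
  have key : ∀ t : ℝ, 0 ≤ t ^ 2 * (m * ‖z‖ ^ 2 - ⟪T z, z⟫_ℝ) + 2 * t * ‖z‖ ^ 2 := by
    intro t
    have h := hmax (x + t • z) (by rw [inner_add_right, inner_smul_right, hx, hez]; simp)
    rw [← real_inner_self_eq_norm_sq] at h
    simp only [map_add, map_smul, inner_add_left, inner_add_right, inner_smul_left,
      inner_smul_right, hzx, hxz, hxm, real_inner_self_eq_norm_sq, real_inner_comm x z] at h
    simp only [conj_trivial] at h
    nlinarith [h]
  have hz0 : ‖z‖ ^ 2 = 0 := by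
    by_contra hne
    have hp : 0 < ‖z‖ ^ 2 := lt_of_le_of_ne (by positivity) (Ne.symm hne)
    set A := m * ‖z‖ ^ 2 - ⟪T z, z⟫_ℝ with hA
    have h1 := key (-(‖z‖ ^ 2 / (|A| + 1)))
    have hA1 : 0 < |A| + 1 := by positivity
    set s := ‖z‖ ^ 2 / (|A| + 1) with hs'
    have hsp : 0 < s := div_pos hp hA1
    have hse : s * (|A| + 1) = ‖z‖ ^ 2 := div_mul_cancel₀ _ hA1.ne'
    have h2 := le_abs_self A
    rw [← hse] at h1
    nlinarith [mul_pos hsp hsp, mul_le_mul_of_nonneg_left h2 (mul_pos hsp hsp).le, abs_nonneg A]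
  have : z = 0 := by simpa using hz0
  rw [hz, sub_eq_zero] at this
  exact this.symm

end Spectral

theorem exists_ne_zero_of_lt_finrank {V : Type*} [AddCommGroup V] [Module ℝ V] {m : ℕ}
    (f : V →ₗ[ℝ] (Fin m → ℝ)) (h : m < Module.finrank ℝ V) : ∃ x : V, x ≠ 0 ∧ f x = 0 := by
  have : FiniteDimensional ℝ V := Module.finite_of_finrank_pos (by omega)
  have hk := LinearMap.ker_ne_bot_of_finrank_lt (f := f) (by simpa using h)
  obtain ⟨x, hx, hx0⟩ := (Submodule.ne_bot_iff _).1 hk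
  exact ⟨x, hx0, hx⟩

section MinMax

open scoped InnerProductSpace

variable {H : Type*} [NormedAddCommGroup H] [InnerProductSpace ℝ H]

/-- Two orthonormal eigenvectors can be approximated from a dense set without losing much of the
Rayleigh quotient. -/
theorem exists_approx_pair (T : H →L[ℝ] H) {D : Set H} (hD : Dense D) {e₀ e₁ : H} {a₀ a₁ : ℝ}
    (h₀ : T e₀ = a₀ • e₀) (h₁ : T e₁ = a₁ • e₁) (n₀ : ‖e₀‖ = 1) (n₁ : ‖e₁‖ = 1)
    (h₀₁ : ⟪e₀, e₁⟫_ℝ = 0) (ha : a₁ ≤ a₀) {δ : ℝ} (hδ : 0 < δ) :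
    ∃ d₀ ∈ D, ∃ d₁ ∈ D, ∀ a b : ℝ, a ^ 2 + b ^ 2 ≤ 4 * ‖a • d₀ + b • d₁‖ ^ 2 ∧
      (a₁ - δ) * ‖a • d₀ + b • d₁‖ ^ 2 ≤ ⟪T (a • d₀ + b • d₁), a • d₀ + b • d₁⟫_ℝ := by
  set K := ‖T‖ + |a₁| with hK
  have hK0 : 0 ≤ K := by positivity
  set η := min (1 / 4) (δ / (32 * (K + 1))) with hη
  have hη0 : 0 < η := lt_min (by norm_num) (by positivity)
  have hη1 : η ≤ 1 / 4 := min_le_left _ _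
  have hη2 : 32 * K * η ≤ δ := by
    have : η * (32 * (K + 1)) ≤ δ := by
      rw [← le_div_iff₀ (by positivity)]
      exact min_le_right _ _
    nlinarith
  obtain ⟨d₀, hd₀, hD₀⟩ := Metric.dense_iff.1 hD e₀ η hη0
  obtain ⟨d₁, hd₁, hD₁⟩ := Metric.dense_iff.1 hD e₁ η hη0
  rw [Metric.mem_ball, dist_eq_norm] at hd₀ hd₁
  refine ⟨d₀, hD₀, d₁, hD₁, fun a b => ?_⟩
  set u := a • d₀ + b • d₁ with hu
  set v := a • e₀ + b • e₁ with hv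
  have h₁₀ : ⟪e₁, e₀⟫_ℝ = 0 := by rw [real_inner_comm]; exact h₀₁
  have hvn : ‖v‖ ^ 2 = a ^ 2 + b ^ 2 := by
    rw [← real_inner_self_eq_norm_sq, hv]
    simp only [inner_add_left, inner_add_right, inner_smul_left, inner_smul_right, h₀₁, h₁₀,
      real_inner_self_eq_norm_sq, n₀, n₁, conj_trivial]
    ring
  have hTv : ⟪T v, v⟫_ℝ = a₀ * a ^ 2 + a₁ * b ^ 2 := by
    rw [hv]
    simp only [map_add, map_smul, h₀, h₁, inner_add_left, inner_add_right, inner_smul_left,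
      inner_smul_right, h₀₁, h₁₀, real_inner_self_eq_norm_sq, n₀, n₁, conj_trivial]
    ring
  have haN : |a| ≤ ‖v‖ := abs_le_of_sq_le_sq (by nlinarith [sq_nonneg b]) (norm_nonneg _)
  have hbN : |b| ≤ ‖v‖ := abs_le_of_sq_le_sq (by nlinarith [sq_nonneg a]) (norm_nonneg _)
  have huv : ‖u - v‖ ≤ 2 * η * ‖v‖ := by
    have : u - v = a • (d₀ - e₀) + b • (d₁ - e₁) := by rw [hu, hv]; module
    rw [this]
    refine (norm_add_le _ _).trans ?_
    rw [norm_smul, norm_smul, Real.norm_eq_abs, Real.norm_eq_abs]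
    have p₀ := mul_le_mul haN hd₀.le (norm_nonneg _) (norm_nonneg _)
    have p₁ := mul_le_mul hbN hd₁.le (norm_nonneg _) (norm_nonneg _)
    linarith
  have hN := norm_nonneg v
  have hvu : ‖v‖ ≤ 2 * ‖u‖ := by
    have h := norm_sub_norm_le v u
    rw [norm_sub_rev] at h
    have := mul_le_mul_of_nonneg_right hη1 hN
    linarith
  have huv' : ‖u‖ ≤ 2 * ‖v‖ := by
    have h := norm_sub_norm_le u v
    have := mul_le_mul_of_nonneg_right hη1 hN
    linarith
  refine ⟨by rw [← hvn]; exact (pow_le_pow_left₀ hN hvu 2).trans (by rw [mul_pow]; norm_num), ?_⟩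
  set w := u - v with hw
  have hexp : ⟪T u, u⟫_ℝ - a₁ * ‖u‖ ^ 2 = (⟪T v, v⟫_ℝ - a₁ * ‖v‖ ^ 2)
      + ⟪T w - a₁ • w, u⟫_ℝ + ⟪T v - a₁ • v, w⟫_ℝ := by
    have : u = v + w := by rw [hw]; abel
    rw [this]
    simp only [← real_inner_self_eq_norm_sq, map_add, inner_add_left, inner_add_right,
      inner_sub_left, inner_smul_left, conj_trivial]
    ring
  have hop : ∀ z, ‖T z - a₁ • z‖ ≤ K * ‖z‖ := fun z => by
    refine (norm_sub_le _ _).trans ?_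
    rw [norm_smul, Real.norm_eq_abs, hK, add_mul]
    gcongr
    exact T.le_opNorm z
  have e1 : -(K * ‖w‖ * ‖u‖) ≤ ⟪T w - a₁ • w, u⟫_ℝ := by
    have := (abs_le.1 (abs_real_inner_le_norm (T w - a₁ • w) u)).1
    have := mul_le_mul_of_nonneg_right (hop w) (norm_nonneg u)
    linarith
  have e2 : -(K * ‖v‖ * ‖w‖) ≤ ⟪T v - a₁ • v, w⟫_ℝ := by
    have := (abs_le.1 (abs_real_inner_le_norm (T v - a₁ • v) w)).1
    have := mul_le_mul_of_nonneg_right (hop v) (norm_nonneg w)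
    linarith
  have hpos : 0 ≤ ⟪T v, v⟫_ℝ - a₁ * ‖v‖ ^ 2 := by
    rw [hTv, hvn]; linarith [mul_le_mul_of_nonneg_right ha (sq_nonneg a)]
  have e3 : K * ‖w‖ * (‖u‖ + ‖v‖) ≤ δ * ‖u‖ ^ 2 := by
    calc K * ‖w‖ * (‖u‖ + ‖v‖) ≤ K * (2 * η * ‖v‖) * (‖u‖ + ‖v‖) := by gcongr
      _ ≤ K * (2 * η * (2 * ‖u‖)) * (‖u‖ + 2 * ‖u‖) := by gcongr
      _ = (12 * K * η) * ‖u‖ ^ 2 := by ring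
      _ ≤ δ * ‖u‖ ^ 2 := by
        have : 0 ≤ K * η := by positivity
        gcongr
        linarith
  have e4 : K * ‖w‖ * (‖u‖ + ‖v‖) = K * ‖w‖ * ‖u‖ + K * ‖v‖ * ‖w‖ := by ring
  have e5 : (a₁ - δ) * ‖u‖ ^ 2 = a₁ * ‖u‖ ^ 2 - δ * ‖u‖ ^ 2 := by ring
  linarith

end MinMax

theorem sq_integral_le {X : Type*} [MeasurableSpace X] (ν : Measure X) [IsFiniteMeasure ν]
    {f : X → ℝ} (hf : Integrable f ν) (hf2 : Integrable (fun x => f x ^ 2) ν) :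
    (∫ x, f x ∂ν) ^ 2 ≤ ν.real univ * ∫ x, f x ^ 2 ∂ν := by
  set m := ν.real univ with hm
  set I := ∫ x, f x ∂ν with hI
  have h0 : 0 ≤ ∫ x, (m ^ 2 * f x ^ 2 - 2 * m * I * f x + I ^ 2) ∂ν :=
    integral_nonneg fun x => by
      have : m ^ 2 * f x ^ 2 - 2 * m * I * f x + I ^ 2 = (m * f x - I) ^ 2 := by ring
      simp only [this]; positivity
  rw [integral_add (f := fun x => m ^ 2 * f x ^ 2 - 2 * m * I * f x)
      ((hf2.const_mul _).sub (hf.const_mul _)) (integrable_const _),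
    integral_sub (hf2.const_mul _) (hf.const_mul _), integral_const_mul, integral_const_mul,
    integral_const, ← hI, smul_eq_mul] at h0
  rcases (measureReal_nonneg : 0 ≤ ν.real univ).eq_or_lt with h | h
  · have : ν = 0 := by
      rw [← Measure.measure_univ_eq_zero]
      exact (measureReal_eq_zero_iff (measure_ne_top _ _)).1 h.symm
    have hI0 : I = 0 := by rw [hI, this]; simp
    rw [hI0, hm, ← h]; simp
  · rw [← hm] at h h0
    have : 0 ≤ m * (m * (∫ x, f x ^ 2 ∂ν) - I ^ 2) := by nlinarith
    nlinarith [nonneg_of_mul_nonneg_right this h]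

theorem hasDerivAt_fst {u : ℝ × ℝ → ℝ} (hu : ContDiff ℝ 1 u) (y t : ℝ) :
    HasDerivAt (fun t => u (t, y)) (fderiv ℝ u (t, y) (1, 0)) t :=
  ((hu.differentiable one_ne_zero) (t, y)).hasFDerivAt.comp_hasDerivAt t
    ((hasDerivAt_id t).prodMk (hasDerivAt_const t y))

theorem hasDerivAt_snd {u : ℝ × ℝ → ℝ} (hu : ContDiff ℝ 1 u) (x t : ℝ) :
    HasDerivAt (fun t => u (x, t)) (fderiv ℝ u (x, t) (0, 1)) t :=
  ((hu.differentiable one_ne_zero) (x, t)).hasFDerivAt.comp_hasDerivAt t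
    ((hasDerivAt_const t x).prodMk (hasDerivAt_id t))

theorem sq_sub_le_integral {w w' : ℝ → ℝ} (hw : ∀ t, HasDerivAt w (w' t) t) (hc : Continuous w')
    {a s p q : ℝ} (hs : 0 < s) (hp : p ∈ Ioc a (a + s)) (hq : q ∈ Ioc a (a + s)) :
    (w p - w q) ^ 2 ≤ s * ∫ t in a..(a + s), w' t ^ 2 := by
  wlog hpq : p ≤ q generalizing p q
  · have := this hq hp (le_of_not_ge hpq)
    nlinarith
  have h1 : ∫ t in p..q, w' t = w q - w p :=
    intervalIntegral.integral_eq_sub_of_hasDerivAt (fun t _ => hw t) (hc.intervalIntegrable _ _)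
  have h2 := sq_integral_le (volume.restrict (Ioc p q)) (f := w')
    (hc.integrableOn_Ioc) ((hc.pow 2).integrableOn_Ioc)
  rw [← intervalIntegral.integral_of_le hpq, ← intervalIntegral.integral_of_le hpq, h1] at h2
  have h3 : (volume.restrict (Ioc p q)).real univ = q - p := by
    simp [measureReal_def, hpq]
  rw [h3] at h2
  have h4 : ∫ t in p..q, w' t ^ 2 ≤ ∫ t in a..(a + s), w' t ^ 2 :=
    intervalIntegral.integral_mono_interval hp.1.le hpq hq.2
      (Filter.Eventually.of_forall fun t => sq_nonneg _) ((hc.pow 2).intervalIntegrable _ _)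
  have h5 : 0 ≤ ∫ t in a..(a + s), w' t ^ 2 :=
    intervalIntegral.integral_nonneg (by linarith) fun t _ => sq_nonneg _
  calc (w p - w q) ^ 2 = (w q - w p) ^ 2 := by ring
    _ ≤ (q - p) * ∫ t in p..q, w' t ^ 2 := h2
    _ ≤ s * ∫ t in a..(a + s), w' t ^ 2 := by
      have := hp.1
      have := hq.2
      apply mul_le_mul (by linarith) h4
        (intervalIntegral.integral_nonneg hpq fun t _ => sq_nonneg _)
        hs.le

/-- The half-open square of side `s` with lower left corner `(a, b)`. -/
def square (a b s : ℝ) : Set (ℝ × ℝ) := Ioc a (a + s) ×ˢ Ioc b (b + s)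

theorem measurableSet_square (a b s : ℝ) : MeasurableSet (square a b s) :=
  measurableSet_Ioc.prod measurableSet_Ioc

theorem volume_square (a b : ℝ) {s : ℝ} (hs : 0 < s) :
    volume.real (square a b s) = s ^ 2 := by
  rw [square, measureReal_def, Measure.volume_eq_prod, Measure.prod_prod]
  simp [hs.le, sq]

theorem integrableOn_square {f : ℝ × ℝ → ℝ} (hf : Continuous f) (a b s : ℝ) :
    IntegrableOn f (square a b s) :=
  (hf.continuousOn.integrableOn_compact (isCompact_Icc.prod isCompact_Icc)).mono_set
    (prod_mono Ioc_subset_Icc_self Ioc_subset_Icc_self)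

instance isFiniteMeasure_square (a b s : ℝ) :
    IsFiniteMeasure ((volume : Measure (ℝ × ℝ)).restrict (square a b s)) := by
  refine ⟨?_⟩
  rw [Measure.restrict_apply_univ, square, Measure.volume_eq_prod, Measure.prod_prod]
  exact ENNReal.mul_lt_top (by simp) (by simp)

/-- The Poincaré inequality on a square. -/
theorem poincare_square {u : ℝ × ℝ → ℝ} (hu : ContDiff ℝ 1 u) (a b : ℝ) {s : ℝ} (hs : 0 < s) :
    ∫ x in square a b s, (u x - (s ^ 2)⁻¹ * ∫ y in square a b s, u y) ^ 2
      ≤ 2 * s ^ 2 * ∫ x in square a b s, gradSq u x := by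
  set Q := square a b s with hQ
  have hfd : Continuous (fderiv ℝ u) := hu.continuous_fderiv one_ne_zero
  have hc1 : Continuous fun x => fderiv ℝ u x (1, 0) := hfd.clm_apply continuous_const
  have hc2 : Continuous fun x => fderiv ℝ u x (0, 1) := hfd.clm_apply continuous_const
  set α : ℝ → ℝ := fun y => ∫ t in a..(a + s), fderiv ℝ u (t, y) (1, 0) ^ 2 with hα
  set β : ℝ → ℝ := fun x => ∫ t in b..(b + s), fderiv ℝ u (x, t) (0, 1) ^ 2 with hβ
  have hαc : Continuous α :=
    intervalIntegral.continuous_parametric_intervalIntegral_of_continuous'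
      (f := fun y t => fderiv ℝ u (t, y) (1, 0) ^ 2)
      (by simp only [Function.uncurry_def]; exact
        (hc1.comp (continuous_snd.prodMk continuous_fst)).fun_pow 2) a (a + s)
  have hβc : Continuous β :=
    intervalIntegral.continuous_parametric_intervalIntegral_of_continuous'
      (f := fun x t => fderiv ℝ u (x, t) (0, 1) ^ 2)
      (by simp only [Function.uncurry_def]; exact
        (hc2.comp (continuous_fst.prodMk continuous_snd)).fun_pow 2) b (b + s)
  set A := ∫ x in Q, fderiv ℝ u x (1, 0) ^ 2 with hA
  set B := ∫ x in Q, fderiv ℝ u x (0, 1) ^ 2 with hB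
  have hQm : MeasurableSet Q := measurableSet_square a b s
  have hig : ∀ {f : ℝ × ℝ → ℝ}, Continuous f → IntegrableOn f Q := fun hf =>
    integrableOn_square hf a b s
  have hIα : ∫ x in Q, α x.2 = s * A := by
    have h1 : ∫ x in Q, α x.2 = s * ∫ y in Ioc b (b + s), α y := by
      have := setIntegral_prod_mul (μ := (volume : Measure ℝ)) (ν := (volume : Measure ℝ))
        (fun _ : ℝ => (1 : ℝ)) α (Ioc a (a + s)) (Ioc b (b + s))
      simp only [one_mul] at this
      rw [hQ, square, Measure.volume_eq_prod, this]
      simp [hs.le]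
    rw [h1, hA]
    congr 1
    have h2 : IntegrableOn (fun x => fderiv ℝ u x (1, 0) ^ 2) Q := hig (hc1.pow 2)
    rw [hQ, square, Measure.volume_eq_prod] at h2 ⊢
    have h3 := setIntegral_prod _ h2.swap
    simp only [Function.comp_def] at h3
    rw [← setIntegral_prod_swap, h3]
    simp only [hα]
    refine setIntegral_congr_fun measurableSet_Ioc fun x _ => ?_
    exact intervalIntegral.integral_of_le (by linarith)
  have hIβ : ∫ x in Q, β x.1 = s * B := by
    have h1 : ∫ x in Q, β x.1 = (∫ y in Ioc a (a + s), β y) * s := by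
      have := setIntegral_prod_mul (μ := (volume : Measure ℝ)) (ν := (volume : Measure ℝ))
        β (fun _ : ℝ => (1 : ℝ)) (Ioc a (a + s)) (Ioc b (b + s))
      simp only [mul_one] at this
      rw [hQ, square, Measure.volume_eq_prod, this]
      simp [hs.le]
    rw [h1, hB, mul_comm]
    congr 1
    have h2 : IntegrableOn (fun x => fderiv ℝ u x (0, 1) ^ 2) Q := hig (hc2.pow 2)
    rw [hQ, square, Measure.volume_eq_prod] at h2 ⊢
    rw [setIntegral_prod _ h2]
    simp only [hβ]
    refine setIntegral_congr_fun measurableSet_Ioc fun x _ => ?_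
    exact intervalIntegral.integral_of_le (by linarith)
  have hpt : ∀ x ∈ Q, ∀ y ∈ Q, (u x - u y) ^ 2 ≤ 2 * s * (α x.2 + β y.1) := by
    rintro ⟨x1, x2⟩ ⟨hx1, hx2⟩ ⟨y1, y2⟩ ⟨hy1, hy2⟩
    have h1 := sq_sub_le_integral (hasDerivAt_fst hu x2)
      (hc1.comp (continuous_id.prodMk continuous_const)) hs hx1 hy1
    have h2 := sq_sub_le_integral (hasDerivAt_snd hu y1)
      (hc2.comp (continuous_const.prodMk continuous_id)) hs hx2 hy2
    have h3 : (u (x1, x2) - u (y1, y2)) ^ 2 ≤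
        2 * (u (x1, x2) - u (y1, x2)) ^ 2 + 2 * (u (y1, x2) - u (y1, y2)) ^ 2 := by
      nlinarith [sq_nonneg ((u (x1, x2) - u (y1, x2)) - (u (y1, x2) - u (y1, y2)))]
    simp only [hα, hβ]
    linarith
  have hm : (volume.restrict Q).real univ = s ^ 2 := by
    rw [measureReal_restrict_apply_univ]; exact volume_square a b hs
  have hptx : ∀ x ∈ Q, (u x - (s ^ 2)⁻¹ * ∫ y in Q, u y) ^ 2 ≤ 2 * s * α x.2 + 2 * B := by
    intro x hx
    have hc : Continuous fun y => u x - u y := continuous_const.sub hu.continuous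
    have h1 := sq_integral_le (volume.restrict Q) (f := fun y => u x - u y) (hig hc)
      (hig (hc.pow 2))
    rw [hm, integral_sub (hig continuous_const) (hig hu.continuous), integral_const, hm,
      smul_eq_mul] at h1
    have h2 : ∫ y in Q, (u x - u y) ^ 2 ≤ ∫ y in Q, 2 * s * (α x.2 + β y.1) :=
      setIntegral_mono_on (hig (hc.pow 2)) (hig (by fun_prop)) hQm (hpt x hx)
    rw [integral_const_mul, integral_add (hig continuous_const) (hig (by fun_prop)), hIβ,
      integral_const, hm, smul_eq_mul] at h2
    have hs2 : 0 < s ^ 2 := by positivity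
    have h3 : (s ^ 2 * (u x - (s ^ 2)⁻¹ * ∫ y in Q, u y)) ^ 2 ≤
        (s ^ 2) ^ 2 * (2 * s * α x.2 + 2 * B) := by
      calc _ = (s ^ 2 * u x - ∫ y in Q, u y) ^ 2 := by
            rw [mul_sub, mul_inv_cancel_left₀ hs2.ne']
        _ ≤ s ^ 2 * (2 * s * (s ^ 2 * α x.2 + s * B)) := h1.trans (by gcongr)
        _ = _ := by ring
    rw [mul_pow] at h3
    exact le_of_mul_le_mul_left h3 (by positivity)
  have hcu : Continuous fun x => (u x - (s ^ 2)⁻¹ * ∫ y in Q, u y) ^ 2 := by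
    have := hu.continuous
    fun_prop
  calc _ ≤ ∫ x in Q, (2 * s * α x.2 + 2 * B) :=
        setIntegral_mono_on (hig hcu) (hig (by fun_prop)) hQm hptx
    _ = 2 * s * (s * A) + s ^ 2 * (2 * B) := by
      rw [integral_add (hig (by fun_prop)) (hig continuous_const), integral_const_mul, hIα,
        integral_const, hm, smul_eq_mul]
    _ = 2 * s ^ 2 * ∫ x in Q, gradSq u x := by
      simp only [gradSq]
      rw [integral_add (hig (hc1.fun_pow 2)) (hig (hc2.fun_pow 2))]
      ring

/-- The Euclidean space `ℝ³`, where first order jets take their values. -/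
abbrev E3 : Type := EuclideanSpace ℝ (Fin 3)

/-- Square integrable jets. -/
abbrev L2V : Type := Lp E3 2 (volume : Measure (ℝ × ℝ))

/-- The first order jet of a function of two variables. -/
def jet (u : ℝ × ℝ → ℝ) (x : ℝ × ℝ) : E3 :=
  !₂[u x, fderiv ℝ u x (1, 0), fderiv ℝ u x (0, 1)]

@[simp] theorem jet_zero (u : ℝ × ℝ → ℝ) (x) : jet u x 0 = u x := rfl
@[simp] theorem jet_one (u : ℝ × ℝ → ℝ) (x) : jet u x 1 = fderiv ℝ u x (1, 0) := rfl
@[simp] theorem jet_two (u : ℝ × ℝ → ℝ) (x) : jet u x 2 = fderiv ℝ u x (0, 1) := rfl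

theorem continuous_jet {u : ℝ × ℝ → ℝ} (hu : ContDiff ℝ (⊤ : ℕ∞) u) : Continuous (jet u) := by
  have hfd : Continuous (fderiv ℝ u) := hu.continuous_fderiv (by simp)
  refine (PiLp.continuous_toLp 2 _).comp (continuous_pi fun i => ?_)
  fin_cases i
  · exact hu.continuous
  · exact hfd.clm_apply continuous_const
  · exact hfd.clm_apply continuous_const

theorem jet_eq_zero_of_notMem {u : ℝ × ℝ → ℝ} {x : ℝ × ℝ} (hx : x ∉ tsupport u) : jet u x = 0 := by
  have h1 : u x = 0 := image_eq_zero_of_notMem_tsupport hx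
  have h2 : fderiv ℝ u x = 0 :=
    image_eq_zero_of_notMem_tsupport (fun h => hx (tsupport_fderiv_subset ℝ h))
  ext i
  fin_cases i <;> simp [jet, h1, h2]

theorem hasCompactSupport_jet {u : ℝ × ℝ → ℝ} (hu : HasCompactSupport u) :
    HasCompactSupport (jet u) :=
  HasCompactSupport.intro hu fun _ hx => jet_eq_zero_of_notMem hx

theorem memLp_jet {u : ℝ × ℝ → ℝ} (hu : ContDiff ℝ (⊤ : ℕ∞) u) (hc : HasCompactSupport u) :
    MemLp (jet u) 2 volume :=
  (continuous_jet hu).memLp_of_hasCompactSupport (hasCompactSupport_jet hc)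

/-- The space of Dirichlet test functions. -/
def testSub (ω : Set (ℝ × ℝ)) : Submodule ℝ ((ℝ × ℝ) → ℝ) where
  carrier := {u | testFun ω u}
  add_mem' {u v} hu hv :=
    ⟨hu.1.add hv.1, hu.2.1.add hv.2.1, (tsupport_add u v).trans (union_subset hu.2.2 hv.2.2)⟩
  zero_mem' := ⟨contDiff_const, HasCompactSupport.zero, by simp [tsupport]⟩
  smul_mem' c u hu :=
    ⟨contDiff_const.smul hu.1, hu.2.1.smul_left (f := fun _ => c),
      (tsupport_smul_subset_right (fun _ => c) u).trans hu.2.2⟩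

/-- The jet map from test functions to square integrable jets. -/
def jetL (ω : Set (ℝ × ℝ)) : testSub ω →ₗ[ℝ] L2V where
  toFun u := (memLp_jet u.2.1 u.2.2.1).toLp (jet u)
  map_add' u v := by
    rw [← MemLp.toLp_add]
    congr 1
    have hu := (u.2.1.differentiable (by simp) : Differentiable ℝ (u : ℝ × ℝ → ℝ))
    have hv := (v.2.1.differentiable (by simp) : Differentiable ℝ (v : ℝ × ℝ → ℝ))
    ext x i
    have := fderiv_add (hu x) (hv x)
    fin_cases i <;> simp [jet, this]
  map_smul' c u := by
    simp only [RingHom.id_apply]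
    rw [← MemLp.toLp_const_smul]
    congr 1
    have hu := (u.2.1.differentiable (by simp) : Differentiable ℝ (u : ℝ × ℝ → ℝ))
    ext x i
    have := fderiv_const_smul (hu x) c
    fin_cases i <;> simp [jet, this]

theorem coeFn_jetL {ω : Set (ℝ × ℝ)} (u : testSub ω) : jetL ω u =ᵐ[volume] jet u :=
  MemLp.coeFn_toLp (memLp_jet u.2.1 u.2.2.1)

/-- The Sobolev space `H¹₀(ω)`, as a space of square integrable jets. -/
def sobolev (ω : Set (ℝ × ℝ)) : Submodule ℝ L2V := (LinearMap.range (jetL ω)).topologicalClosure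

theorem isClosed_sobolev (ω : Set (ℝ × ℝ)) : IsClosed (sobolev ω : Set L2V) :=
  Submodule.isClosed_topologicalClosure _

instance completeSpace_sobolev (ω : Set (ℝ × ℝ)) : CompleteSpace (sobolev ω) :=
  (isClosed_sobolev ω).completeSpace_coe

theorem jetL_mem_sobolev {ω : Set (ℝ × ℝ)} (u : testSub ω) : jetL ω u ∈ sobolev ω :=
  Submodule.le_topologicalClosure _ ⟨u, rfl⟩

/-- Closed conditions on jets of test functions extend to the Sobolev space. -/
theorem sobolev_induction {ω : Set (ℝ × ℝ)} {p : L2V → Prop} (hp : IsClosed {f | p f})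
    (h : ∀ u : testSub ω, p (jetL ω u)) {f : L2V} (hf : f ∈ sobolev ω) : p f := by
  have : (sobolev ω : Set L2V) ⊆ {f | p f} := by
    rw [sobolev, Submodule.topologicalClosure_coe]
    refine closure_minimal ?_ hp
    rintro _ ⟨u, rfl⟩
    exact h u
  exact this hf

theorem memLp_apply (f : L2V) (i : Fin 3) : MemLp (fun x => f x i) 2 volume :=
  (Lp.memLp f).continuousLinearMap_comp (EuclideanSpace.proj (𝕜 := ℝ) i)

theorem integrable_mul_apply (f g : L2V) (i j : Fin 3) :
    Integrable (fun x => f x i * g x j) volume :=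
  (memLp_apply f i).integrable_mul (memLp_apply g j)

theorem inner_L2V (f g : L2V) :
    inner ℝ f g = (∫ x, f x 0 * g x 0) + (∫ x, f x 1 * g x 1) + ∫ x, f x 2 * g x 2 := by
  rw [L2.inner_def, ← integral_add (integrable_mul_apply f g 0 0) (integrable_mul_apply f g 1 1),
    ← integral_add (f := fun x => f x 0 * g x 0 + f x 1 * g x 1)
      ((integrable_mul_apply f g 0 0).add (integrable_mul_apply f g 1 1))
      (integrable_mul_apply f g 2 2)]
  congr 1
  ext x
  rw [PiLp.inner_apply, Fin.sum_univ_three]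
  simp only [RCLike.inner_apply, conj_trivial]
  ring

/-- The underlying function of a jet. -/
def valL : L2V →L[ℝ] Lp ℝ 2 (volume : Measure (ℝ × ℝ)) :=
  (EuclideanSpace.proj (𝕜 := ℝ) (0 : Fin 3)).compLpL 2 volume

theorem coeFn_valL (f : L2V) : valL f =ᵐ[volume] fun x => f x 0 :=
  ContinuousLinearMap.coeFn_compLpL _ f

theorem inner_valL (f g : L2V) : inner ℝ (valL f) (valL g) = ∫ x, f x 0 * g x 0 := by
  rw [L2.inner_def]
  refine integral_congr_ae ?_
  filter_upwards [coeFn_valL f, coeFn_valL g] with x hf hg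
  rw [hf, hg]
  simp [mul_comm]

theorem norm_valL_sq (f : L2V) : ‖valL f‖ ^ 2 = ∫ x, f x 0 ^ 2 := by
  rw [← real_inner_self_eq_norm_sq, inner_valL]
  simp only [sq]

theorem norm_valL_le (f : L2V) : ‖valL f‖ ^ 2 ≤ ‖f‖ ^ 2 := by
  rw [← real_inner_self_eq_norm_sq f, inner_L2V, norm_valL_sq]
  simp only [sq]
  have h1 : 0 ≤ ∫ x, f x 1 * f x 1 := integral_nonneg fun x => mul_self_nonneg _
  have h2 : 0 ≤ ∫ x, f x 2 * f x 2 := integral_nonneg fun x => mul_self_nonneg _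
  linarith

theorem norm_jetL_sq {ω : Set (ℝ × ℝ)} (u : testSub ω) :
    ‖jetL ω u‖ ^ 2 = (∫ x, (u : ℝ × ℝ → ℝ) x ^ 2) + ∫ x, gradSq u x := by
  have hi := fun i => integrable_mul_apply (jetL ω u) (jetL ω u) i i
  rw [← real_inner_self_eq_norm_sq, inner_L2V, add_assoc, ← integral_add (hi 1) (hi 2)]
  congr 1 <;> refine integral_congr_ae ?_ <;> filter_upwards [coeFn_jetL u] with x hx <;>
    rw [hx] <;> simp [gradSq, sq]

theorem norm_valL_jetL_sq {ω : Set (ℝ × ℝ)} (u : testSub ω) :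
    ‖valL (jetL ω u)‖ ^ 2 = ∫ x, (u : ℝ × ℝ → ℝ) x ^ 2 := by
  rw [norm_valL_sq]
  refine integral_congr_ae ?_
  filter_upwards [coeFn_jetL u] with x hx
  rw [hx, jet_zero]

section Rellich

theorem isCompactOperator_of_norm_sub_le {E F : Type*} [NormedAddCommGroup E] [NormedSpace ℝ E]
    [NormedAddCommGroup F] [NormedSpace ℝ F] [CompleteSpace F] {T : E →L[ℝ] F}
    {A : ℕ → E →L[ℝ] F} {c : ℕ → ℝ} (hA : ∀ n, IsCompactOperator (A n)) (hc : ∀ n, 0 ≤ c n)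
    (hc0 : Filter.Tendsto c Filter.atTop (nhds 0)) (h : ∀ n x, ‖T x - A n x‖ ≤ c n * ‖x‖) :
    IsCompactOperator T := by
  refine isCompactOperator_of_tendsto (l := Filter.atTop) (F := A) ?_
    (Filter.Eventually.of_forall hA)
  refine tendsto_iff_norm_sub_tendsto_zero.2
    (squeeze_zero (fun n => norm_nonneg _) (fun n => ?_) hc0)
  rw [norm_sub_rev]
  exact ContinuousLinearMap.opNorm_le_bound _ (hc n) (h n)

/-- The cell of the grid of mesh `s` indexed by `k`. -/
def cell (s : ℝ) (k : ℤ × ℤ) : Set (ℝ × ℝ) := square (s * k.1) (s * k.2) s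

/-- The index of the cell containing a point. -/
def cellIndex (s : ℝ) (x : ℝ × ℝ) : ℤ × ℤ := (⌈x.1 / s⌉ - 1, ⌈x.2 / s⌉ - 1)

theorem mem_cell_iff {s : ℝ} (hs : 0 < s) (k : ℤ × ℤ) (x : ℝ × ℝ) :
    x ∈ cell s k ↔ cellIndex s x = k := by
  have key : ∀ (t : ℝ) (m : ℤ), t ∈ Ioc (s * m) (s * m + s) ↔ ⌈t / s⌉ - 1 = m := by
    intro t m
    rw [sub_eq_iff_eq_add, Int.ceil_eq_iff, mem_Ioc, lt_div_iff₀ hs, div_le_iff₀ hs]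
    push_cast
    constructor <;> rintro ⟨h1, h2⟩ <;> constructor <;> linarith
  rw [cell, square, mem_prod, key, key, cellIndex, Prod.ext_iff]

theorem measurableSet_cell (s : ℝ) (k : ℤ × ℤ) : MeasurableSet (cell s k) :=
  measurableSet_square _ _ _

theorem volume_cell_ne_top (s : ℝ) (k : ℤ × ℤ) : volume (cell s k) ≠ ⊤ := by
  have : IsFiniteMeasure ((volume : Measure (ℝ × ℝ)).restrict (cell s k)) :=
    isFiniteMeasure_square _ _ _
  have := measure_lt_top ((volume : Measure (ℝ × ℝ)).restrict (cell s k)) univ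
  rw [Measure.restrict_apply_univ] at this
  exact this.ne

abbrev L2R : Type := Lp ℝ 2 (volume : Measure (ℝ × ℝ))

/-- The normalized indicator function of a cell. -/
def cellLp (s : ℝ) (k : ℤ × ℤ) : L2R :=
  indicatorConstLp 2 (measurableSet_cell s k) (volume_cell_ne_top s k) (1 : ℝ)

/-- Averaging over finitely many cells of the grid. -/
def averaging (s : ℝ) (F : Finset (ℤ × ℤ)) : L2R →L[ℝ] L2R :=
  ∑ k ∈ F, (s ^ 2)⁻¹ • (innerSL ℝ (cellLp s k)).smulRight (cellLp s k)

theorem isCompactOperator_averaging (s : ℝ) (F : Finset (ℤ × ℤ)) :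
    IsCompactOperator (averaging s F) := by
  have hmem : averaging s F ∈ compactOperator (RingHom.id ℝ) L2R L2R := by
    refine Submodule.sum_mem _ fun k _ => Submodule.smul_mem _ _ ?_
    have h1 : IsCompactOperator (id : ℝ → ℝ) :=
      (isCompactOperator_id_iff_finiteDimensional (𝕜 := ℝ) (E := ℝ)).2 inferInstance
    have h2 := (h1.comp_clm (innerSL ℝ (cellLp s k))).clm_comp
      (ContinuousLinearMap.toSpanSingleton ℝ (cellLp s k))
    exact h2
  exact hmem

theorem averaging_apply (s : ℝ) (F : Finset (ℤ × ℤ)) (g : L2R) :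
    averaging s F g = ∑ k ∈ F, ((s ^ 2)⁻¹ * ∫ x in cell s k, g x) • cellLp s k := by
  simp only [averaging, sum_apply, smul_apply,
    ContinuousLinearMap.smulRight_apply, innerSL_apply_apply, smul_smul]
  refine Finset.sum_congr rfl fun k _ => ?_
  rw [cellLp, L2.inner_indicatorConstLp_one]

theorem coeFn_averaging (s : ℝ) (F : Finset (ℤ × ℤ)) (g : L2R) :
    averaging s F g =ᵐ[volume] fun x => ∑ k ∈ F,
      (cell s k).indicator (fun _ => (s ^ 2)⁻¹ * ∫ x in cell s k, g x) x := by
  rw [averaging_apply]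
  have h1 : ∀ k ∈ F, (((s ^ 2)⁻¹ * ∫ x in cell s k, g x) • cellLp s k : L2R) =ᵐ[volume]
      (cell s k).indicator (fun _ => (s ^ 2)⁻¹ * ∫ x in cell s k, g x) := by
    intro k _
    filter_upwards [Lp.coeFn_smul ((s ^ 2)⁻¹ * ∫ x in cell s k, g x) (cellLp s k),
      indicatorConstLp_coeFn (p := 2) (hs := measurableSet_cell s k)
        (hμs := volume_cell_ne_top s k) (c := (1 : ℝ))] with x h1 h2
    rw [h1, Pi.smul_apply, cellLp, h2]
    by_cases hx : x ∈ cell s k <;> simp [hx]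
  have h2 : ∀ᵐ x ∂(volume : Measure (ℝ × ℝ)), ∀ k ∈ F,
      (((s ^ 2)⁻¹ * ∫ x in cell s k, g x) • cellLp s k : L2R) x =
      (cell s k).indicator (fun _ => (s ^ 2)⁻¹ * ∫ x in cell s k, g x) x :=
    (Finset.eventually_all F).2 h1
  filter_upwards [Lp.coeFn_fun_finsetSum F
    (fun k => (((s ^ 2)⁻¹ * ∫ x in cell s k, g x) • cellLp s k : L2R)), h2] with x hx hx2
  rw [hx]
  exact Finset.sum_congr rfl fun k hk => hx2 k hk

theorem norm_sub_averaging_le {ω : Set (ℝ × ℝ)} {s : ℝ} (hs : 0 < s) {F : Finset (ℤ × ℤ)}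
    (hF : ∀ x ∈ ω, cellIndex s x ∈ F) (u : testSub ω) :
    ‖valL (jetL ω u) - averaging s F (valL (jetL ω u))‖ ≤ 2 * s * ‖jetL ω u‖ := by
  set g := valL (jetL ω u) with hg
  have hgu : g =ᵐ[volume] (u : ℝ × ℝ → ℝ) := by
    filter_upwards [coeFn_valL (jetL ω u), coeFn_jetL u] with x h1 h2
    rw [hg, h1, h2, jet_zero]
  have hu1 : ContDiff ℝ 1 (u : ℝ × ℝ → ℝ) := u.2.1.of_le (by exact_mod_cast le_top)
  have hgs : Continuous (gradSq (u : ℝ × ℝ → ℝ)) := by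
    have hfd : Continuous (fderiv ℝ (u : ℝ × ℝ → ℝ)) := hu1.continuous_fderiv one_ne_zero
    unfold gradSq
    fun_prop
  have hgi : Integrable (gradSq (u : ℝ × ℝ → ℝ)) := by
    refine hgs.integrable_of_hasCompactSupport (HasCompactSupport.intro u.2.2.1 fun x hx => ?_)
    have h := jet_eq_zero_of_notMem hx
    have h1 := congrArg (fun v : E3 => v 1) h
    have h2 := congrArg (fun v : E3 => v 2) h
    simp only [jet_one, jet_two, PiLp.zero_apply] at h1 h2
    simp [gradSq, h1, h2]
  set a : ℤ × ℤ → ℝ := fun k => (s ^ 2)⁻¹ * ∫ x in cell s k, (u : ℝ × ℝ → ℝ) x with ha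
  have hag : ∀ k, (s ^ 2)⁻¹ * ∫ x in cell s k, g x = a k := fun k => by
    rw [ha]
    congr 1
    exact setIntegral_congr_ae (measurableSet_cell s k)
      (by filter_upwards [hgu] with x hx _ using hx)
  have hdiff : (g - averaging s F g : L2R) =ᵐ[volume] fun x =>
      (u : ℝ × ℝ → ℝ) x - ∑ k ∈ F, (cell s k).indicator (fun _ => a k) x := by
    filter_upwards [Lp.coeFn_sub g (averaging s F g), coeFn_averaging s F g, hgu] with x h1 h2 h3
    rw [h1, Pi.sub_apply, h2, h3]
    congr 1
    exact Finset.sum_congr rfl fun k _ => by rw [hag k]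
  have hpt : ∀ x, ((u : ℝ × ℝ → ℝ) x - ∑ k ∈ F, (cell s k).indicator (fun _ => a k) x) ^ 2 =
      ∑ k ∈ F, (cell s k).indicator (fun y => ((u : ℝ × ℝ → ℝ) y - a k) ^ 2) x := by
    classical
    intro x
    simp only [indicator_apply, mem_cell_iff hs, Finset.sum_ite_eq]
    split_ifs with h
    · rfl
    · have : (u : ℝ × ℝ → ℝ) x = 0 :=
        image_eq_zero_of_notMem_tsupport fun hx => h (hF x (u.2.2.2 hx))
      simp [this]
  have hcell : ∀ k, ∫ x in cell s k, ((u : ℝ × ℝ → ℝ) x - a k) ^ 2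
      ≤ 2 * s ^ 2 * ∫ x in cell s k, gradSq (u : ℝ × ℝ → ℝ) x := fun k =>
    poincare_square hu1 _ _ hs
  have hcu : ∀ k, Continuous fun y => ((u : ℝ × ℝ → ℝ) y - a k) ^ 2 := fun k => by
    have := hu1.continuous
    fun_prop
  have hsq : ‖g - averaging s F g‖ ^ 2 ≤ 2 * s ^ 2 * ∫ x, gradSq (u : ℝ × ℝ → ℝ) x := by
    calc ‖g - averaging s F g‖ ^ 2
        = ∫ x, ∑ k ∈ F, (cell s k).indicator (fun y => ((u : ℝ × ℝ → ℝ) y - a k) ^ 2) x := by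
          rw [← real_inner_self_eq_norm_sq, L2.inner_def]
          refine integral_congr_ae ?_
          filter_upwards [hdiff] with x hx
          rw [hx, ← hpt x]
          simp [sq]
      _ = ∑ k ∈ F, ∫ x in cell s k, ((u : ℝ × ℝ → ℝ) x - a k) ^ 2 := by
          rw [integral_finsetSum]
          · exact Finset.sum_congr rfl fun k _ => integral_indicator (measurableSet_cell s k)
          · exact fun k _ => (integrableOn_square (hcu k) _ _ _).integrable_indicator
              (measurableSet_cell s k)
      _ ≤ ∑ k ∈ F, 2 * s ^ 2 * ∫ x in cell s k, gradSq (u : ℝ × ℝ → ℝ) x :=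
          Finset.sum_le_sum fun k _ => hcell k
      _ = 2 * s ^ 2 * ∫ x in ⋃ k ∈ F, cell s k, gradSq (u : ℝ × ℝ → ℝ) x := by
          rw [← Finset.mul_sum, integral_biUnion_finset F (fun k _ => measurableSet_cell s k)]
          · intro k _ l _ hkl
            exact Set.disjoint_left.2 fun x hx hx' =>
              hkl (((mem_cell_iff hs k x).1 hx).symm.trans ((mem_cell_iff hs l x).1 hx'))
          · exact fun k _ => hgi.integrableOn
      _ ≤ _ := by
          refine mul_le_mul_of_nonneg_left (setIntegral_le_integral hgi ?_) (by positivity)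
          exact Filter.Eventually.of_forall fun x => add_nonneg (sq_nonneg _) (sq_nonneg _)
  have hn := norm_jetL_sq u
  have h0 : 0 ≤ ∫ x, (u : ℝ × ℝ → ℝ) x ^ 2 := integral_nonneg fun x => sq_nonneg _
  have h1 : ‖g - averaging s F g‖ ^ 2 ≤ (2 * s * ‖jetL ω u‖) ^ 2 := by
    have hs2 : 0 < s ^ 2 := by positivity
    have : 0 ≤ ‖jetL ω u‖ ^ 2 := by positivity
    rw [mul_pow, mul_pow]
    nlinarith
  exact abs_le_of_sq_le_sq h1 (by positivity) |> (le_abs_self _).trans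

/-- Rellich's theorem: the Sobolev space of a bounded set embeds compactly in `L²`. -/
theorem isCompactOperator_valL {ω : Set (ℝ × ℝ)} (hω : Bornology.IsBounded ω) :
    IsCompactOperator (valL ∘L (sobolev ω).subtypeL) := by
  obtain ⟨R, hR⟩ := hω.exists_norm_le
  have hex : ∀ n : ℕ, ∃ F : Finset (ℤ × ℤ), ∀ x ∈ ω, cellIndex (1 / ((n : ℝ) + 1)) x ∈ F := by
    intro n
    set s : ℝ := 1 / ((n : ℝ) + 1) with hs
    have hs0 : 0 < s := by positivity
    refine ⟨Finset.Icc (⌈-R / s⌉ - 1) (⌈R / s⌉ - 1) ×ˢ Finset.Icc (⌈-R / s⌉ - 1) (⌈R / s⌉ - 1),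
      fun x hx => ?_⟩
    have h := hR x hx
    have h1 := abs_le.1 ((norm_fst_le x).trans h)
    have h2 := abs_le.1 ((norm_snd_le x).trans h)
    simp only [cellIndex, Finset.mem_product, Finset.mem_Icc]
    refine ⟨⟨?_, ?_⟩, ⟨?_, ?_⟩⟩ <;> refine sub_le_sub_right (Int.ceil_mono ?_) 1 <;>
      gcongr
    exacts [h1.1, h1.2, h2.1, h2.2]
  choose F hF using hex
  set A : ℕ → (sobolev ω →L[ℝ] L2R) := fun n =>
    averaging (1 / ((n : ℝ) + 1)) (F n) ∘L (valL ∘L (sobolev ω).subtypeL) with hA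
  refine isCompactOperator_of_norm_sub_le (A := A) (c := fun n => 2 * (1 / ((n : ℝ) + 1)))
    (fun n => (isCompactOperator_averaging _ _).comp_clm _) (fun n => by positivity) ?_ ?_
  · simpa using (tendsto_one_div_add_atTop_nhds_zero_nat (𝕜 := ℝ)).const_mul 2
  · intro n f
    exact sobolev_induction (ω := ω)
      (p := fun f => ‖valL f - averaging (1 / ((n : ℝ) + 1)) (F n) (valL f)‖
        ≤ 2 * (1 / ((n : ℝ) + 1)) * ‖f‖)
      (isClosed_le (by fun_prop) (by fun_prop))
      (fun u => norm_sub_averaging_le (by positivity) (hF n) u) f.2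

end Rellich

/-- Functions in the Sobolev space are limits of test functions. -/
theorem exists_seq_tendsto_sobolev {ω : Set (ℝ × ℝ)} {f : L2V} (hf : f ∈ sobolev ω) :
    ∃ u : ℕ → testSub ω, Filter.Tendsto (fun n => jetL ω (u n)) Filter.atTop (nhds f) ∧
      ∀ᵐ x, Filter.Tendsto (fun n => jet (u n) x) Filter.atTop (nhds (f x)) := by
  have hf' : f ∈ closure (LinearMap.range (jetL ω) : Set L2V) := by
    rwa [← Submodule.topologicalClosure_coe]
  obtain ⟨g, hg, hlim⟩ := mem_closure_iff_seq_limit.1 hf'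
  choose u hu using hg
  have hlim' : Filter.Tendsto (fun n => jetL ω (u n)) Filter.atTop (nhds f) := by
    simpa only [hu] using hlim
  obtain ⟨ns, hns, hae⟩ := (tendstoInMeasure_of_tendsto_Lp hlim').exists_seq_tendsto_ae
  refine ⟨fun n => u (ns n), hlim'.comp hns.tendsto_atTop, ?_⟩
  have hall : ∀ᵐ x, ∀ n, jetL ω (u (ns n)) x = jet (u (ns n)) x :=
    ae_all_iff.2 fun n => coeFn_jetL (u (ns n))
  filter_upwards [hae, hall] with x hx hx2
  simpa only [hx2] using hx

theorem sobolev_ae_eq_zero {ω : Set (ℝ × ℝ)} {f : L2V} (hf : f ∈ sobolev ω) :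
    ∀ᵐ x, x ∉ ω → f x = 0 := by
  obtain ⟨u, -, hu⟩ := exists_seq_tendsto_sobolev hf
  filter_upwards [hu] with x hx hxω
  refine tendsto_nhds_unique hx ?_
  have : ∀ n, jet (u n) x = 0 := fun n => jet_eq_zero_of_notMem fun h => hxω ((u n).2.2.2 h)
  simp only [this]
  exact tendsto_const_nhds

/-- The vector field used to test weak derivatives. -/
def dualJet (φ ψ₁ ψ₂ : ℝ × ℝ → ℝ) (x : ℝ × ℝ) : E3 := !₂[φ x, ψ₁ x, ψ₂ x]

theorem memLp_dualJet {φ ψ₁ ψ₂ : ℝ × ℝ → ℝ} (h0 : Continuous φ) (h1 : Continuous ψ₁)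
    (h2 : Continuous ψ₂) (c0 : HasCompactSupport φ) (c1 : HasCompactSupport ψ₁)
    (c2 : HasCompactSupport ψ₂) : MemLp (dualJet φ ψ₁ ψ₂) 2 volume := by
  refine Continuous.memLp_of_hasCompactSupport ?_ ?_
  · refine (PiLp.continuous_toLp 2 _).comp (continuous_pi fun i => ?_)
    fin_cases i
    exacts [h0, h1, h2]
  · refine HasCompactSupport.intro ((c0.isCompact.union c1.isCompact).union c2.isCompact) ?_
    intro x hx
    simp only [mem_union, not_or] at hx
    ext i
    fin_cases i <;> simp [dualJet, image_eq_zero_of_notMem_tsupport hx.1.1,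
      image_eq_zero_of_notMem_tsupport hx.1.2, image_eq_zero_of_notMem_tsupport hx.2]

theorem inner_dualJet {φ ψ₁ ψ₂ : ℝ × ℝ → ℝ} (h : MemLp (dualJet φ ψ₁ ψ₂) 2 volume) (f : L2V) :
    inner ℝ f (h.toLp _) = (∫ x, f x 0 * φ x) + (∫ x, f x 1 * ψ₁ x) + ∫ x, f x 2 * ψ₂ x := by
  rw [inner_L2V]
  congr 1
  congr 1
  all_goals
    refine integral_congr_ae ?_
    filter_upwards [h.coeFn_toLp] with x hx
    rw [hx]
    rfl

theorem integral_test_mul_fderiv {u φ : ℝ × ℝ → ℝ} (hu : ContDiff ℝ (⊤ : ℕ∞) u)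
    (hφ : ContDiff ℝ (⊤ : ℕ∞) φ) (hc : HasCompactSupport φ) (v : ℝ × ℝ) :
    ∫ x, u x * fderiv ℝ φ x v = -∫ x, fderiv ℝ u x v * φ x := by
  have hdu : Continuous fun x => fderiv ℝ u x v :=
    (hu.continuous_fderiv (by simp)).clm_apply continuous_const
  have hdφ : Continuous fun x => fderiv ℝ φ x v :=
    (hφ.continuous_fderiv (by simp)).clm_apply continuous_const
  have hcd : HasCompactSupport fun x => fderiv ℝ φ x v := hc.fderiv_apply ℝ v
  refine integral_mul_fderiv_eq_neg_fderiv_mul_of_integrable ?_ ?_ ?_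
    (fun x _ => hu.differentiable (by simp) x) (fun x _ => hφ.differentiable (by simp) x)
  · exact (hdu.mul hφ.continuous).integrable_of_hasCompactSupport hc.mul_left
  · exact (hu.continuous.mul hdφ).integrable_of_hasCompactSupport hcd.mul_left
  · exact (hu.continuous.mul hφ.continuous).integrable_of_hasCompactSupport hc.mul_left

theorem sobolev_weak_fst {ω : Set (ℝ × ℝ)} {f : L2V} (hf : f ∈ sobolev ω) {φ : ℝ × ℝ → ℝ}
    (hφ : ContDiff ℝ (⊤ : ℕ∞) φ) (hc : HasCompactSupport φ) :
    ∫ x, f x 0 * fderiv ℝ φ x (1, 0) = -∫ x, f x 1 * φ x := by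
  have hdφ : Continuous fun x => fderiv ℝ φ x (1, 0) :=
    (hφ.continuous_fderiv (by simp)).clm_apply continuous_const
  have hm := memLp_dualJet hdφ hφ.continuous continuous_zero (hc.fderiv_apply ℝ _) hc .zero
  have := sobolev_induction (ω := ω) (p := fun f => inner ℝ f (hm.toLp _) = 0)
    (isClosed_eq (by fun_prop) continuous_const) ?_ hf
  · simp only [inner_dualJet, Pi.zero_apply, mul_zero, integral_zero, add_zero] at this
    linarith
  · intro u
    have h1 : ∫ x, jetL ω u x 0 * fderiv ℝ φ x (1, 0) =
        ∫ x, (u : ℝ × ℝ → ℝ) x * fderiv ℝ φ x (1, 0) :=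
      integral_congr_ae (by filter_upwards [coeFn_jetL u] with x hx; rw [hx, jet_zero])
    have h2 : ∫ x, jetL ω u x 1 * φ x = ∫ x, fderiv ℝ (u : ℝ × ℝ → ℝ) x (1, 0) * φ x :=
      integral_congr_ae (by filter_upwards [coeFn_jetL u] with x hx; rw [hx, jet_one])
    rw [inner_dualJet, h1, h2, integral_test_mul_fderiv u.2.1 hφ hc]
    simp

theorem sobolev_weak_snd {ω : Set (ℝ × ℝ)} {f : L2V} (hf : f ∈ sobolev ω) {φ : ℝ × ℝ → ℝ}
    (hφ : ContDiff ℝ (⊤ : ℕ∞) φ) (hc : HasCompactSupport φ) :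
    ∫ x, f x 0 * fderiv ℝ φ x (0, 1) = -∫ x, f x 2 * φ x := by
  have hdφ : Continuous fun x => fderiv ℝ φ x (0, 1) :=
    (hφ.continuous_fderiv (by simp)).clm_apply continuous_const
  have hm := memLp_dualJet hdφ continuous_zero hφ.continuous (hc.fderiv_apply ℝ _) .zero hc
  have := sobolev_induction (ω := ω) (p := fun f => inner ℝ f (hm.toLp _) = 0)
    (isClosed_eq (by fun_prop) continuous_const) ?_ hf
  · simp only [inner_dualJet, Pi.zero_apply, mul_zero, integral_zero, add_zero] at this
    linarith
  · intro u
    have h1 : ∫ x, jetL ω u x 0 * fderiv ℝ φ x (0, 1) =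
        ∫ x, (u : ℝ × ℝ → ℝ) x * fderiv ℝ φ x (0, 1) :=
      integral_congr_ae (by filter_upwards [coeFn_jetL u] with x hx; rw [hx, jet_zero])
    have h2 : ∫ x, jetL ω u x 2 * φ x = ∫ x, fderiv ℝ (u : ℝ × ℝ → ℝ) x (0, 1) * φ x :=
      integral_congr_ae (by filter_upwards [coeFn_jetL u] with x hx; rw [hx, jet_two])
    rw [inner_dualJet, h1, h2, integral_test_mul_fderiv u.2.1 hφ hc]
    simp

theorem locallyIntegrable_apply (f : L2V) (i : Fin 3) :
    LocallyIntegrable (fun x => f x i) volume :=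
  (memLp_apply f i).locallyIntegrable (by norm_num)

theorem eq_zero_of_valL_eq_zero {ω : Set (ℝ × ℝ)} {f : L2V} (hf : f ∈ sobolev ω)
    (h : valL f = 0) : f = 0 := by
  have h0 : ∀ᵐ x, f x 0 = 0 := by
    filter_upwards [coeFn_valL f, Lp.coeFn_zero ℝ 2 (volume : Measure (ℝ × ℝ))] with x h1 h2
    rw [← h1, h, h2, Pi.zero_apply]
  have key : ∀ i : Fin 3, (∀ φ : ℝ × ℝ → ℝ, ContDiff ℝ (⊤ : ℕ∞) φ → HasCompactSupport φ →
      ∫ x, f x i * φ x = 0) → ∀ᵐ x, f x i = 0 := by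
    intro i hi
    refine ae_eq_zero_of_integral_contDiff_smul_eq_zero (locallyIntegrable_apply f i) ?_
    intro φ hφ hc
    simpa [mul_comm] using hi φ hφ hc
  have hz : ∀ ψ : ℝ × ℝ → ℝ, ∫ x, f x 0 * ψ x = 0 := fun ψ => by
    rw [← integral_zero (ℝ × ℝ) ℝ (μ := volume)]
    exact integral_congr_ae (by filter_upwards [h0] with x hx; rw [hx, zero_mul])
  have h1 := key 1 fun φ hφ hc => by
    have := sobolev_weak_fst hf hφ hc
    rw [hz] at this
    linarith
  have h2 := key 2 fun φ hφ hc => by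
    have := sobolev_weak_snd hf hφ hc
    rw [hz] at this
    linarith
  refine Lp.ext ?_
  filter_upwards [h0, h1, h2, Lp.coeFn_zero E3 2 (volume : Measure (ℝ × ℝ))] with x h0 h1 h2 h3
  rw [h3]
  ext i
  fin_cases i
  exacts [h0, h1, h2]

/-- The inclusion of the Sobolev space in `L²`. -/
def sobEmb (ω : Set (ℝ × ℝ)) : sobolev ω →L[ℝ] L2R := valL ∘L (sobolev ω).subtypeL

/-- The solution operator `(1 - Δ)⁻¹` on the Sobolev space. -/
def solOp (ω : Set (ℝ × ℝ)) : sobolev ω →L[ℝ] sobolev ω :=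
  (ContinuousLinearMap.adjoint (sobEmb ω)) ∘L sobEmb ω

theorem inner_solOp {ω : Set (ℝ × ℝ)} (f g : sobolev ω) :
    inner ℝ (solOp ω f) g = ∫ x, (f : L2V) x 0 * (g : L2V) x 0 := by
  rw [solOp, ContinuousLinearMap.comp_apply, ContinuousLinearMap.adjoint_inner_left]
  exact inner_valL f g

theorem inner_solOp_self {ω : Set (ℝ × ℝ)} (f : sobolev ω) :
    inner ℝ (solOp ω f) f = ‖valL f‖ ^ 2 := by
  rw [inner_solOp, norm_valL_sq]
  simp only [sq]

theorem isSymmetric_solOp (ω : Set (ℝ × ℝ)) :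
    (solOp ω : sobolev ω →ₗ[ℝ] sobolev ω).IsSymmetric := by
  intro f g
  change inner ℝ (solOp ω f) g = inner ℝ f (solOp ω g)
  rw [← real_inner_comm f]
  rw [inner_solOp, inner_solOp]
  simp only [mul_comm]

theorem isCompactOperator_solOp {ω : Set (ℝ × ℝ)} (hω : Bornology.IsBounded ω) :
    IsCompactOperator (solOp ω) :=
  (isCompactOperator_valL hω).clm_comp (ContinuousLinearMap.adjoint (sobEmb ω))

theorem solOp_pos {ω : Set (ℝ × ℝ)} (f : sobolev ω) (hf : f ≠ 0) :
    0 < inner ℝ (solOp ω f) f := by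
  rw [inner_solOp_self]
  have : valL (f : L2V) ≠ 0 := fun h => hf (Subtype.ext (eq_zero_of_valL_eq_zero f.2 h))
  positivity

theorem jetL_injective (ω : Set (ℝ × ℝ)) : Function.Injective (jetL ω) := by
  rw [← LinearMap.ker_eq_bot, LinearMap.ker_eq_bot']
  intro u hu
  have h : (u : ℝ × ℝ → ℝ) =ᵐ[volume] fun _ => (0 : ℝ) := by
    filter_upwards [coeFn_jetL u, Lp.coeFn_zero E3 2 (volume : Measure (ℝ × ℝ))] with x h1 h2
    rw [← jet_zero u x, ← h1, hu, h2, Pi.zero_apply, PiLp.zero_apply]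
  exact Subtype.ext ((u.2.1.continuous.ae_eq_iff_eq volume continuous_const).1 h)

theorem exists_linearIndependent_testSub {ω : Set (ℝ × ℝ)} (ho : IsOpen ω) (hne : ω.Nonempty)
    (n : ℕ) : ∃ u : Fin n → testSub ω, LinearIndependent ℝ u := by
  have hinf : ω.Infinite := by
    obtain ⟨p, hp⟩ := hne
    exact infinite_of_mem_nhds p (ho.mem_nhds hp)
  set P : ℕ ↪ ω := hinf.natEmbedding
  have hex : ∀ i : Fin n, ∃ u : testSub ω, ∀ j : Fin n,
      (u : ℝ × ℝ → ℝ) (P j) = if j = i then 1 else 0 := by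
    intro i
    set Z : Set (ℝ × ℝ) := (fun j : Fin n => (P j : ℝ × ℝ)) '' {j | j ≠ i} with hZ
    have hZc : IsClosed Z := (Set.toFinite Z).isClosed
    have hmem : ω \ Z ∈ nhds (P i : ℝ × ℝ) := by
      refine (ho.sdiff hZc).mem_nhds ⟨(P i).2, ?_⟩
      rintro ⟨j, hj, h⟩
      exact hj (Fin.ext (P.injective (Subtype.ext h)))
    obtain ⟨f, h1, h2, h3, -, h5⟩ := exists_contDiff_tsupport_subset (n := (⊤ : ℕ∞)) hmem
    refine ⟨⟨f, h3, h2, h1.trans sdiff_subset⟩, fun j => ?_⟩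
    split_ifs with h
    · rw [h]; exact h5
    · exact image_eq_zero_of_notMem_tsupport fun hj => (h1 hj).2 ⟨j, h, rfl⟩
  choose u hu using hex
  refine ⟨u, Fintype.linearIndependent_iff.2 fun g hg i => ?_⟩
  have := congrArg (fun w : testSub ω => (w : ℝ × ℝ → ℝ) (P i)) hg
  simpa [hu] using this

theorem not_finiteDimensional_sobolev {ω : Set (ℝ × ℝ)} (ho : IsOpen ω) (hne : ω.Nonempty) :
    ¬ FiniteDimensional ℝ (sobolev ω) := by
  intro hfin
  obtain ⟨u, hu⟩ := exists_linearIndependent_testSub ho hne (Module.finrank ℝ (sobolev ω) + 1)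
  set J : testSub ω →ₗ[ℝ] sobolev ω := (jetL ω).codRestrict _ jetL_mem_sobolev with hJ
  have hJi : LinearMap.ker J = ⊥ := by
    rw [LinearMap.ker_eq_bot]
    intro a b hab
    exact jetL_injective ω (congrArg Subtype.val hab)
  have := (hu.map' J hJi).fintype_card_le_finrank
  simp at this

theorem setIntegral_testSub {ω : Set (ℝ × ℝ)} {g : ℝ × ℝ → ℝ} (u : testSub ω)
    (h : ∀ x, x ∉ tsupport (u : ℝ × ℝ → ℝ) → g x = 0) : ∫ x in ω, g x = ∫ x, g x :=
  setIntegral_eq_integral_of_forall_compl_eq_zero fun x hx => h x fun hx' => hx (u.2.2.2 hx')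

theorem rayleigh_testSub {ω : Set (ℝ × ℝ)} (u : testSub ω) :
    rayleigh ω u = (‖jetL ω u‖ ^ 2 - ‖valL (jetL ω u)‖ ^ 2) / ‖valL (jetL ω u)‖ ^ 2 := by
  rw [norm_jetL_sq, norm_valL_jetL_sq, rayleigh, setIntegral_testSub u, setIntegral_testSub u,
    add_sub_cancel_left]
  · intro x hx
    simp [image_eq_zero_of_notMem_tsupport hx]
  · intro x hx
    have h := jet_eq_zero_of_notMem hx
    have h1 := congrArg (fun v : E3 => v 1) h
    have h2 := congrArg (fun v : E3 => v 2) h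
    simp only [jet_one, jet_two, PiLp.zero_apply] at h1 h2
    simp [gradSq, h1, h2]

theorem rayleigh_nonneg (ω : Set (ℝ × ℝ)) (u : ℝ × ℝ → ℝ) : 0 ≤ rayleigh ω u :=
  div_nonneg (integral_nonneg fun _ => add_nonneg (sq_nonneg _) (sq_nonneg _))
    (integral_nonneg fun _ => sq_nonneg _)

theorem valL_jetL_ne_zero {ω : Set (ℝ × ℝ)} {u : testSub ω} (hu : u ≠ 0) :
    valL (jetL ω u) ≠ 0 := fun h =>
  hu (jetL_injective ω ((eq_zero_of_valL_eq_zero (jetL_mem_sobolev u) h).trans (map_zero _).symm))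

theorem bddAbove_rayleigh {ω : Set (ℝ × ℝ)} {V : Submodule ℝ ((ℝ × ℝ) → ℝ)}
    (hV : V ≤ testSub ω) [FiniteDimensional ℝ V] :
    BddAbove {r | ∃ u ∈ V, u ≠ 0 ∧ r = rayleigh ω u} := by
  set W : Submodule ℝ L2V := LinearMap.range ((jetL ω).comp (Submodule.inclusion hV)) with hW
  set F : W →ₗ[ℝ] L2R := (valL : L2V →ₗ[ℝ] L2R).comp W.subtype with hF
  have hker : LinearMap.ker F = ⊥ := by
    rw [LinearMap.ker_eq_bot']
    rintro ⟨_, ⟨u, rfl⟩⟩ h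
    exact Subtype.ext (eq_zero_of_valL_eq_zero (jetL_mem_sobolev _) h)
  obtain ⟨K, hK, hA⟩ := LinearMap.exists_antilipschitzWith F hker
  refine ⟨K ^ 2, ?_⟩
  rintro _ ⟨u, hu, hu0, rfl⟩
  have h1 : ‖jetL ω ⟨u, hV hu⟩‖ ≤ K * ‖valL (jetL ω ⟨u, hV hu⟩)‖ :=
    hA.le_mul_norm (map_zero F) (⟨jetL ω ⟨u, hV hu⟩, ⟨⟨u, hu⟩, rfl⟩⟩ : W)
  have hv : valL (jetL ω ⟨u, hV hu⟩) ≠ 0 :=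
    valL_jetL_ne_zero fun h => hu0 (congrArg Subtype.val h)
  have h2 : 0 < ‖valL (jetL ω ⟨u, hV hu⟩)‖ := norm_pos_iff.2 hv
  have h3 := rayleigh_testSub ⟨u, hV hu⟩
  simp only at h3
  rw [h3, div_le_iff₀ (by positivity)]
  have h4 : ‖jetL ω ⟨u, hV hu⟩‖ ^ 2 ≤ (K * ‖valL (jetL ω ⟨u, hV hu⟩)‖) ^ 2 := by gcongr
  nlinarith [sq_nonneg ‖valL (jetL ω ⟨u, hV hu⟩)‖]

/-- The jet map into the Sobolev space. -/
def sobJet (ω : Set (ℝ × ℝ)) : testSub ω →ₗ[ℝ] sobolev ω :=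
  (jetL ω).codRestrict _ jetL_mem_sobolev

theorem dense_range_sobJet (ω : Set (ℝ × ℝ)) : Dense (Set.range (sobJet ω)) := by
  intro f
  obtain ⟨u, hu, -⟩ := exists_seq_tendsto_sobolev f.2
  exact mem_closure_of_tendsto (tendsto_subtype_rng.2 hu)
    (Filter.Eventually.of_forall fun n => ⟨u n, rfl⟩)

theorem le_dirichletEV {ω : Set (ℝ × ℝ)} (ho : IsOpen ω) (hne : ω.Nonempty) {n : ℕ}
    {e : ℕ → sobolev ω} {m : ℝ} (hm : 0 < m)
    (hmax : ∀ x, (∀ j < n, inner ℝ (e j) x = 0) → inner ℝ (solOp ω x) x ≤ m * ‖x‖ ^ 2) :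
    1 / m - 1 ≤ dirichletEV ω (n + 1) := by
  refine le_csInf ?_ ?_
  · obtain ⟨u, hu⟩ := exists_linearIndependent_testSub ho hne (n + 1)
    have hu' : LinearIndependent ℝ fun i => (u i : ℝ × ℝ → ℝ) :=
      hu.map' (testSub ω).subtype (Submodule.ker_subtype _)
    refine ⟨_, Submodule.span ℝ (Set.range fun i => (u i : ℝ × ℝ → ℝ)), ?_, ?_, rfl⟩
    · have : Submodule.span ℝ (Set.range fun i => (u i : ℝ × ℝ → ℝ)) ≤ testSub ω :=
        Submodule.span_le.2 (by rintro _ ⟨i, rfl⟩; exact (u i).2)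
      exact this
    · rw [finrank_span_eq_card hu', Fintype.card_fin]
  · rintro _ ⟨V, hV, hfin, rfl⟩
    have hV' : V ≤ testSub ω := hV
    have : FiniteDimensional ℝ V := Module.finite_of_finrank_pos (by omega)
    set F : V →ₗ[ℝ] (Fin n → ℝ) := LinearMap.pi fun i =>
      (innerₗ (sobolev ω) (e i)).comp ((sobJet ω).comp (Submodule.inclusion hV')) with hF
    obtain ⟨u, hu0, hu⟩ := exists_ne_zero_of_lt_finrank F (by omega)
    set u' : testSub ω := Submodule.inclusion hV' u with hu'
    have hu'0 : u' ≠ 0 := fun h =>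
      hu0 (Subtype.ext (congrArg (fun w : testSub ω => (w : ℝ × ℝ → ℝ)) h))
    have h1 := hmax (sobJet ω u') fun j hj => congrFun hu ⟨j, hj⟩
    rw [inner_solOp_self] at h1
    have h2 : 0 < ‖valL (jetL ω u')‖ ^ 2 := by
      have := valL_jetL_ne_zero hu'0
      positivity
    have h3 : ‖valL (jetL ω u')‖ ^ 2 ≤ m * ‖jetL ω u'‖ ^ 2 := h1
    refine le_trans ?_ (le_csSup (bddAbove_rayleigh hV')
      ⟨u, u.2, fun h => hu0 (Subtype.ext h), rfl⟩)
    have h4 : rayleigh ω u = _ := rayleigh_testSub u'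
    rw [h4, sub_div, div_self h2.ne', sub_le_sub_iff_right, div_le_div_iff₀ hm h2]
    linarith

theorem dirichletEV_two_le {ω : Set (ℝ × ℝ)} {e₀ e₁ : sobolev ω} {a₀ a₁ : ℝ}
    (h₀ : solOp ω e₀ = a₀ • e₀) (h₁ : solOp ω e₁ = a₁ • e₁) (n₀ : ‖e₀‖ = 1) (n₁ : ‖e₁‖ = 1)
    (h₀₁ : inner ℝ e₀ e₁ = 0) (ha : a₁ ≤ a₀) {δ : ℝ} (hδ : 0 < δ) (hδa : δ < a₁) :
    dirichletEV ω 2 ≤ 1 / (a₁ - δ) - 1 := by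
  obtain ⟨_, ⟨u₀, rfl⟩, _, ⟨u₁, rfl⟩, hd⟩ :=
    exists_approx_pair (solOp ω) (dense_range_sobJet ω) h₀ h₁ n₀ n₁ h₀₁ ha hδ
  have hb : BddBelow {l | ∃ V : Submodule ℝ ((ℝ × ℝ) → ℝ),
      (V : Set ((ℝ × ℝ) → ℝ)) ⊆ {u | testFun ω u} ∧ Module.finrank ℝ V = 2 ∧
      l = sSup {r | ∃ u ∈ V, u ≠ 0 ∧ r = rayleigh ω u}} := by
    refine ⟨0, ?_⟩
    rintro _ ⟨V, -, -, rfl⟩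
    refine Real.sSup_nonneg ?_
    rintro _ ⟨u, -, -, rfl⟩
    exact rayleigh_nonneg _ _
  have hli : LinearIndependent ℝ ![u₀, u₁] := by
    rw [LinearIndependent.pair_iff]
    intro a b hab
    have h := (hd a b).1
    rw [← map_smul, ← map_smul, ← map_add, hab, map_zero, norm_zero] at h
    constructor <;> nlinarith [sq_nonneg a, sq_nonneg b]
  have hli' : LinearIndependent ℝ ((testSub ω).subtype ∘ ![u₀, u₁]) :=
    hli.map' (testSub ω).subtype (Submodule.ker_subtype _)
  set V := Submodule.span ℝ (Set.range ((testSub ω).subtype ∘ ![u₀, u₁])) with hVdef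
  have hV : V ≤ testSub ω := Submodule.span_le.2 (by rintro _ ⟨i, rfl⟩; exact (![u₀, u₁] i).2)
  have hVfin : Module.finrank ℝ V = 2 := by rw [finrank_span_eq_card hli', Fintype.card_fin]
  have : FiniteDimensional ℝ V := Module.finite_of_finrank_pos (by omega)
  refine (csInf_le hb ⟨V, hV, hVfin, rfl⟩).trans ?_
  refine csSup_le ⟨_, u₀, Submodule.subset_span ⟨0, rfl⟩, ?_, rfl⟩ ?_
  · intro h
    exact hli.ne_zero 0 (Subtype.ext h)
  · rintro _ ⟨u, hu, hu0, rfl⟩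
    have hu2 := hu
    rw [hVdef, show Set.range ((testSub ω).subtype ∘ ![u₀, u₁]) =
      {(u₀ : ℝ × ℝ → ℝ), (u₁ : ℝ × ℝ → ℝ)} by
        ext x; simp [Fin.exists_fin_two, eq_comm], Submodule.mem_span_pair] at hu2
    obtain ⟨a, b, hab⟩ := hu2
    set u' : testSub ω := a • u₀ + b • u₁ with hu'
    have hu'u : (u' : ℝ × ℝ → ℝ) = u := by rw [← hab]; rfl
    have h := (hd a b).2
    rw [← map_smul, ← map_smul, ← map_add, ← hu', inner_solOp_self] at h
    have h3 : (a₁ - δ) * ‖jetL ω u'‖ ^ 2 ≤ ‖valL (jetL ω u')‖ ^ 2 := h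
    have h2 : 0 < ‖valL (jetL ω u')‖ ^ 2 := by
      have : u' ≠ 0 := by
        rintro h
        rw [h] at hu'u
        exact hu0 hu'u.symm
      have := valL_jetL_ne_zero this
      positivity
    rw [← hu'u, rayleigh_testSub u', sub_div, div_self h2.ne', sub_le_sub_iff_right,
      div_le_div_iff₀ h2 (by linarith)]
    linarith

/-- If the fifth eigenvalue does not exceed the second one, then the second largest eigenvalue
of the solution operator has a four dimensional space of eigenvectors. -/
theorem exists_eigenvectors_of_le {ω : Set (ℝ × ℝ)} (ho : IsOpen ω) (hne : ω.Nonempty)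
    (hb : Bornology.IsBounded ω) (h : dirichletEV ω 5 ≤ dirichletEV ω 2) :
    ∃ (e : Fin 4 → sobolev ω) (e₀ : sobolev ω) (a m : ℝ), 0 < m ∧ m ≤ 1 ∧ solOp ω e₀ = a • e₀ ∧
      (∀ x, inner ℝ e₀ x = 0 → inner ℝ (solOp ω x) x ≤ m * ‖x‖ ^ 2) ∧
      LinearIndependent ℝ e ∧ (∀ i, inner ℝ e₀ (e i) = 0) ∧ ∀ i, solOp ω (e i) = m • e i := by
  obtain ⟨e, μ, hn, ho', hμ, hmax⟩ := exists_leading_eigenvectors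
    (not_finiteDimensional_sobolev ho hne) (solOp ω) (isCompactOperator_solOp hb)
    (isSymmetric_solOp ω) solOp_pos 5
  have hval : ∀ i < 5, inner ℝ (solOp ω (e i)) (e i) = μ i := fun i hi => by
    rw [hμ i hi, inner_smul_left, real_inner_self_eq_norm_sq, hn i hi]; simp
  have hne0 : ∀ i < 5, e i ≠ 0 := fun i hi h0 => by
    have := hn i hi
    rw [h0, norm_zero] at this
    exact zero_ne_one this
  have hpos : ∀ i < 5, 0 < μ i := fun i hi => by
    rw [← hval i hi]; exact solOp_pos _ (hne0 i hi)
  have hanti : ∀ i < 5, ∀ j ≤ i, μ i ≤ μ j := fun i hi j hj => by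
    have := hmax j (by omega) (e i) fun k hk => ho' i hi k (by omega)
    rwa [hval i hi, hn i hi, one_pow, mul_one] at this
  have h5 := le_dirichletEV ho hne (n := 4) (hpos 4 (by norm_num)) (hmax 4 (by norm_num))
  have h14 : μ 1 ≤ μ 4 := by
    by_contra! hlt
    set δ := (μ 1 - μ 4) / 2 with hδ
    have h4 := hpos 4 (by norm_num)
    have h2 := dirichletEV_two_le (hμ 0 (by norm_num)) (hμ 1 (by norm_num)) (hn 0 (by norm_num))
      (hn 1 (by norm_num)) (ho' 1 (by norm_num) 0 (by norm_num))
      (hanti 1 (by norm_num) 0 (by norm_num))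
      (δ := δ) (by linarith) (by linarith)
    have h6 : 1 / (μ 1 - δ) < 1 / μ 4 := one_div_lt_one_div_of_lt h4 (by linarith)
    norm_num at h5
    norm_num at h2 h6
    linarith
  have heq : ∀ i < 5, 1 ≤ i → μ i = μ 1 := fun i hi h1 =>
    le_antisymm (hanti i hi 1 h1) (h14.trans (hanti 4 (by norm_num) i (by omega)))
  refine ⟨fun i => e (i + 1), e 0, μ 0, μ 1, hpos 1 (by norm_num), ?_, hμ 0 (by norm_num), ?_, ?_,
    fun i => ho' _ (by omega) 0 (by omega), fun i => ?_⟩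
  · rw [← hval 1 (by norm_num), inner_solOp_self]
    refine (norm_valL_le _).trans ?_
    have : ‖(e 1 : L2V)‖ = 1 := hn 1 (by norm_num)
    rw [this, one_pow]
  · intro x hx
    refine hmax 1 (by norm_num) x fun j hj => ?_
    obtain rfl : j = 0 := by omega
    exact hx
  · have hon : Orthonormal ℝ fun i : Fin 4 => e (i + 1) := by
      refine ⟨fun i => hn _ (by omega), fun i j hij => ?_⟩
      rcases lt_or_gt_of_ne hij with hlt | hlt
      · exact ho' _ (by omega) _ (by have : (i : ℕ) < j := hlt; omega)
      · rw [real_inner_comm]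
        exact ho' _ (by omega) _ (by have : (j : ℕ) < i := hlt; omega)
    exact hon.linearIndependent
  · rw [hμ _ (by omega), heq _ (by omega) (by omega)]

section ParametricIntegral

variable {E G : Type} [NormedAddCommGroup E] [NormedSpace ℝ E] [FiniteDimensional ℝ E]
  [NormedAddCommGroup G] [NormedSpace ℝ G]

theorem hasFDerivAt_parametric_integral {F : E × ℝ → G} (hF : ContDiff ℝ 1 F) (a b : ℝ) (p₀ : E) :
    HasFDerivAt (fun p => ∫ s in a..b, F (p, s))
      (∫ s in a..b, (fderiv ℝ F (p₀, s)).comp (ContinuousLinearMap.inl ℝ E ℝ)) p₀ := by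
  have : ProperSpace E := FiniteDimensional.proper ℝ E
  have hF' : Continuous fun q : E × ℝ =>
      (fderiv ℝ F q).comp (ContinuousLinearMap.inl ℝ E ℝ) :=
    (hF.continuous_fderiv one_ne_zero).clm_comp continuous_const
  obtain ⟨B, hB⟩ := ((isCompact_closedBall p₀ 1).prod
    (isCompact_uIcc (a := a) (b := b))).exists_bound_of_continuousOn hF'.continuousOn
  refine intervalIntegral.hasFDerivAt_integral_of_dominated_of_fderiv_le
    (F' := fun p s => (fderiv ℝ F (p, s)).comp (ContinuousLinearMap.inl ℝ E ℝ))
    (bound := fun _ => B) (Metric.ball_mem_nhds p₀ one_pos)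
    (Filter.Eventually.of_forall fun p => ?_) ?_ ?_ ?_ ?_ ?_
  · exact (hF.continuous.comp (by fun_prop : Continuous fun s : ℝ => (p, s))).aestronglyMeasurable
  · exact (hF.continuous.comp
      (by fun_prop : Continuous fun s : ℝ => (p₀, s))).intervalIntegrable _ _
  · exact (hF'.comp (by fun_prop : Continuous fun s : ℝ => (p₀, s))).aestronglyMeasurable
  · refine Filter.Eventually.of_forall fun s hs p hp => ?_
    exact hB (p, s) ⟨Metric.ball_subset_closedBall hp, uIoc_subset_uIcc hs⟩
  · exact intervalIntegrable_const
  · refine Filter.Eventually.of_forall fun s _ p _ => ?_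
    exact ((hF.differentiable one_ne_zero (p, s)).hasFDerivAt).comp p (hasFDerivAt_prodMk_left p s)

theorem contDiff_parametric_integral_nat (n : ℕ) : ∀ {G : Type} [NormedAddCommGroup G]
    [NormedSpace ℝ G] [CompleteSpace G] {F : E × ℝ → G} (_ : ContDiff ℝ (⊤ : ℕ∞) F) (a b : ℝ),
    ContDiff ℝ n fun p => ∫ s in a..b, F (p, s) := by
  induction n with
  | zero =>
    intro G _ _ _ F hF a b
    refine contDiff_zero.2 ?_
    exact continuous_iff_continuousAt.2 fun p =>
      (hasFDerivAt_parametric_integral (hF.of_le (by exact_mod_cast le_top)) a b p).continuousAt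
  | succ n ih =>
    intro G _ _ _ F hF a b
    have h1 := fun p => hasFDerivAt_parametric_integral (hF.of_le (by exact_mod_cast le_top)) a b p
    push_cast
    refine contDiff_succ_iff_hasFDerivAt.2 ⟨_, ?_, h1⟩
    refine ih (F := fun q => (fderiv ℝ F q).comp (ContinuousLinearMap.inl ℝ E ℝ)) ?_ a b
    exact (hF.fderiv_right (m := (⊤ : ℕ∞)) (by simp)).clm_comp contDiff_const

theorem contDiff_parametric_integral [CompleteSpace G] {F : E × ℝ → G}
    (hF : ContDiff ℝ (⊤ : ℕ∞) F) (a b : ℝ) :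
    ContDiff ℝ (⊤ : ℕ∞) fun p => ∫ s in a..b, F (p, s) :=
  contDiff_infty.2 fun n => contDiff_parametric_integral_nat n hF a b

end ParametricIntegral

section Kernel

/-- A smooth cutoff function of the square of the radius. -/
def cutoff (σ : ℝ) : ℝ := Real.smoothTransition (1 - σ)

theorem contDiff_cutoff : ContDiff ℝ (⊤ : ℕ∞) cutoff :=
  Real.smoothTransition.contDiff.comp (contDiff_const.sub contDiff_id)

theorem cutoff_of_one_le {σ : ℝ} (h : 1 ≤ σ) : cutoff σ = 0 :=
  Real.smoothTransition.zero_of_nonpos (by linarith)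

theorem contDiff_deriv_cutoff : ContDiff ℝ (⊤ : ℕ∞) (deriv cutoff) :=
  (contDiff_infty_iff_deriv.1 contDiff_cutoff).2

theorem antitone_cutoff : Antitone cutoff := fun _ _ h =>
  Real.smoothTransition.monotone (by linarith)

theorem deriv_cutoff_nonpos (σ : ℝ) : deriv cutoff σ ≤ 0 := antitone_cutoff.deriv_nonpos

theorem deriv_cutoff_of_one_le {σ : ℝ} (h : 1 ≤ σ) : deriv cutoff σ = 0 := by
  have h1 : IsLocalMin cutoff σ := Filter.Eventually.of_forall fun t => by
    rw [cutoff_of_one_le h]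
    exact Real.smoothTransition.nonneg _
  exact h1.deriv_eq_zero

theorem exists_deriv_cutoff_eq : ∃ σ : ℝ, 0 < σ ∧ deriv cutoff σ = -1 := by
  obtain ⟨σ, hσ, h⟩ := exists_deriv_eq_slope cutoff one_pos contDiff_cutoff.continuous.continuousOn
    (contDiff_cutoff.differentiable (by simp)).differentiableOn
  refine ⟨σ, hσ.1, ?_⟩
  rw [h, cutoff_of_one_le le_rfl, cutoff, sub_zero, Real.smoothTransition.one]
  norm_num

/-- The integrand of `lift`. -/
def liftIntegrand (μ : ℝ) (a ψ : ℝ → ℝ) (p : (ℝ × ℝ × ℝ) × ℝ) : ℝ :=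
  a p.2 * Real.exp (μ * p.1.1 * p.2) * ψ (p.1.2.1 ^ 2 + p.1.2.2 ^ 2 + p.2 ^ 2)

/-- Integral over the third variable of a radial function with an exponential weight. -/
def liftInt (μ : ℝ) (a ψ : ℝ → ℝ) (p : ℝ × ℝ × ℝ) : ℝ :=
  ∫ s in (-1 : ℝ)..1, liftIntegrand μ a ψ (p, s)

variable {μ : ℝ} {a ψ : ℝ → ℝ}

theorem contDiff_liftIntegrand (ha : ContDiff ℝ (⊤ : ℕ∞) a) (hψ : ContDiff ℝ (⊤ : ℕ∞) ψ) :
    ContDiff ℝ (⊤ : ℕ∞) (liftIntegrand μ a ψ) := by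
  unfold liftIntegrand
  fun_prop

theorem contDiff_liftInt (ha : ContDiff ℝ (⊤ : ℕ∞) a) (hψ : ContDiff ℝ (⊤ : ℕ∞) ψ) :
    ContDiff ℝ (⊤ : ℕ∞) (liftInt μ a ψ) :=
  contDiff_parametric_integral (contDiff_liftIntegrand ha hψ) _ _

theorem fderiv_liftIntegrand (ha : ContDiff ℝ (⊤ : ℕ∞) a) (hψ : ContDiff ℝ (⊤ : ℕ∞) ψ)
    (p v : ℝ × ℝ × ℝ) (s : ℝ) : fderiv ℝ (liftIntegrand μ a ψ) (p, s) (v, 0) =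
      v.1 * liftIntegrand μ (fun s => μ * s * a s) ψ (p, s) +
      2 * (p.2.1 * v.2.1 + p.2.2 * v.2.2) * liftIntegrand μ a (deriv ψ) (p, s) := by
  have hd : DifferentiableAt ℝ (liftIntegrand μ a ψ) (p, s) :=
    (contDiff_liftIntegrand ha hψ).differentiable (by simp) _
  rw [← hd.lineDeriv_eq_fderiv]
  refine HasLineDerivAt.lineDeriv ?_
  have hψd : HasDerivAt ψ (deriv ψ (p.2.1 ^ 2 + p.2.2 ^ 2 + s ^ 2))
      ((p.2.1 + 0 * v.2.1) ^ 2 + (p.2.2 + 0 * v.2.2) ^ 2 + s ^ 2) := by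
    simpa using (hψ.differentiable (by simp) (p.2.1 ^ 2 + p.2.2 ^ 2 + s ^ 2)).hasDerivAt
  have h1 : HasDerivAt (fun t : ℝ => (p.2.1 + t * v.2.1) ^ 2 + (p.2.2 + t * v.2.2) ^ 2 + s ^ 2)
      (2 * (p.2.1 * v.2.1 + p.2.2 * v.2.2)) 0 := by
    have ha := ((hasDerivAt_id (0 : ℝ)).mul_const v.2.1).const_add p.2.1
    have hb := ((hasDerivAt_id (0 : ℝ)).mul_const v.2.2).const_add p.2.2
    refine (((ha.fun_pow 2).fun_add (hb.fun_pow 2)).add_const (s ^ 2)).congr_deriv ?_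
    simp only [id]
    ring
  have h2 : HasDerivAt (fun t : ℝ => a s * Real.exp (μ * (p.1 + t * v.1) * s))
      (a s * (Real.exp (μ * p.1 * s) * (μ * v.1 * s))) 0 := by
    have ha := ((((hasDerivAt_id (0 : ℝ)).mul_const v.1).const_add p.1).const_mul μ).mul_const s
    refine (ha.exp.const_mul (a s)).congr_deriv ?_
    simp only [id]
    ring_nf
  have h3 := h2.fun_mul (hψd.comp (0 : ℝ) h1)
  unfold HasLineDerivAt
  have h4 : (fun t : ℝ => liftIntegrand μ a ψ ((p, s) + t • (v, 0))) = fun t =>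
      a s * Real.exp (μ * (p.1 + t * v.1) * s) *
        (ψ ∘ fun t => (p.2.1 + t * v.2.1) ^ 2 + (p.2.2 + t * v.2.2) ^ 2 + s ^ 2) t := by
    ext t
    simp [liftIntegrand]
  rw [h4]
  refine h3.congr_deriv ?_
  simp only [liftIntegrand, Function.comp_apply, zero_mul, add_zero]
  ring

theorem fderiv_liftInt (ha : ContDiff ℝ (⊤ : ℕ∞) a) (hψ : ContDiff ℝ (⊤ : ℕ∞) ψ)
    (p v : ℝ × ℝ × ℝ) : fderiv ℝ (liftInt μ a ψ) p v =
      v.1 * liftInt μ (fun s => μ * s * a s) ψ p +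
      2 * (p.2.1 * v.2.1 + p.2.2 * v.2.2) * liftInt μ a (deriv ψ) p := by
  have hψ' : ContDiff ℝ (⊤ : ℕ∞) (deriv ψ) := (contDiff_infty_iff_deriv.1 hψ).2
  have ha' : ContDiff ℝ (⊤ : ℕ∞) fun s => μ * s * a s := by fun_prop
  have hF := contDiff_liftIntegrand (μ := μ) ha hψ
  have hc1 : ∀ {a ψ : ℝ → ℝ} (_ : ContDiff ℝ (⊤ : ℕ∞) a) (_ : ContDiff ℝ (⊤ : ℕ∞) ψ),
      IntervalIntegrable (fun s => liftIntegrand μ a ψ (p, s)) volume (-1) 1 := fun ha hψ =>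
    ((contDiff_liftIntegrand ha hψ).continuous.comp
      (by fun_prop : Continuous fun s : ℝ => (p, s))).intervalIntegrable _ _
  have hF' : Continuous fun s : ℝ =>
      (fderiv ℝ (liftIntegrand μ a ψ) (p, s)).comp (ContinuousLinearMap.inl ℝ (ℝ × ℝ × ℝ) ℝ) :=
    ((hF.continuous_fderiv (by simp)).comp (by fun_prop : Continuous fun s : ℝ => (p, s))).clm_comp
      continuous_const
  have h := hasFDerivAt_parametric_integral (hF.of_le (by exact_mod_cast le_top)) (-1) 1 p
  have h' : HasFDerivAt (liftInt μ a ψ) _ p := h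
  rw [h'.fderiv, ContinuousLinearMap.intervalIntegral_apply (hF'.intervalIntegrable _ _)]
  simp only [ContinuousLinearMap.comp_apply, ContinuousLinearMap.inl_apply,
    fderiv_liftIntegrand ha hψ]
  rw [intervalIntegral.integral_add ((hc1 ha' hψ).const_mul _) ((hc1 ha hψ').const_mul _),
    intervalIntegral.integral_const_mul, intervalIntegral.integral_const_mul]
  rfl

theorem liftInt_eq_zero (hψ : ∀ σ, 1 ≤ σ → ψ σ = 0) {p : ℝ × ℝ × ℝ} (hp : 1 ≤ ‖p.2‖) :
    liftInt μ a ψ p = 0 := by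
  have h : 1 ≤ p.2.1 ^ 2 + p.2.2 ^ 2 := by
    rw [Prod.norm_def] at hp
    rcases le_max_iff.1 hp with h | h
    · have : 1 ≤ p.2.1 ^ 2 := by rw [← sq_abs]; exact one_le_pow₀ h
      nlinarith [sq_nonneg p.2.2]
    · have : 1 ≤ p.2.2 ^ 2 := by rw [← sq_abs]; exact one_le_pow₀ h
      nlinarith [sq_nonneg p.2.1]
  have : ∀ s, liftIntegrand μ a ψ (p, s) = 0 := fun s => by
    rw [liftIntegrand, hψ _ (by simp only; nlinarith [sq_nonneg s]), mul_zero]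
  simp [liftInt, this]

/-- Integration by parts in the third variable. -/
theorem liftInt_mul_deriv_cutoff (p : ℝ × ℝ × ℝ) :
    2 * p.1 * liftInt μ (fun s => μ * s * 1) (deriv cutoff) p =
      -(μ * p.1) ^ 2 * liftInt μ (fun _ => 1) cutoff p := by
  set ρ := p.2.1 ^ 2 + p.2.2 ^ 2 with hρ
  have hρ0 : 0 ≤ ρ := by positivity
  have hu : ∀ s : ℝ, HasDerivAt (fun s => Real.exp (μ * p.1 * s))
      (Real.exp (μ * p.1 * s) * (μ * p.1)) s := fun s => by
    simpa using ((hasDerivAt_id s).const_mul (μ * p.1)).exp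
  have hv : ∀ s : ℝ, HasDerivAt (fun s => cutoff (ρ + s ^ 2))
      (deriv cutoff (ρ + s ^ 2) * (2 * s)) s := by
    intro s
    have h1 : HasDerivAt (fun s : ℝ => ρ + s ^ 2) (2 * s) s := by
      simpa using ((hasDerivAt_id s).fun_pow 2).const_add ρ
    exact ((contDiff_cutoff.differentiable (by simp) _).hasDerivAt).comp s h1
  have hdc := contDiff_deriv_cutoff.continuous
  have h := intervalIntegral.integral_mul_deriv_eq_deriv_mul (a := -1) (b := 1)
    (fun s _ => hu s) (fun s _ => hv s)
    ((by fun_prop : Continuous fun s => Real.exp (μ * p.1 * s) * (μ * p.1)).intervalIntegrable _ _)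
    ((by fun_prop : Continuous fun s => deriv cutoff (ρ + s ^ 2) * (2 * s)).intervalIntegrable _ _)
  rw [cutoff_of_one_le (by linarith), cutoff_of_one_le (by linarith)] at h
  simp only [mul_zero, sub_zero, zero_sub] at h
  have e1 : 2 * liftInt μ (fun s => μ * s * 1) (deriv cutoff) p = μ *
      ∫ s in (-1 : ℝ)..1, Real.exp (μ * p.1 * s) * (deriv cutoff (ρ + s ^ 2) * (2 * s)) := by
    rw [liftInt, ← intervalIntegral.integral_const_mul, ← intervalIntegral.integral_const_mul]
    refine intervalIntegral.integral_congr fun s _ => ?_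
    simp only [liftIntegrand, hρ]
    ring
  have e2 : μ * p.1 * liftInt μ (fun _ => 1) cutoff p =
      ∫ s in (-1 : ℝ)..1, Real.exp (μ * p.1 * s) * (μ * p.1) * cutoff (ρ + s ^ 2) := by
    rw [liftInt, ← intervalIntegral.integral_const_mul]
    refine intervalIntegral.integral_congr fun s _ => ?_
    simp only [liftIntegrand, hρ]
    ring
  rw [mul_comm 2 p.1, mul_assoc, e1, h, ← e2]
  ring

end Kernel

/-- The Laplacian on the plane. -/
def lap (g : ℝ × ℝ → ℝ) (x : ℝ × ℝ) : ℝ :=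
  fderiv ℝ (fun y => fderiv ℝ g y (1, 0)) x (1, 0) +
    fderiv ℝ (fun y => fderiv ℝ g y (0, 1)) x (0, 1)

section Kernel

/-- A mollifying kernel at scale `exp τ`, whose convolution with a solution of `Δ u + μ² u = 0`
does not depend on the scale. -/
def ker (μ τ : ℝ) (x : ℝ × ℝ) : ℝ :=
  Real.exp (-τ) ^ 2 * (-2 * liftInt μ (fun _ => 1) (deriv cutoff) (Real.exp τ, Real.exp (-τ) • x))

/-- The potential with `∂_τ ker = Δ pot + μ² pot`. -/
def pot (μ τ : ℝ) (x : ℝ × ℝ) : ℝ :=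
  liftInt μ (fun _ => 1) cutoff (Real.exp τ, Real.exp (-τ) • x)

variable {μ : ℝ} {a ψ : ℝ → ℝ}

theorem contDiff_ker_uncurry (μ : ℝ) :
    ContDiff ℝ (⊤ : ℕ∞) fun p : ℝ × ℝ × ℝ => ker μ p.1 p.2 := by
  have h := contDiff_liftInt (μ := μ) (contDiff_const (c := (1 : ℝ))) contDiff_deriv_cutoff
  have h2 : ContDiff ℝ (⊤ : ℕ∞) fun p : ℝ × ℝ × ℝ => liftInt μ (fun _ => 1) (deriv cutoff)
      (Real.exp p.1, Real.exp (-p.1) • p.2) := h.comp (by fun_prop)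
  unfold ker
  fun_prop

theorem contDiff_ker (μ τ : ℝ) : ContDiff ℝ (⊤ : ℕ∞) (ker μ τ) :=
  (contDiff_ker_uncurry μ).comp (contDiff_const.prodMk contDiff_id)

theorem contDiff_pot (μ τ : ℝ) : ContDiff ℝ (⊤ : ℕ∞) (pot μ τ) := by
  have h := contDiff_liftInt (μ := μ) (contDiff_const (c := (1 : ℝ))) contDiff_cutoff
  exact h.comp (by fun_prop : ContDiff ℝ (⊤ : ℕ∞) fun x : ℝ × ℝ => (Real.exp τ, Real.exp (-τ) • x))

theorem one_le_norm_exp_smul {τ : ℝ} {x : ℝ × ℝ} (h : Real.exp τ ≤ ‖x‖) :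
    1 ≤ ‖Real.exp (-τ) • x‖ := by
  rw [norm_smul, Real.norm_of_nonneg (Real.exp_pos _).le, Real.exp_neg, ← div_eq_inv_mul,
    one_le_div (Real.exp_pos _)]
  exact h

theorem ker_eq_zero {τ : ℝ} {x : ℝ × ℝ} (h : Real.exp τ ≤ ‖x‖) : ker μ τ x = 0 := by
  rw [ker, liftInt_eq_zero (fun _ => deriv_cutoff_of_one_le) (one_le_norm_exp_smul h)]
  simp

theorem pot_eq_zero {τ : ℝ} {x : ℝ × ℝ} (h : Real.exp τ ≤ ‖x‖) : pot μ τ x = 0 :=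
  liftInt_eq_zero (fun _ => cutoff_of_one_le) (one_le_norm_exp_smul h)

theorem fderiv_liftInt_smul (ha : ContDiff ℝ (⊤ : ℕ∞) a) (hψ : ContDiff ℝ (⊤ : ℕ∞) ψ)
    (e c : ℝ) (x v : ℝ × ℝ) : fderiv ℝ (fun x : ℝ × ℝ => liftInt μ a ψ (e, c • x)) x v =
      2 * c ^ 2 * (x.1 * v.1 + x.2 * v.2) * liftInt μ a (deriv ψ) (e, c • x) := by
  have h1 : HasFDerivAt (fun x : ℝ × ℝ => (e, c • x))
      ((0 : (ℝ × ℝ) →L[ℝ] ℝ).prod (c • ContinuousLinearMap.id ℝ (ℝ × ℝ))) x :=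
    (hasFDerivAt_const e x).prodMk ((hasFDerivAt_id x).const_smul c)
  have h2 := (((contDiff_liftInt (μ := μ) ha hψ).differentiable (by simp)
    (e, c • x)).hasFDerivAt).comp x h1
  have h3 : (fun x : ℝ × ℝ => liftInt μ a ψ (e, c • x)) =
    liftInt μ a ψ ∘ fun x : ℝ × ℝ => (e, c • x) := rfl
  rw [h3, h2.fderiv, ContinuousLinearMap.comp_apply, fderiv_liftInt ha hψ]
  simp only [ContinuousLinearMap.prod_apply, zero_apply,
    smul_apply, ContinuousLinearMap.id_apply, Prod.smul_fst, Prod.smul_snd,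
    smul_eq_mul]
  ring

theorem lap_pot (μ τ : ℝ) (x : ℝ × ℝ) : lap (pot μ τ) x = Real.exp (-τ) ^ 2 *
    (4 * liftInt μ (fun _ => 1) (deriv cutoff) (Real.exp τ, Real.exp (-τ) • x) +
      4 * Real.exp (-τ) ^ 2 * (x.1 ^ 2 + x.2 ^ 2) *
        liftInt μ (fun _ => 1) (deriv (deriv cutoff)) (Real.exp τ, Real.exp (-τ) • x)) := by
  have hc := contDiff_const (𝕜 := ℝ) (E := ℝ) (n := (⊤ : ℕ∞)) (c := (1 : ℝ))
  have h1 := fderiv_liftInt_smul (μ := μ) hc contDiff_cutoff (Real.exp τ) (Real.exp (-τ))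
  have h2 := fderiv_liftInt_smul (μ := μ) hc contDiff_deriv_cutoff (Real.exp τ) (Real.exp (-τ))
  have hd : DifferentiableAt ℝ (fun x : ℝ × ℝ => liftInt μ (fun _ => 1) (deriv cutoff)
      (Real.exp τ, Real.exp (-τ) • x)) x :=
    ((contDiff_liftInt (μ := μ) hc contDiff_deriv_cutoff).comp
      (by fun_prop : ContDiff ℝ (⊤ : ℕ∞)
        fun x : ℝ × ℝ => (Real.exp τ, Real.exp (-τ) • x))).differentiable (by simp) x
  unfold lap pot
  simp only [h1]
  have key : ∀ v : ℝ × ℝ, fderiv ℝ (fun y : ℝ × ℝ =>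
      2 * Real.exp (-τ) ^ 2 * (y.1 * v.1 + y.2 * v.2) *
      liftInt μ (fun _ => 1) (deriv cutoff) (Real.exp τ, Real.exp (-τ) • y)) x v =
      2 * Real.exp (-τ) ^ 2 * ((v.1 ^ 2 + v.2 ^ 2) *
        liftInt μ (fun _ => 1) (deriv cutoff) (Real.exp τ, Real.exp (-τ) • x) +
        2 * Real.exp (-τ) ^ 2 * (x.1 * v.1 + x.2 * v.2) ^ 2 *
        liftInt μ (fun _ => 1) (deriv (deriv cutoff)) (Real.exp τ, Real.exp (-τ) • x)) := by
    intro v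
    have h3 : HasFDerivAt (fun y : ℝ × ℝ => 2 * Real.exp (-τ) ^ 2 * (y.1 * v.1 + y.2 * v.2))
        ((2 * Real.exp (-τ) ^ 2) • (v.1 • ContinuousLinearMap.fst ℝ ℝ ℝ +
          v.2 • ContinuousLinearMap.snd ℝ ℝ ℝ)) x :=
      (((hasFDerivAt_fst).mul_const v.1).add ((hasFDerivAt_snd).mul_const v.2)).const_mul _
    rw [(h3.fun_mul hd.hasFDerivAt).fderiv]
    simp [h2]
    ring
  have k1 := key (1, 0)
  have k2 := key (0, 1)
  simp only at k1 k2
  rw [k1, k2]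
  ring

theorem hasDerivAt_ker (μ τ : ℝ) (x : ℝ × ℝ) : HasDerivAt (fun τ => ker μ τ x)
    (lap (pot μ τ) x + μ ^ 2 * pot μ τ x) τ := by
  have hc := contDiff_const (𝕜 := ℝ) (E := ℝ) (n := (⊤ : ℕ∞)) (c := (1 : ℝ))
  have hd := ((contDiff_liftInt (μ := μ) hc contDiff_deriv_cutoff).differentiable (by simp)
    (Real.exp τ, Real.exp (-τ) • x)).hasFDerivAt
  have he := (hasDerivAt_neg τ).exp
  have h1 := hd.comp_hasDerivAt τ ((Real.hasDerivAt_exp τ).prodMk (he.smul_const x))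
  have h2 := (he.fun_pow 2).fun_mul (h1.const_mul (-2))
  refine h2.congr_deriv ?_
  rw [lap_pot, fderiv_liftInt hc contDiff_deriv_cutoff, pot]
  have h3 := liftInt_mul_deriv_cutoff (μ := μ) (Real.exp τ, Real.exp (-τ) • x)
  have h4 : Real.exp (-τ) * Real.exp τ = 1 := by rw [← Real.exp_add]; simp
  simp only [Function.comp_apply, Prod.smul_fst, Prod.smul_snd, smul_eq_mul] at h3 ⊢
  have h5 : Real.exp (-τ) ^ 2 * (μ * Real.exp τ) ^ 2 = μ ^ 2 := by
    linear_combination μ ^ 2 * (Real.exp (-τ) * Real.exp τ + 1) * h4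
  rw [← h5]
  linear_combination (-(Real.exp (-τ)) ^ 2) * h3

theorem ker_neg (μ τ : ℝ) (x : ℝ × ℝ) : ker μ τ (-x) = ker μ τ x := by
  simp [ker, liftInt, liftIntegrand]

theorem ker_sub_comm (μ τ : ℝ) (x y : ℝ × ℝ) : ker μ τ (x - y) = ker μ τ (y - x) := by
  rw [← ker_neg, neg_sub]

/-- The scaled kernel is bounded by the inverse square of the scale. -/
theorem exists_abs_ker_le (μ : ℝ) :
    ∃ C, 0 < C ∧ ∀ τ ≤ 0, ∀ x, |ker μ τ x| ≤ C * Real.exp (-τ) ^ 2 := by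
  have hc := contDiff_const (𝕜 := ℝ) (E := ℝ) (n := (⊤ : ℕ∞)) (c := (1 : ℝ))
  have hL := (contDiff_liftInt (μ := μ) hc contDiff_deriv_cutoff).continuous
  obtain ⟨C, hC⟩ := ((isCompact_Icc (a := (0 : ℝ)) (b := 1)).prod
    (isCompact_closedBall (0 : ℝ × ℝ) 1)).exists_bound_of_continuousOn hL.continuousOn
  refine ⟨2 * |C| + 1, by positivity, fun τ hτ x => ?_⟩
  have hτ' : Real.exp τ ≤ 1 := Real.exp_le_one_iff.2 hτ
  rcases le_or_gt 1 ‖Real.exp (-τ) • x‖ with h | h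
  · rw [ker, liftInt_eq_zero (fun _ => deriv_cutoff_of_one_le) h]
    simp
    positivity
  · have h1 := hC (Real.exp τ, Real.exp (-τ) • x) ⟨⟨(Real.exp_pos _).le, hτ'⟩, by simpa using h.le⟩
    rw [ker, abs_mul, abs_mul, abs_of_nonneg (sq_nonneg _), mul_comm]
    rw [Real.norm_eq_abs] at h1
    have := le_abs_self C
    rw [abs_neg, abs_two]
    gcongr
    linarith

theorem exists_abs_fderiv_ker_le (μ : ℝ) : ∃ C, 0 < C ∧ ∀ τ ≤ 0, ∀ x v,
    |fderiv ℝ (ker μ τ) x v| ≤ C * ‖v‖ * Real.exp (-τ) ^ 3 := by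
  have hc := contDiff_const (𝕜 := ℝ) (E := ℝ) (n := (⊤ : ℕ∞)) (c := (1 : ℝ))
  have hL := contDiff_liftInt (μ := μ) hc contDiff_deriv_cutoff
  have hL' : Continuous fun p => liftInt μ (fun _ => 1) (deriv (deriv cutoff)) p :=
    (contDiff_liftInt (μ := μ) hc (contDiff_infty_iff_deriv.1 contDiff_deriv_cutoff).2).continuous
  obtain ⟨C, hC⟩ := ((isCompact_Icc (a := (0 : ℝ)) (b := 1)).prod
    (isCompact_closedBall (0 : ℝ × ℝ) 1)).exists_bound_of_continuousOn hL'.continuousOn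
  have hz : ∀ σ : ℝ, 1 ≤ σ → deriv (deriv cutoff) σ = 0 := fun σ h => by
    have h1 : IsLocalMax (deriv cutoff) σ := Filter.Eventually.of_forall fun t => by
      rw [deriv_cutoff_of_one_le h]
      exact deriv_cutoff_nonpos t
    exact h1.deriv_eq_zero
  refine ⟨8 * |C| + 1, by positivity, fun τ hτ x v => ?_⟩
  have hτ' : Real.exp τ ≤ 1 := Real.exp_le_one_iff.2 hτ
  have hfd : fderiv ℝ (ker μ τ) x v = -4 * Real.exp (-τ) ^ 3 *
      ((Real.exp (-τ) • x).1 * v.1 + (Real.exp (-τ) • x).2 * v.2) *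
      liftInt μ (fun _ => 1) (deriv (deriv cutoff)) (Real.exp τ, Real.exp (-τ) • x) := by
    have hd : DifferentiableAt ℝ (fun x : ℝ × ℝ => liftInt μ (fun _ => 1) (deriv cutoff)
      (Real.exp τ, Real.exp (-τ) • x)) x :=
      (hL.comp (by fun_prop : ContDiff ℝ (⊤ : ℕ∞) fun x : ℝ × ℝ =>
        (Real.exp τ, Real.exp (-τ) • x))).differentiable (by simp) x
    have h2 := (hd.hasFDerivAt.const_mul (-2)).const_mul (Real.exp (-τ) ^ 2)
    have h3 : HasFDerivAt (ker μ τ) _ x := h2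
    rw [h3.fderiv]
    simp [fderiv_liftInt_smul (μ := μ) hc contDiff_deriv_cutoff]
    ring
  rcases le_or_gt 1 ‖Real.exp (-τ) • x‖ with h | h
  · rw [hfd, liftInt_eq_zero hz h]
    simp
    positivity
  · have h1 := hC (Real.exp τ, Real.exp (-τ) • x) ⟨⟨(Real.exp_pos _).le, hτ'⟩, by simpa using h.le⟩
    rw [Real.norm_eq_abs] at h1
    rw [hfd]
    set z := Real.exp (-τ) • x
    have hz1 : |z.1| ≤ 1 := (norm_fst_le z).trans h.le
    have hz2 : |z.2| ≤ 1 := (norm_snd_le z).trans h.le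
    have hv1 : |v.1| ≤ ‖v‖ := norm_fst_le v
    have hv2 : |v.2| ≤ ‖v‖ := norm_snd_le v
    have hs : |z.1 * v.1 + z.2 * v.2| ≤ 2 * ‖v‖ := by
      refine (abs_add_le _ _).trans ?_
      rw [abs_mul, abs_mul]
      nlinarith [abs_nonneg v.1, abs_nonneg v.2, abs_nonneg z.1, abs_nonneg z.2]
    rw [abs_mul, abs_mul, abs_mul, abs_neg, abs_of_pos (by positivity : (0:ℝ) < Real.exp (-τ) ^ 3),
      abs_of_pos (by norm_num : (0 : ℝ) < 4)]
    calc 4 * Real.exp (-τ) ^ 3 * |z.1 * v.1 + z.2 * v.2| * _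
        ≤ 4 * Real.exp (-τ) ^ 3 * (2 * ‖v‖) * |C| :=
          mul_le_mul (by gcongr) (h1.trans (le_abs_self C)) (abs_nonneg _) (by positivity)
      _ ≤ (8 * |C| + 1) * ‖v‖ * Real.exp (-τ) ^ 3 := by
          have : 0 ≤ ‖v‖ * Real.exp (-τ) ^ 3 := by positivity
          nlinarith

theorem hasCompactSupport_ker (μ τ : ℝ) : HasCompactSupport (ker μ τ) :=
  HasCompactSupport.of_support_subset_isCompact (isCompact_closedBall (0 : ℝ × ℝ) (Real.exp τ))
    fun x hx => by
      by_contra h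
      exact hx (ker_eq_zero (le_of_not_ge (by simpa using h)))

/-- The total mass of the kernel in the limit of small scales. -/
def kerMass (μ : ℝ) : ℝ := ∫ z : ℝ × ℝ, -2 * liftInt μ (fun _ => 1) (deriv cutoff) (0, z)

theorem kerMass_pos (μ : ℝ) : 0 < kerMass μ := by
  have hc := contDiff_const (𝕜 := ℝ) (E := ℝ) (n := (⊤ : ℕ∞)) (c := (1 : ℝ))
  have hL := (contDiff_liftInt (μ := μ) hc contDiff_deriv_cutoff).continuous
  have hneg : ∀ p : ℝ × ℝ × ℝ, ∀ s,
      0 ≤ -2 * liftIntegrand μ (fun _ => 1) (deriv cutoff) (p, s) := by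
    intro p s
    rw [liftIntegrand]
    have := mul_nonneg (Real.exp_pos (μ * p.1 * s)).le
      (neg_nonneg.2 (deriv_cutoff_nonpos (p.2.1 ^ 2 + p.2.2 ^ 2 + s ^ 2)))
    simp only [one_mul]
    linarith
  have hig : ∀ p : ℝ × ℝ × ℝ, -2 * liftInt μ (fun _ => 1) (deriv cutoff) p =
      ∫ s in (-1 : ℝ)..1, -2 * liftIntegrand μ (fun _ => 1) (deriv cutoff) (p, s) := fun p => by
    rw [intervalIntegral.integral_const_mul, liftInt]
  obtain ⟨σ, hσ, hσ'⟩ := exists_deriv_cutoff_eq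
  refine Continuous.integral_pos_of_hasCompactSupport_nonneg_nonzero (x := (Real.sqrt σ, 0))
    (by fun_prop) ?_ ?_ ?_
  · refine HasCompactSupport.of_support_subset_isCompact (isCompact_closedBall (0 : ℝ × ℝ) 1)
      fun x hx => ?_
    by_contra h
    refine hx ?_
    simp only
    rw [liftInt_eq_zero (fun _ => deriv_cutoff_of_one_le)]
    · simp
    · simpa using (le_of_not_ge (by simpa using h) : (1 : ℝ) ≤ ‖x‖)
  · intro z
    simp only [Pi.zero_apply]
    rw [hig]
    exact intervalIntegral.integral_nonneg (by norm_num) fun s _ => hneg _ s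
  · rw [hig]
    refine (intervalIntegral.integral_pos (by norm_num) ?_ (fun s _ => hneg _ s)
      ⟨0, by norm_num, ?_⟩).ne'
    · have := (contDiff_liftIntegrand (μ := μ) hc contDiff_deriv_cutoff).continuous
      fun_prop
    · simp [liftIntegrand, Real.sq_sqrt hσ.le, hσ']

theorem integral_ker (μ τ : ℝ) : ∫ x, ker μ τ x =
    ∫ z : ℝ × ℝ, -2 * liftInt μ (fun _ => 1) (deriv cutoff) (Real.exp τ, z) := by
  unfold ker
  rw [integral_const_mul, Measure.integral_comp_smul volume (fun z : ℝ × ℝ =>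
    -2 * liftInt μ (fun _ => 1) (deriv cutoff) (Real.exp τ, z))]
  have : 0 < Real.exp (-τ) := Real.exp_pos _
  rw [show Module.finrank ℝ (ℝ × ℝ) = 2 by simp, abs_of_pos (by positivity), smul_eq_mul,
    ← mul_assoc, mul_inv_cancel₀ (by positivity), one_mul]

theorem tendsto_integral_ker (μ : ℝ) :
    Filter.Tendsto (fun τ => ∫ x, ker μ τ x) Filter.atBot (nhds (kerMass μ)) := by
  have hc := contDiff_const (𝕜 := ℝ) (E := ℝ) (n := (⊤ : ℕ∞)) (c := (1 : ℝ))
  have hL := (contDiff_liftInt (μ := μ) hc contDiff_deriv_cutoff).continuous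
  have h1 : ∀ e : ℝ, ∫ z : ℝ × ℝ, -2 * liftInt μ (fun _ => 1) (deriv cutoff) (e, z) =
      ∫ z in Metric.closedBall (0 : ℝ × ℝ) 1,
        -2 * liftInt μ (fun _ => 1) (deriv cutoff) (e, z) := by
    intro e
    refine (setIntegral_eq_integral_of_forall_compl_eq_zero fun z hz => ?_).symm
    rw [liftInt_eq_zero (fun _ => deriv_cutoff_of_one_le), mul_zero]
    simpa using (le_of_not_ge (by simpa using hz) : (1 : ℝ) ≤ ‖z‖)
  have h2 : Continuous fun e : ℝ => ∫ z in Metric.closedBall (0 : ℝ × ℝ) 1,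
      -2 * liftInt μ (fun _ => 1) (deriv cutoff) (e, z) :=
    continuous_parametric_integral_of_continuous
      (by simp only [Function.uncurry_def]; fun_prop) (isCompact_closedBall _ _)
  simp only [integral_ker, kerMass, h1]
  exact (h2.tendsto 0).comp Real.tendsto_exp_atBot

end Kernel

section Regularity

variable {μ : ℝ} {f : ℝ × ℝ → ℝ} {U : Set (ℝ × ℝ)}

/-- `f` solves `Δ f + μ² f = 0` on `U` in the sense of distributions. -/
def IsWeakSol (μ : ℝ) (f : ℝ × ℝ → ℝ) (U : Set (ℝ × ℝ)) : Prop :=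
  ∀ φ, testFun U φ → ∫ x, f x * (lap φ x + μ ^ 2 * φ x) = 0

theorem IsWeakSol.mono {V : Set (ℝ × ℝ)} (h : IsWeakSol μ f U) (hV : V ⊆ U) : IsWeakSol μ f V :=
  fun φ hφ => h φ ⟨hφ.1, hφ.2.1, hφ.2.2.trans hV⟩

theorem lap_comp_sub (g : ℝ × ℝ → ℝ) (x y : ℝ × ℝ) :
    lap (fun y => g (y - x)) y = lap g (y - x) := by
  unfold lap
  have h : ∀ v : ℝ × ℝ, (fun y => fderiv ℝ (fun y => g (y - x)) y v) =
      fun y => (fun z => fderiv ℝ g z v) (y - x) := fun v => by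
    ext y
    rw [fderiv_comp_sub]
  rw [h, h, fderiv_comp_sub (f := fun z => fderiv ℝ g z (1, 0)),
    fderiv_comp_sub (f := fun z => fderiv ℝ g z (0, 1))]

theorem contDiff_fderiv_apply {g : ℝ × ℝ → ℝ} (hg : ContDiff ℝ (⊤ : ℕ∞) g) (v : ℝ × ℝ) :
    ContDiff ℝ (⊤ : ℕ∞) fun x => fderiv ℝ g x v :=
  (hg.fderiv_right (m := (⊤ : ℕ∞)) (by simp)).clm_apply contDiff_const

theorem contDiff_lap {g : ℝ × ℝ → ℝ} (hg : ContDiff ℝ (⊤ : ℕ∞) g) : ContDiff ℝ (⊤ : ℕ∞) (lap g) :=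
  (contDiff_fderiv_apply (contDiff_fderiv_apply hg _) _).add
    (contDiff_fderiv_apply (contDiff_fderiv_apply hg _) _)

theorem testFun_translate {g : ℝ × ℝ → ℝ} (hg : ContDiff ℝ (⊤ : ℕ∞) g) {ε : ℝ}
    (h0 : ∀ x, ε ≤ ‖x‖ → g x = 0) (x : ℝ × ℝ) {r : ℝ} (hr : ε < r) :
    testFun (Metric.ball x r) fun y => g (y - x) := by
  have hs : tsupport (fun y => g (y - x)) ⊆ Metric.closedBall x ε := by
    refine closure_minimal (fun y hy => ?_) Metric.isClosed_closedBall
    by_contra h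
    refine hy (h0 _ ?_)
    rw [← dist_eq_norm]
    exact le_of_not_ge (by simpa using h)
  exact ⟨hg.comp (contDiff_id.sub contDiff_const),
    (isCompact_closedBall x ε).of_isClosed_subset (isClosed_tsupport _) hs,
    hs.trans (Metric.closedBall_subset_ball hr)⟩

theorem hasDerivAt_integral_mul_ker (hf : LocallyIntegrable f) {x : ℝ × ℝ} {r : ℝ}
    (hw : IsWeakSol μ f (Metric.ball x r)) {τ : ℝ} (hτ : Real.exp τ < r) :
    HasDerivAt (fun τ => ∫ y, f y * ker μ τ (y - x)) 0 τ := by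
  have hpot := testFun_translate (contDiff_pot μ τ) (fun _ => pot_eq_zero) x hτ
  have h0 := hw _ hpot
  have hK := (contDiff_ker_uncurry μ)
  have hder : ∀ τ' x', HasDerivAt (fun τ => ker μ τ x')
      (lap (pot μ τ') x' + μ ^ 2 * pot μ τ' x') τ' :=
    fun τ' x' => hasDerivAt_ker μ τ' x'
  have hdc : Continuous fun p : ℝ × ℝ × ℝ => lap (pot μ p.1) p.2 + μ ^ 2 * pot μ p.1 p.2 := by
    have h1 : (fun p : ℝ × ℝ × ℝ => lap (pot μ p.1) p.2 + μ ^ 2 * pot μ p.1 p.2) =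
        fun p => fderiv ℝ (fun p : ℝ × ℝ × ℝ => ker μ p.1 p.2) p (1, 0) := by
      ext p
      have h2 := ((hK.differentiable (by simp) p).hasFDerivAt).comp_hasDerivAt p.1
        ((hasDerivAt_id p.1).prodMk (hasDerivAt_const p.1 p.2))
      exact (hder p.1 p.2).unique h2
    rw [h1]
    exact (hK.continuous_fderiv (by simp)).clm_apply continuous_const
  obtain ⟨B, hB⟩ := ((isCompact_closedBall τ 1).prod
    (isCompact_closedBall (0 : ℝ × ℝ) (Real.exp (τ + 1)))).exists_bound_of_continuousOn
    hdc.continuousOn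
  have hz : ∀ τ' ∈ Metric.ball τ 1, ∀ z : ℝ × ℝ,
      z ∉ Metric.closedBall (0 : ℝ × ℝ) (Real.exp (τ + 1)) →
      lap (pot μ τ') z + μ ^ 2 * pot μ τ' z = 0 := by
    intro τ' hτ' z hz
    have hlt : Real.exp τ' < ‖z‖ := by
      have h1 : Real.exp (τ + 1) < ‖z‖ := by simpa using hz
      refine lt_of_le_of_lt (Real.exp_le_exp.2 ?_) h1
      have := (abs_lt.1 (by simpa [Real.dist_eq] using hτ' : |τ' - τ| < 1)).2
      linarith
    have h2 : (fun τ => ker μ τ z) =ᶠ[nhds τ'] fun _ => 0 := by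
      filter_upwards [Real.continuous_exp.continuousAt.eventually (gt_mem_nhds hlt)] with t ht
      exact ker_eq_zero (le_of_lt ht)
    exact (hder τ' z).unique ((hasDerivAt_const τ' (0 : ℝ)).congr_of_eventuallyEq h2)
  have hcont : ∀ τ, Continuous fun y => ker μ τ (y - x) := fun τ =>
    (contDiff_ker μ τ).continuous.comp (by fun_prop)
  have hsupp : ∀ τ, HasCompactSupport fun y => ker μ τ (y - x) := fun τ =>
    (testFun_translate (contDiff_ker μ τ) (fun _ => ker_eq_zero) x (lt_add_one _)).2.1
  have hig : ∀ τ, Integrable fun y => f y * ker μ τ (y - x) := fun τ =>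
    hf.integrable_smul_right_of_hasCompactSupport (hcont τ) (hsupp τ)
  have key := hasDerivAt_integral_of_dominated_loc_of_deriv_le (μ := (volume : Measure (ℝ × ℝ)))
    (F := fun τ y => f y * ker μ τ (y - x))
    (F' := fun τ y => f y * (lap (pot μ τ) (y - x) + μ ^ 2 * pot μ τ (y - x)))
    (bound := fun y => (Metric.closedBall x (Real.exp (τ + 1))).indicator (fun y => ‖f y‖ * |B|) y)
    (x₀ := τ) (Metric.ball_mem_nhds τ one_pos)
    (Filter.Eventually.of_forall fun τ => (hig τ).aestronglyMeasurable) (hig τ) ?_ ?_ ?_ ?_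
  · have h1 := key.2
    have h2 : ∫ y, f y * (lap (pot μ τ) (y - x) + μ ^ 2 * pot μ τ (y - x)) = 0 := by
      simpa only [lap_comp_sub] using h0
    rwa [h2] at h1
  · have h1 := (contDiff_lap (contDiff_pot μ τ)).continuous
    have h2 := (contDiff_pot μ τ).continuous
    have h3 : Continuous fun y => lap (pot μ τ) (y - x) + μ ^ 2 * pot μ τ (y - x) := by fun_prop
    exact hf.aestronglyMeasurable.mul h3.aestronglyMeasurable
  · refine Filter.Eventually.of_forall fun y τ' hτ' => ?_
    by_cases hy : y ∈ Metric.closedBall x (Real.exp (τ + 1))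
    · rw [indicator_of_mem hy, norm_mul]
      refine mul_le_mul_of_nonneg_left ?_ (norm_nonneg _)
      refine (hB (τ', y - x) ⟨Metric.ball_subset_closedBall hτ', ?_⟩).trans (le_abs_self B)
      simpa [dist_eq_norm] using hy
    · rw [indicator_of_notMem hy, hz τ' hτ' _ (by simpa [dist_eq_norm] using hy)]
      simp
  · exact IntegrableOn.integrable_indicator (f := fun y => ‖f y‖ * |B|)
      ((hf.integrableOn_isCompact (isCompact_closedBall _ _)).norm.mul_const |B|)
      measurableSet_closedBall
  · exact Filter.Eventually.of_forall fun y τ' _ => (hder τ' (y - x)).const_mul (f y)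

theorem measureReal_closedBall_prod (x : ℝ × ℝ) {ε : ℝ} (hε : 0 ≤ ε) :
    volume.real (Metric.closedBall x ε) = 4 * ε ^ 2 := by
  rw [← closedBall_prod_same, Measure.volume_eq_prod, Measure.real, Measure.prod_prod]
  rw [Real.volume_closedBall, Real.volume_closedBall, ENNReal.toReal_mul,
    ENNReal.toReal_ofReal (by positivity)]
  ring

theorem tendsto_integral_mul_ker (hf : LocallyIntegrable f) {x : ℝ × ℝ}
    (hx : Filter.Tendsto (fun ε : ℝ => ⨍ y in Metric.closedBall x ε, ‖f y - f x‖)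
      (nhdsWithin 0 (Ioi 0)) (nhds 0)) :
    Filter.Tendsto (fun τ => ∫ y, f y * ker μ τ (y - x)) Filter.atBot
      (nhds (f x * kerMass μ)) := by
  obtain ⟨C, hC0, hC⟩ := exists_abs_ker_le μ
  have hcont : ∀ τ, Continuous fun y => ker μ τ (y - x) := fun τ =>
    (contDiff_ker μ τ).continuous.comp (by fun_prop)
  have hsupp : ∀ τ, HasCompactSupport fun y => ker μ τ (y - x) := fun τ =>
    (testFun_translate (contDiff_ker μ τ) (fun _ => ker_eq_zero) x (lt_add_one _)).2.1
  have hig : ∀ τ, Integrable fun y => f y * ker μ τ (y - x) := fun τ =>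
    hf.integrable_smul_right_of_hasCompactSupport (hcont τ) (hsupp τ)
  have hf' : LocallyIntegrable fun y => f y - f x := hf.sub (locallyIntegrable_const _)
  have hig' : ∀ τ, Integrable fun y => (f y - f x) * ker μ τ (y - x) := fun τ =>
    hf'.integrable_smul_right_of_hasCompactSupport (hcont τ) (hsupp τ)
  have hdec : ∀ τ, ∫ y, f y * ker μ τ (y - x) =
      (∫ y, (f y - f x) * ker μ τ (y - x)) + f x * ∫ y, ker μ τ y := by
    intro τ
    rw [← integral_sub_right_eq_self (fun y => ker μ τ y) x, ← integral_const_mul,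
      ← integral_add (f := fun y => (f y - f x) * ker μ τ (y - x)) (hig' τ)
        (((hcont τ).integrable_of_hasCompactSupport (hsupp τ)).const_mul (f x))]
    refine integral_congr_ae (Filter.Eventually.of_forall fun y => ?_)
    simp only
    ring
  have hsmall : Filter.Tendsto (fun τ => ∫ y, (f y - f x) * ker μ τ (y - x)) Filter.atBot
      (nhds 0) := by
    have h1 : Filter.Tendsto (fun τ : ℝ => 4 * C *
        ⨍ y in Metric.closedBall x (Real.exp τ), ‖f y - f x‖) Filter.atBot (nhds 0) := by
      have := (hx.comp (tendsto_nhdsWithin_iff.2 ⟨Real.tendsto_exp_atBot,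
        Filter.Eventually.of_forall fun τ => Real.exp_pos τ⟩)).const_mul (4 * C)
      simpa using this
    refine squeeze_zero_norm' ?_ h1
    filter_upwards [Filter.eventually_le_atBot 0] with τ hτ
    have h2 : ∫ y, (f y - f x) * ker μ τ (y - x) =
        ∫ y in Metric.closedBall x (Real.exp τ), (f y - f x) * ker μ τ (y - x) := by
      refine (setIntegral_eq_integral_of_forall_compl_eq_zero fun y hy => ?_).symm
      rw [ker_eq_zero, mul_zero]
      rw [← dist_eq_norm]
      exact le_of_not_ge (by simpa using hy)
    rw [h2, setAverage_eq, measureReal_closedBall_prod _ (Real.exp_pos τ).le, smul_eq_mul]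
    have hif : IntegrableOn (fun y => ‖f y - f x‖) (Metric.closedBall x (Real.exp τ)) :=
      (hf'.integrableOn_isCompact (isCompact_closedBall _ _)).norm
    have h3 : ‖∫ y in Metric.closedBall x (Real.exp τ), (f y - f x) * ker μ τ (y - x)‖ ≤
        ∫ y in Metric.closedBall x (Real.exp τ), ‖f y - f x‖ * (C * Real.exp (-τ) ^ 2) := by
      refine norm_integral_le_of_norm_le (hif.mul_const _) (Filter.Eventually.of_forall fun y => ?_)
      rw [norm_mul]
      exact mul_le_mul_of_nonneg_left (hC τ hτ _) (norm_nonneg _)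
    refine h3.trans (le_of_eq ?_)
    rw [integral_mul_const, Real.exp_neg]
    field_simp
  have := hsmall.add ((tendsto_integral_ker μ).const_mul (f x))
  simpa [hdec] using this

theorem integral_mul_ker_const (hf : LocallyIntegrable f) {x : ℝ × ℝ} {r : ℝ}
    (hw : IsWeakSol μ f (Metric.ball x r)) {τ t : ℝ} (hτ : Real.exp τ < r) (ht : Real.exp t < r) :
    ∫ y, f y * ker μ t (y - x) = ∫ y, f y * ker μ τ (y - x) := by
  have hr : 0 < r := (Real.exp_pos τ).trans hτ
  have hd : ∀ t ∈ Iio (Real.log r), HasDerivAt (fun τ => ∫ y, f y * ker μ τ (y - x)) 0 t :=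
    fun t ht => hasDerivAt_integral_mul_ker hf hw ((Real.lt_log_iff_exp_lt hr).1 ht)
  exact isOpen_Iio.is_const_of_deriv_eq_zero isPreconnected_Iio
    (fun t ht => (hd t ht).differentiableAt.differentiableWithinAt) (fun t ht => (hd t ht).deriv)
    ((Real.lt_log_iff_exp_lt hr).2 ht) ((Real.lt_log_iff_exp_lt hr).2 hτ)

theorem tendsto_integral_mul_ker_of_isWeakSol (hf : LocallyIntegrable f) {x : ℝ × ℝ} {r : ℝ}
    (hw : IsWeakSol μ f (Metric.ball x r)) {τ : ℝ} (hτ : Real.exp τ < r) :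
    Filter.Tendsto (fun t => ∫ y, f y * ker μ t (y - x)) Filter.atBot
      (nhds (∫ y, f y * ker μ τ (y - x))) := by
  refine tendsto_const_nhds.congr' ?_
  filter_upwards [Real.tendsto_exp_atBot.eventually (gt_mem_nhds ((Real.exp_pos τ).trans hτ))]
    with t ht
  exact integral_mul_ker_const hf hw ht hτ

/-- Mean value property: the mollification of a weak solution reproduces it. -/
theorem integral_mul_ker_eq (hf : LocallyIntegrable f) {x : ℝ × ℝ} {r : ℝ}
    (hx : Filter.Tendsto (fun ε : ℝ => ⨍ y in Metric.closedBall x ε, ‖f y - f x‖)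
      (nhdsWithin 0 (Ioi 0)) (nhds 0))
    (hw : IsWeakSol μ f (Metric.ball x r)) {τ : ℝ} (hτ : Real.exp τ < r) :
    ∫ y, f y * ker μ τ (y - x) = f x * kerMass μ :=
  tendsto_nhds_unique (tendsto_integral_mul_ker_of_isWeakSol hf hw hτ)
    (tendsto_integral_mul_ker hf hx)

theorem tendsto_average_of_continuousAt {x : ℝ × ℝ} (hx : ContinuousAt f x) :
    Filter.Tendsto (fun ε : ℝ => ⨍ y in Metric.closedBall x ε, ‖f y - f x‖)
      (nhdsWithin 0 (Ioi 0)) (nhds 0) := by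
  rw [Metric.tendsto_nhds]
  intro δ hδ
  obtain ⟨ρ, hρ, h⟩ := Metric.continuousAt_iff.1 hx (δ / 2) (by positivity)
  filter_upwards [Ioo_mem_nhdsGT hρ] with ε hε
  rw [dist_zero_right, setAverage_eq, measureReal_closedBall_prod _ hε.1.le, smul_eq_mul, norm_mul]
  have h1 : ‖∫ y in Metric.closedBall x ε, ‖f y - f x‖‖ ≤ δ / 2 * (4 * ε ^ 2) := by
    rw [← measureReal_closedBall_prod x hε.1.le]
    refine norm_setIntegral_le_of_norm_le_const measure_closedBall_lt_top fun y hy => ?_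
    rw [norm_norm, ← dist_eq_norm]
    exact (h (lt_of_le_of_lt hy hε.2)).le
  have h2 : 0 < 4 * ε ^ 2 := by have := hε.1; positivity
  rw [Real.norm_of_nonneg (inv_pos.2 h2).le]
  calc _ ≤ (4 * ε ^ 2)⁻¹ * (δ / 2 * (4 * ε ^ 2)) := by gcongr
    _ = δ / 2 := by
      have := hε.1.ne'
      field_simp
    _ < δ := by linarith

end Regularity

section Regularity

variable {μ : ℝ} {f g w : ℝ × ℝ → ℝ} {U : Set (ℝ × ℝ)}

theorem fderiv_fderiv_comm (hg : ContDiff ℝ (⊤ : ℕ∞) g) (a b x : ℝ × ℝ) :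
    fderiv ℝ (fun y => fderiv ℝ g y a) x b = fderiv ℝ (fun y => fderiv ℝ g y b) x a := by
  have h1 : Differentiable ℝ (fderiv ℝ g) :=
    (hg.fderiv_right (m := (⊤ : ℕ∞)) (by simp)).differentiable (by simp)
  have h2 : ∀ a b, fderiv ℝ (fun y => fderiv ℝ g y a) x b = fderiv ℝ (fderiv ℝ g) x b a := by
    intro a b
    rw [fderiv_clm_apply (h1 x) (differentiableAt_const a)]
    simp
  rw [h2, h2]
  have h3 : IsSymmSndFDerivAt ℝ g x := (hg.contDiffAt).isSymmSndFDerivAt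
    (by simpa using WithTop.coe_le_coe.2 (le_top : (2 : ℕ∞) ≤ ⊤))
  exact h3 b a

theorem lap_fderiv_apply (hg : ContDiff ℝ (⊤ : ℕ∞) g) (v x : ℝ × ℝ) :
    lap (fun y => fderiv ℝ g y v) x = fderiv ℝ (lap g) x v := by
  have hd : ∀ a, DifferentiableAt ℝ (fun y => fderiv ℝ (fun z => fderiv ℝ g z a) y a) x := fun a =>
    (contDiff_fderiv_apply (contDiff_fderiv_apply hg _) _).differentiable (by simp) x
  have h1 : lap g = fun y => fderiv ℝ (fun z => fderiv ℝ g z (1, 0)) y (1, 0) +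
    fderiv ℝ (fun z => fderiv ℝ g z (0, 1)) y (0, 1) := rfl
  rw [h1, fderiv_fun_add (hd _) (hd _), add_apply]
  have h2 : ∀ a, fderiv ℝ (fun y => fderiv ℝ (fun z => fderiv ℝ g z v) y a) x a =
      fderiv ℝ (fun y => fderiv ℝ (fun z => fderiv ℝ g z a) y a) x v := by
    intro a
    rw [show (fun y => fderiv ℝ (fun z => fderiv ℝ g z v) y a) =
      fun y => fderiv ℝ (fun z => fderiv ℝ g z a) y v from
        funext fun y => fderiv_fderiv_comm hg v a y]
    exact fderiv_fderiv_comm (contDiff_fderiv_apply hg a) v a x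
  rw [lap, h2, h2]

theorem HasCompactSupport.lap (hg : HasCompactSupport g) : HasCompactSupport (lap g) :=
  ((hg.fderiv_apply ℝ _).fderiv_apply ℝ _).add ((hg.fderiv_apply ℝ _).fderiv_apply ℝ _)

theorem integral_mul_lap (hw : ContDiff ℝ (⊤ : ℕ∞) w) (hg : ContDiff ℝ (⊤ : ℕ∞) g)
    (hc : HasCompactSupport g) : ∫ x, w x * lap g x = ∫ x, lap w x * g x := by
  have hi : ∀ {a b : ℝ × ℝ → ℝ}, ContDiff ℝ (⊤ : ℕ∞) a → ContDiff ℝ (⊤ : ℕ∞) b →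
      HasCompactSupport b → Integrable fun x => a x * b x := fun ha hb hc =>
    (ha.continuous.mul hb.continuous).integrable_of_hasCompactSupport hc.mul_left
  have h1 : ∀ v, ∫ x, w x * fderiv ℝ (fun y => fderiv ℝ g y v) x v =
      ∫ x, fderiv ℝ (fun y => fderiv ℝ w y v) x v * g x := by
    intro v
    rw [integral_test_mul_fderiv hw (contDiff_fderiv_apply hg v) (hc.fderiv_apply ℝ v),
      integral_test_mul_fderiv (contDiff_fderiv_apply hw v) hg hc, neg_neg]
  have hg2 := fun v => contDiff_fderiv_apply (contDiff_fderiv_apply hg v) v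
  have hw2 := fun v => contDiff_fderiv_apply (contDiff_fderiv_apply hw v) v
  have hc2 := fun v => ((hc.fderiv_apply ℝ v).fderiv_apply ℝ v)
  simp only [lap, mul_add, add_mul]
  rw [integral_add (hi hw (hg2 _) (hc2 _)) (hi hw (hg2 _) (hc2 _)),
    integral_add (hi (hw2 _) hg hc) (hi (hw2 _) hg hc), h1, h1]

theorem isWeakSol_of_lap (hw : ContDiff ℝ (⊤ : ℕ∞) w) (h : ∀ x ∈ U, lap w x + μ ^ 2 * w x = 0) :
    IsWeakSol μ w U := by
  intro φ hφ
  have hi : ∀ {a b : ℝ × ℝ → ℝ}, ContDiff ℝ (⊤ : ℕ∞) a → ContDiff ℝ (⊤ : ℕ∞) b →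
      HasCompactSupport b → Integrable fun x => a x * b x := fun ha hb hc =>
    (ha.continuous.mul hb.continuous).integrable_of_hasCompactSupport hc.mul_left
  have h1 : ∫ x, w x * (lap φ x + μ ^ 2 * φ x) =
      (∫ x, w x * lap φ x) + μ ^ 2 * ∫ x, w x * φ x := by
    rw [← integral_const_mul, ← integral_add (f := fun x => w x * lap φ x)
      (hi hw (contDiff_lap hφ.1) hφ.2.1.lap) ((hi hw hφ.1 hφ.2.1).const_mul _)]
    congr 1
    ext x
    ring
  rw [h1, integral_mul_lap hw hφ.1 hφ.2.1, ← integral_const_mul,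
    ← integral_add (f := fun x => lap w x * φ x) (hi (contDiff_lap hw) hφ.1 hφ.2.1)
      ((hi hw hφ.1 hφ.2.1).const_mul _)]
  refine integral_eq_zero_of_ae (Filter.Eventually.of_forall fun x => ?_)
  by_cases hx : x ∈ U
  · simp only [Pi.zero_apply]
    linear_combination φ x * h x hx
  · have : φ x = 0 := image_eq_zero_of_notMem_tsupport fun hx' => hx (hφ.2.2 hx')
    simp [this]

theorem lap_fderiv_apply_eq_zero (hU : IsOpen U) (hw : ContDiff ℝ (⊤ : ℕ∞) w)
    (h : ∀ x ∈ U, lap w x + μ ^ 2 * w x = 0) (v : ℝ × ℝ) :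
    ∀ x ∈ U, lap (fun y => fderiv ℝ w y v) x + μ ^ 2 * fderiv ℝ w x v = 0 := by
  intro x hx
  have h1 : (fun x => lap w x + μ ^ 2 * w x) =ᶠ[nhds x] fun _ => 0 := by
    filter_upwards [hU.mem_nhds hx] with y hy using h y hy
  have h2 := h1.fderiv_eq (𝕜 := ℝ)
  rw [fderiv_fun_add ((contDiff_lap hw).differentiable (by simp) x)
    ((hw.differentiable (by simp) x).const_mul _), fderiv_const_mul (hw.differentiable (by simp) x)]
    at h2
  have h3 := congrArg (fun L => L v) h2
  simpa [lap_fderiv_apply hw] using h3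

/-- Interior gradient estimate. -/
theorem exists_abs_fderiv_le (μ : ℝ) : ∃ C, 0 < C ∧ ∀ w : ℝ × ℝ → ℝ, ContDiff ℝ (⊤ : ℕ∞) w →
    ∀ (x : ℝ × ℝ) (r M : ℝ), 0 < r → r ≤ 1 →
    (∀ y ∈ Metric.ball x r, lap w y + μ ^ 2 * w y = 0) → (∀ y ∈ Metric.ball x r, |w y| ≤ M) →
    ∀ v, |fderiv ℝ w x v| ≤ C * ‖v‖ / r * M := by
  obtain ⟨C, hC0, hC⟩ := exists_abs_fderiv_ker_le μ
  have hm := kerMass_pos μ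
  refine ⟨8 * C / kerMass μ, by positivity, fun w hw x r M hr hr1 hsol hM v => ?_⟩
  have hτ : Real.exp (Real.log (r / 2)) = r / 2 := Real.exp_log (by positivity)
  set τ := Real.log (r / 2) with hτdef
  have hτ0 : τ ≤ 0 := Real.log_nonpos (by positivity) (by linarith)
  have hM0 : 0 ≤ M := (abs_nonneg _).trans (hM x (Metric.mem_ball_self hr))
  have hwv := contDiff_fderiv_apply hw v
  have hwv' := hwv.continuous
  have h1 := integral_mul_ker_eq (f := fun y => fderiv ℝ w y v) hwv'.locallyIntegrable
    (tendsto_average_of_continuousAt hwv'.continuousAt)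
    (isWeakSol_of_lap (μ := μ) hwv (lap_fderiv_apply_eq_zero Metric.isOpen_ball hw hsol v))
    (τ := τ) (by rw [hτ]; linarith : Real.exp τ < r)
  have ht := testFun_translate (contDiff_ker μ τ) (fun _ => ker_eq_zero) x
    (by rw [hτ]; linarith : Real.exp τ < r)
  have h2 := integral_test_mul_fderiv hw ht.1 ht.2.1 v
  have h3 : ∀ y, fderiv ℝ (fun y => ker μ τ (y - x)) y v =
      fderiv ℝ (ker μ τ) (y - x) v := fun y => by
    rw [fderiv_comp_sub]
  simp only [h3] at h2
  have h4 : fderiv ℝ w x v * kerMass μ = -∫ y, w y * fderiv ℝ (ker μ τ) (y - x) v := by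
    rw [h2, neg_neg, ← h1]
  have h5 : ∫ y, w y * fderiv ℝ (ker μ τ) (y - x) v =
      ∫ y in Metric.closedBall x (r / 2), w y * fderiv ℝ (ker μ τ) (y - x) v := by
    refine (setIntegral_eq_integral_of_forall_compl_eq_zero fun y hy => ?_).symm
    have : (ker μ τ) =ᶠ[nhds (y - x)] fun _ => 0 := by
      have hy' : r / 2 < ‖y - x‖ := by rw [← dist_eq_norm]; simpa using hy
      filter_upwards [continuous_norm.continuousAt.eventually (lt_mem_nhds hy')] with z hz
      exact ker_eq_zero (by rw [hτ]; exact le_of_lt hz)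
    rw [this.fderiv_eq]
    simp
  have h6 : ‖∫ y in Metric.closedBall x (r / 2), w y * fderiv ℝ (ker μ τ) (y - x) v‖ ≤
      M * (C * ‖v‖ * Real.exp (-τ) ^ 3) * (4 * (r / 2) ^ 2) := by
    rw [← measureReal_closedBall_prod x (by positivity)]
    refine norm_setIntegral_le_of_norm_le_const measure_closedBall_lt_top fun y hy => ?_
    rw [norm_mul]
    refine mul_le_mul (hM y ?_) (hC τ hτ0 _ v) (norm_nonneg _) hM0
    exact Metric.closedBall_subset_ball (by linarith) hy
  have h7 : |fderiv ℝ w x v| * kerMass μ ≤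
      M * (C * ‖v‖ * Real.exp (-τ) ^ 3) * (4 * (r / 2) ^ 2) := by
    calc _ = |fderiv ℝ w x v * kerMass μ| := by rw [abs_mul, abs_of_pos hm]
      _ ≤ _ := by
        rw [h4, abs_neg, h5]
        exact h6
  rw [Real.exp_neg, hτ] at h7
  rw [← le_div_iff₀ hm] at h7
  refine h7.trans (le_of_eq ?_)
  field_simp
  ring

theorem fderiv_comp_neg_apply (g : ℝ × ℝ → ℝ) (y v : ℝ × ℝ) :
    fderiv ℝ (fun y => g (-y)) y v = -fderiv ℝ g (-y) v := by
  have h := (ContinuousLinearEquiv.neg ℝ (M := ℝ × ℝ)).comp_right_fderiv (f := g) (x := y)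
  have h' := congrArg (fun L => L v) h
  simpa [Function.comp_def] using h'

theorem lap_comp_neg (g : ℝ × ℝ → ℝ) (y : ℝ × ℝ) : lap (fun y => g (-y)) y = lap g (-y) := by
  unfold lap
  have h : ∀ v : ℝ × ℝ, (fun y => fderiv ℝ (fun y => g (-y)) y v) =
      fun y => (fun z => -fderiv ℝ g z v) (-y) := fun v => by
    ext y
    rw [fderiv_comp_neg_apply]
  rw [h, h, fderiv_comp_neg_apply (fun z => -fderiv ℝ g z (1, 0)),
    fderiv_comp_neg_apply (fun z => -fderiv ℝ g z (0, 1))]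
  simp

theorem fderiv_convolution_apply (hf : LocallyIntegrable f) (hg : ContDiff ℝ (⊤ : ℕ∞) g)
    (hc : HasCompactSupport g) (x v : ℝ × ℝ) :
    fderiv ℝ (fun x => ∫ t, f t * g (x - t)) x v = ∫ t, f t * fderiv ℝ g (x - t) v := by
  have h := hc.hasFDerivAt_convolution_right (ContinuousLinearMap.mul ℝ ℝ) hf
    (hg.of_le (by exact_mod_cast le_top)) x
  have h' : HasFDerivAt (fun x => ∫ t, f t * g (x - t)) _ x := h
  rw [h'.fderiv, convolution_precompR_apply _ hf (hc.fderiv ℝ) (hg.continuous_fderiv (by simp))]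
  rfl

theorem contDiff_convolution (hf : LocallyIntegrable f) (hg : ContDiff ℝ (⊤ : ℕ∞) g)
    (hc : HasCompactSupport g) : ContDiff ℝ (⊤ : ℕ∞) fun x => ∫ t, f t * g (x - t) :=
  hc.contDiff_convolution_right (ContinuousLinearMap.mul ℝ ℝ) hf hg

theorem lap_convolution (hf : LocallyIntegrable f) (hg : ContDiff ℝ (⊤ : ℕ∞) g)
    (hc : HasCompactSupport g) (x : ℝ × ℝ) :
    lap (fun x => ∫ t, f t * g (x - t)) x = ∫ t, f t * lap g (x - t) := by
  have h2 := fun v => fderiv_convolution_apply hf (contDiff_fderiv_apply hg v)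
    (hc.fderiv_apply ℝ v) x v
  have hi : ∀ v, Integrable fun t =>
      f t * fderiv ℝ (fun z => fderiv ℝ g z v) (x - t) v := fun v =>
    (((hc.fderiv_apply ℝ v).fderiv_apply ℝ v).convolutionExists_right (ContinuousLinearMap.mul ℝ ℝ)
      hf (contDiff_fderiv_apply (contDiff_fderiv_apply hg v) v).continuous) x
  simp only [lap, mul_add]
  rw [integral_add (hi _) (hi _), ← h2, ← h2]
  simp only [fderiv_convolution_apply hf hg hc]

/-- The smooth representative of a weak solution. -/
def mollifyLim (μ : ℝ) (f : ℝ × ℝ → ℝ) (x : ℝ × ℝ) : ℝ :=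
  Filter.limUnder (Filter.atBot : Filter ℝ) (fun τ => ∫ y, f y * ker μ τ (y - x)) / kerMass μ

theorem mollifyLim_eq (hf : LocallyIntegrable f) {x : ℝ × ℝ} {r : ℝ}
    (hw : IsWeakSol μ f (Metric.ball x r)) {τ : ℝ} (hτ : Real.exp τ < r) :
    mollifyLim μ f x = (∫ y, f y * ker μ τ (y - x)) / kerMass μ := by
  rw [mollifyLim, (tendsto_integral_mul_ker_of_isWeakSol hf hw hτ).limUnder_eq]

theorem mollifyLim_ae_eq (hf : LocallyIntegrable f) (hU : IsOpen U) (hw : IsWeakSol μ f U) :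
    ∀ᵐ x, x ∈ U → f x = mollifyLim μ f x := by
  filter_upwards [IsUnifLocDoublingMeasure.ae_tendsto_average_norm_sub volume hf 1] with x hx hxU
  have hx' := hx (fun _ => x) id Filter.tendsto_id (by
    filter_upwards [self_mem_nhdsWithin] with ε hε
    simpa using (le_of_lt hε : (0 : ℝ) ≤ ε))
  obtain ⟨r, hr, hrU⟩ := Metric.isOpen_iff.1 hU x hxU
  have hτ : Real.exp (Real.log (r / 2)) < r := by rw [Real.exp_log (by positivity)]; linarith
  rw [mollifyLim_eq hf (hw.mono hrU) hτ, integral_mul_ker_eq hf hx' (hw.mono hrU) hτ,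
    mul_div_cancel_right₀ _ (kerMass_pos μ).ne']

/-- `u` is, near every point of `U`, equal to a globally smooth function that solves
`Δ u + μ² u = 0` there. -/
def IsSmoothSol (μ : ℝ) (u : ℝ × ℝ → ℝ) (U : Set (ℝ × ℝ)) : Prop :=
  ∀ x₀ ∈ U, ∃ r, 0 < r ∧ Metric.ball x₀ r ⊆ U ∧ ∃ w : ℝ × ℝ → ℝ, ContDiff ℝ (⊤ : ℕ∞) w ∧
    (∀ x ∈ Metric.ball x₀ r, u x = w x) ∧ ∀ x ∈ Metric.ball x₀ r, lap w x + μ ^ 2 * w x = 0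

theorem isSmoothSol_mollifyLim (hf : LocallyIntegrable f) (hU : IsOpen U) (hw : IsWeakSol μ f U) :
    IsSmoothSol μ (mollifyLim μ f) U := by
  intro x₀ hx₀
  obtain ⟨r, hr, hrU⟩ := Metric.isOpen_iff.1 hU x₀ hx₀
  have hτ : Real.exp (Real.log (r / 4)) < r / 2 := by rw [Real.exp_log (by positivity)]; linarith
  set τ := Real.log (r / 4)
  have hsub : ∀ x ∈ Metric.ball x₀ (r / 2), Metric.ball x (r / 2) ⊆ U := fun x hx =>
    (Metric.ball_subset_ball' (by linarith [Metric.mem_ball.1 hx])).trans hrU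
  have hK := contDiff_ker μ τ
  have hKc := hasCompactSupport_ker μ τ
  have hcd := contDiff_convolution hf hK hKc
  refine ⟨r / 2, by positivity, (Metric.ball_subset_ball (by linarith)).trans hrU,
    fun x => (kerMass μ)⁻¹ * ∫ t, f t * ker μ τ (x - t), contDiff_const.mul hcd, ?_, ?_⟩
  · intro x hx
    rw [mollifyLim_eq hf (hw.mono (hsub x hx)) hτ, div_eq_inv_mul]
    simp only [ker_sub_comm μ τ x]
  · intro x hx
    have hlap : lap (fun x => (kerMass μ)⁻¹ * ∫ t, f t * ker μ τ (x - t)) x =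
        (kerMass μ)⁻¹ * lap (fun x => ∫ t, f t * ker μ τ (x - t)) x := by
      simp only [lap]
      have h1 : ∀ v y, fderiv ℝ (fun x => (kerMass μ)⁻¹ * ∫ t, f t * ker μ τ (x - t)) y v =
          (kerMass μ)⁻¹ * fderiv ℝ (fun x => ∫ t, f t * ker μ τ (x - t)) y v := fun v y => by
        rw [fderiv_const_mul (hcd.differentiable (by simp) y)]
        rfl
      simp only [h1]
      have h2 : ∀ v, fderiv ℝ (fun y => (kerMass μ)⁻¹ *
          fderiv ℝ (fun x => ∫ t, f t * ker μ τ (x - t)) y v) x v = (kerMass μ)⁻¹ *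
          fderiv ℝ (fun y => fderiv ℝ (fun x => ∫ t, f t * ker μ τ (x - t)) y v) x v := fun v => by
        rw [fderiv_const_mul ((contDiff_fderiv_apply hcd v).differentiable (by simp) x)]
        rfl
      rw [h2, h2]
      ring
    have ht := testFun_translate hK (fun _ => ker_eq_zero) x hτ
    have h0 := hw _ ⟨ht.1, ht.2.1, ht.2.2.trans (hsub x hx)⟩
    simp only [lap_comp_sub] at h0
    have heven : ∀ t, lap (ker μ τ) (x - t) = lap (ker μ τ) (t - x) := fun t => by
      have h1 := lap_comp_neg (ker μ τ) (t - x)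
      simp only [ker_neg] at h1
      rw [neg_sub] at h1
      exact h1.symm
    have hi1 : Integrable fun t => f t * lap (ker μ τ) (x - t) :=
      (hKc.lap.convolutionExists_right (ContinuousLinearMap.mul ℝ ℝ) hf
        (contDiff_lap hK).continuous) x
    have hi2 : Integrable fun t => f t * ker μ τ (x - t) :=
      (hKc.convolutionExists_right (ContinuousLinearMap.mul ℝ ℝ) hf hK.continuous) x
    have h2 : (∫ t, f t * lap (ker μ τ) (x - t)) + μ ^ 2 * ∫ t, f t * ker μ τ (x - t) = 0 := by
      rw [← h0, ← integral_const_mul, ← integral_add hi1 (hi2.const_mul _)]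
      refine integral_congr_ae (Filter.Eventually.of_forall fun t => ?_)
      simp only [heven, ker_sub_comm μ τ x]
      ring
    rw [hlap, lap_convolution hf hK hKc]
    linear_combination (kerMass μ)⁻¹ * h2

end Regularity

theorem isWeakSol_of_solOp_eq {ω : Set (ℝ × ℝ)} {f : sobolev ω} {m μ : ℝ} (hm : 0 < m)
    (hμ : μ ^ 2 = 1 / m - 1) (hf : solOp ω f = m • f) :
    IsWeakSol μ (fun x => (f : L2V) x 0) ω := by
  intro φ hφ
  set g : sobolev ω := ⟨jetL ω ⟨φ, hφ⟩, jetL_mem_sobolev _⟩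
  have h1 := inner_solOp f g
  rw [hf, Submodule.coe_inner, Submodule.coe_smul, real_inner_smul_left, inner_L2V] at h1
  have hg : ∀ᵐ x, (g : L2V) x = jet φ x := coeFn_jetL (ω := ω) ⟨φ, hφ⟩
  have e0 : ∀ i j, ∫ x, (f : L2V) x i * (g : L2V) x j = ∫ x, (f : L2V) x i * jet φ x j :=
    fun i j => integral_congr_ae (by filter_upwards [hg] with x hx; rw [hx])
  have i0 : ∀ i, ∀ ψ : ℝ × ℝ → ℝ, ContDiff ℝ (⊤ : ℕ∞) ψ → HasCompactSupport ψ →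
      Integrable fun x => (f : L2V) x i * ψ x := fun i ψ hψ hc => by
    have := (locallyIntegrable_apply (f : L2V) i).integrable_smul_right_of_hasCompactSupport
      hψ.continuous hc
    simpa [smul_eq_mul] using this
  simp only [e0, jet_zero, jet_one, jet_two] at h1
  have h2 := sobolev_weak_fst f.2 (contDiff_fderiv_apply hφ.1 (1, 0)) (hφ.2.1.fderiv_apply ℝ (1, 0))
  have h3 := sobolev_weak_snd f.2 (contDiff_fderiv_apply hφ.1 (0, 1)) (hφ.2.1.fderiv_apply ℝ (0, 1))
  have d : ∀ v, ContDiff ℝ (⊤ : ℕ∞) fun x => fderiv ℝ (fun y => fderiv ℝ φ y v) x v :=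
    fun v => contDiff_fderiv_apply (contDiff_fderiv_apply hφ.1 v) v
  have hc : ∀ v, HasCompactSupport fun x => fderiv ℝ (fun y => fderiv ℝ φ y v) x v :=
    fun v => (hφ.2.1.fderiv_apply ℝ v).fderiv_apply ℝ v
  have h4 : ∫ x, (f : L2V) x 0 * (lap φ x + μ ^ 2 * φ x) =
      ((∫ x, (f : L2V) x 0 * fderiv ℝ (fun y => fderiv ℝ φ y (1, 0)) x (1, 0)) +
      ∫ x, (f : L2V) x 0 * fderiv ℝ (fun y => fderiv ℝ φ y (0, 1)) x (0, 1)) +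
      μ ^ 2 * ∫ x, (f : L2V) x 0 * φ x := by
    rw [← integral_const_mul, ← integral_add (i0 0 _ (d _) (hc _)) (i0 0 _ (d _) (hc _)),
      ← integral_add (f := fun x =>
        (f : L2V) x 0 * fderiv ℝ (fun y => fderiv ℝ φ y (1, 0)) x (1, 0) +
        (f : L2V) x 0 * fderiv ℝ (fun y => fderiv ℝ φ y (0, 1)) x (0, 1))
        ((i0 0 _ (d (1, 0)) (hc _)).add (i0 0 _ (d (0, 1)) (hc _)))
        ((i0 0 _ hφ.1 hφ.2.1).const_mul _)]
    refine integral_congr_ae (.of_forall fun x => ?_)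
    simp only [lap]
    ring
  rw [h4, h2, h3, hμ]
  have : (1 / m - 1) * (∫ x, (f : L2V) x 0 * φ x) =
      (1 / m) * (∫ x, (f : L2V) x 0 * φ x) - ∫ x, (f : L2V) x 0 * φ x := by ring
  rw [this]
  nth_rw 1 [← h1]
  rw [← mul_assoc, one_div_mul_cancel hm.ne']
  ring

theorem IsSmoothSol.congr {μ : ℝ} {u v : ℝ × ℝ → ℝ} {U : Set (ℝ × ℝ)} (h : IsSmoothSol μ u U)
    (huv : ∀ x ∈ U, v x = u x) : IsSmoothSol μ v U := by
  intro x hx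
  obtain ⟨r, hr, hrU, w, hw, h1, h2⟩ := h x hx
  exact ⟨r, hr, hrU, w, hw, fun y hy => (huv y (hrU hy)).trans (h1 y hy), h2⟩

theorem lap_sum {ι : Type*} (s : Finset ι) (c : ι → ℝ) {w : ι → ℝ × ℝ → ℝ}
    (hw : ∀ i ∈ s, ContDiff ℝ (⊤ : ℕ∞) (w i)) (x : ℝ × ℝ) :
    lap (fun y => ∑ i ∈ s, c i * w i y) x = ∑ i ∈ s, c i * lap (w i) x := by
  have key : ∀ g : ι → ℝ × ℝ → ℝ, (∀ i ∈ s, ContDiff ℝ (⊤ : ℕ∞) (g i)) → ∀ v y,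
      fderiv ℝ (fun y => ∑ i ∈ s, c i * g i y) y v = ∑ i ∈ s, c i * fderiv ℝ (g i) y v := by
    intro g hg v y
    have hd : ∀ i ∈ s, HasFDerivAt (fun y => c i * g i y) (c i • fderiv ℝ (g i) y) y :=
      fun i hi => (((hg i hi).differentiable (by simp) y).hasFDerivAt).const_mul _
    rw [(HasFDerivAt.fun_sum hd).fderiv]
    simp
  simp only [lap, key w hw]
  rw [key (fun i y => fderiv ℝ (w i) y (1, 0)) fun i hi => contDiff_fderiv_apply (hw i hi) _,
    key (fun i y => fderiv ℝ (w i) y (0, 1)) fun i hi => contDiff_fderiv_apply (hw i hi) _,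
    ← Finset.sum_add_distrib]
  exact Finset.sum_congr rfl fun i _ => by ring

theorem IsSmoothSol.sum {ι : Type*} [Fintype ι] {μ : ℝ} {u : ι → ℝ × ℝ → ℝ} {U : Set (ℝ × ℝ)}
    (hU : IsOpen U) (h : ∀ i, IsSmoothSol μ (u i) U) (c : ι → ℝ) :
    IsSmoothSol μ (fun x => ∑ i, c i * u i x) U := by
  intro x hx
  choose r hr _ w hw h1 h2 using fun i => h i x hx
  obtain ⟨ρ, hρ, hρU⟩ := Metric.isOpen_iff.1 hU x hx
  obtain ⟨δ, hδ, hδr⟩ : ∃ δ, 0 < δ ∧ ∀ i, δ ≤ r i := by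
    have hev : ∀ᶠ δ in nhdsWithin (0 : ℝ) (Ioi 0), ∀ i, δ ≤ r i :=
      Filter.eventually_all.2 fun i => (Filter.eventually_of_mem
        (mem_nhdsWithin_of_mem_nhds (Iic_mem_nhds (hr i))) fun _ h => h)
    obtain ⟨δ, h3, h4⟩ := (hev.and self_mem_nhdsWithin).exists
    exact ⟨δ, h4, h3⟩
  have hb : ∀ i, Metric.ball x (min ρ δ) ⊆ Metric.ball x (r i) := fun i =>
    Metric.ball_subset_ball ((min_le_right _ _).trans (hδr i))
  refine ⟨min ρ δ, lt_min hρ hδ, (Metric.ball_subset_ball (min_le_left _ _)).trans hρU,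
    fun x => ∑ i, c i * w i x, ContDiff.sum fun i _ => contDiff_const.mul (hw i), fun y hy => ?_,
    fun y hy => ?_⟩
  · exact Finset.sum_congr rfl fun i _ => by rw [h1 i y (hb i hy)]
  · rw [lap_sum _ _ fun i _ => hw i, Finset.mul_sum, ← Finset.sum_add_distrib]
    refine Finset.sum_eq_zero fun i _ => ?_
    linear_combination c i * h2 i y (hb i hy)

theorem IsSmoothSol.contDiffAt {μ : ℝ} {u : ℝ × ℝ → ℝ} {U : Set (ℝ × ℝ)} (h : IsSmoothSol μ u U)
    {x : ℝ × ℝ} (hx : x ∈ U) : ContDiffAt ℝ (⊤ : ℕ∞) u x := by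
  obtain ⟨r, hr, -, w, hw, h1, -⟩ := h x hx
  exact hw.contDiffAt.congr_of_eventuallyEq
    (Filter.eventually_of_mem (Metric.ball_mem_nhds x hr) h1)

theorem IsSmoothSol.contDiffOn {μ : ℝ} {u : ℝ × ℝ → ℝ} {U : Set (ℝ × ℝ)} (h : IsSmoothSol μ u U) :
    ContDiffOn ℝ (⊤ : ℕ∞) u U := fun _ hx => (h.contDiffAt hx).contDiffWithinAt

theorem IsSmoothSol.neg {μ : ℝ} {u : ℝ × ℝ → ℝ} {U : Set (ℝ × ℝ)} (hU : IsOpen U)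
    (h : IsSmoothSol μ u U) : IsSmoothSol μ (fun x => -u x) U := by
  have := IsSmoothSol.sum (ι := Unit) hU (fun _ => h) fun _ => -1
  simpa using this

theorem weak_fderiv_of_contDiffOn {u φ : ℝ × ℝ → ℝ} {U : Set (ℝ × ℝ)} (hU : IsOpen U)
    (hu : ContDiffOn ℝ (⊤ : ℕ∞) u U) (hφ : testFun U φ) (v : ℝ × ℝ) :
    ∫ x, u x * fderiv ℝ φ x v = -∫ x, fderiv ℝ u x v * φ x := by
  have hd : ContinuousOn (fun x => fderiv ℝ u x v) U :=
    (hu.continuousOn_fderiv_of_isOpen hU (by simp)).clm_apply continuousOn_const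
  have hcφ := hφ.1.continuous
  have hcdφ : Continuous fun x => fderiv ℝ φ x v :=
    (hφ.1.continuous_fderiv (by simp)).clm_apply continuous_const
  have hts : tsupport (fun x => fderiv ℝ φ x v) ⊆ tsupport φ := tsupport_fderiv_apply_subset ℝ v
  have hig : ∀ a b : ℝ × ℝ → ℝ, ContinuousOn a U → Continuous b → tsupport b ⊆ tsupport φ →
      Integrable fun x => a x * b x := by
    intro a b ha hb hab
    have hs : tsupport (fun x => a x * b x) ⊆ tsupport φ := (tsupport_mul_subset_right).trans hab
    have hc : Continuous fun x => a x * b x :=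
      (ha.mul hb.continuousOn).continuous_of_tsupport_subset hU (hs.trans hφ.2.2)
    exact hc.integrable_of_hasCompactSupport (hφ.2.1.of_isClosed_subset (isClosed_tsupport _) hs)
  refine integral_mul_fderiv_eq_neg_fderiv_mul_of_integrable (hig _ _ hd hcφ subset_rfl)
    (hig _ _ hu.continuousOn hcdφ hts) (hig _ _ hu.continuousOn hcφ subset_rfl) ?_ ?_
  · intro x hx
    exact (hu.contDiffAt (hU.mem_nhds (hφ.2.2 hx))).differentiableAt (by simp)
  · intro x _
    exact hφ.1.differentiable (by simp) x

theorem sobolev_ae_eq_fderiv {ω : Set (ℝ × ℝ)} (ho : IsOpen ω) {f : L2V} (hf : f ∈ sobolev ω)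
    {u : ℝ × ℝ → ℝ} (hu : ContDiffOn ℝ (⊤ : ℕ∞) u ω) (hfu : ∀ᵐ x, x ∈ ω → f x 0 = u x) :
    ∀ᵐ x, x ∈ ω → f x 1 = fderiv ℝ u x (1, 0) ∧ f x 2 = fderiv ℝ u x (0, 1) := by
  have key : ∀ (i : Fin 3) (v : ℝ × ℝ), (∀ φ, testFun ω φ →
      ∫ x, f x 0 * fderiv ℝ φ x v = -∫ x, f x i * φ x) →
      ∀ᵐ x, x ∈ ω → f x i - fderiv ℝ u x v = 0 := by
    intro i v h
    have hd : ContinuousOn (fun x => fderiv ℝ u x v) ω :=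
      (hu.continuousOn_fderiv_of_isOpen ho (by simp)).clm_apply continuousOn_const
    have hl1 : LocallyIntegrableOn (fun x => f x i) ω :=
      (locallyIntegrable_apply f i).locallyIntegrableOn _
    have hl2 : LocallyIntegrableOn (fun x => fderiv ℝ u x v) ω :=
      hd.locallyIntegrableOn ho.measurableSet
    refine ho.ae_eq_zero_of_integral_contDiff_smul_eq_zero (hl1.sub hl2) fun φ hφ hc hs => ?_
    have hφt : testFun ω φ := ⟨hφ, hc, hs⟩
    have h1 := h φ hφt
    have h2 := weak_fderiv_of_contDiffOn ho hu hφt v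
    have h3 : ∫ x, f x 0 * fderiv ℝ φ x v = ∫ x, u x * fderiv ℝ φ x v := by
      refine integral_congr_ae ?_
      filter_upwards [hfu] with x hx
      by_cases hxω : x ∈ ω
      · rw [hx hxω]
      · have : fderiv ℝ φ x = 0 := image_eq_zero_of_notMem_tsupport
          fun hx' => hxω (hs (tsupport_fderiv_subset ℝ hx'))
        simp [this]
    have i1 : Integrable fun x => φ x * f x i := by
      have := (locallyIntegrable_apply f i).integrable_smul_left_of_hasCompactSupport
        hφ.continuous hc
      simpa [smul_eq_mul] using this
    have i2 : Integrable fun x => φ x * fderiv ℝ u x v := by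
      have hs' : tsupport (fun x => φ x * fderiv ℝ u x v) ⊆ tsupport φ := tsupport_mul_subset_left
      have hcont : Continuous fun x => φ x * fderiv ℝ u x v :=
        (hφ.continuous.continuousOn.mul hd).continuous_of_tsupport_subset ho (hs'.trans hs)
      exact hcont.integrable_of_hasCompactSupport (hc.of_isClosed_subset (isClosed_tsupport _) hs')
    simp only [smul_eq_mul, mul_sub]
    rw [integral_sub i1 i2]
    simp only [mul_comm (φ _)]
    linarith
  filter_upwards [key 1 (1, 0) fun φ hφ => sobolev_weak_fst hf hφ.1 hφ.2.1,
    key 2 (0, 1) fun φ hφ => sobolev_weak_snd hf hφ.1 hφ.2.1] with x h1 h2 hx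
  exact ⟨sub_eq_zero.1 (h1 hx), sub_eq_zero.1 (h2 hx)⟩

theorem exists_isSmoothSol {ω : Set (ℝ × ℝ)} (ho : IsOpen ω) {f : sobolev ω} {m μ : ℝ} (hm : 0 < m)
    (hμ : μ ^ 2 = 1 / m - 1) (hf : solOp ω f = m • f) :
    ∃ u, IsSmoothSol μ u ω ∧ ∀ᵐ x, x ∈ ω → (f : L2V) x 0 = u x :=
  ⟨_, isSmoothSol_mollifyLim (locallyIntegrable_apply _ 0) ho (isWeakSol_of_solOp_eq hm hμ hf),
    mollifyLim_ae_eq (locallyIntegrable_apply _ 0) ho (isWeakSol_of_solOp_eq hm hμ hf)⟩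

/-- The space of smooth functions on the plane. -/
def smoothSub : Submodule ℝ (ℝ × ℝ → ℝ) where
  carrier := {g | ContDiff ℝ (⊤ : ℕ∞) g}
  add_mem' {a b} (h1 : ContDiff ℝ (⊤ : ℕ∞) a) (h2 : ContDiff ℝ (⊤ : ℕ∞) b) := h1.add h2
  zero_mem' := show ContDiff ℝ (⊤ : ℕ∞) fun _ => (0 : ℝ) from contDiff_const
  smul_mem' _ a (h : ContDiff ℝ (⊤ : ℕ∞) a) := contDiff_const.smul h

theorem differentiable_smoothSub (g : smoothSub) : Differentiable ℝ (g : ℝ × ℝ → ℝ) :=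
  ContDiff.differentiable (n := (⊤ : ℕ∞)) g.2 (by simp)

/-- The directional derivative as an operator on smooth functions. -/
def dirD (v : ℝ × ℝ) : Module.End ℝ smoothSub where
  toFun g := ⟨fun x => fderiv ℝ (g : ℝ × ℝ → ℝ) x v, contDiff_fderiv_apply g.2 v⟩
  map_add' g h := by
    ext x
    change fderiv ℝ ((g : ℝ × ℝ → ℝ) + (h : ℝ × ℝ → ℝ)) x v = fderiv ℝ g x v + fderiv ℝ h x v
    rw [fderiv_add (differentiable_smoothSub g x) (differentiable_smoothSub h x)]
    rfl
  map_smul' c g := by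
    ext x
    change fderiv ℝ (c • (g : ℝ × ℝ → ℝ)) x v = c * fderiv ℝ g x v
    rw [fderiv_const_smul (differentiable_smoothSub g x)]
    rfl

theorem dirD_apply (v : ℝ × ℝ) (g : smoothSub) (x : ℝ × ℝ) :
    (dirD v g : ℝ × ℝ → ℝ) x = fderiv ℝ g x v := rfl

theorem commute_dirD (v w : ℝ × ℝ) : Commute (dirD v) (dirD w) := by
  refine LinearMap.ext fun g => Subtype.ext (funext fun x => ?_)
  exact fderiv_fderiv_comm g.2 w v x

theorem dirD_eq (v : ℝ × ℝ) : dirD v = v.1 • dirD (1, 0) + v.2 • dirD (0, 1) := by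
  refine LinearMap.ext fun g => Subtype.ext (funext fun x => ?_)
  change fderiv ℝ g x v = v.1 * fderiv ℝ g x (1, 0) + v.2 * fderiv ℝ g x (0, 1)
  rw [← smul_eq_mul, ← smul_eq_mul, ← map_smul, ← map_smul, ← map_add]
  congr 1
  ext <;> simp

/-- The Helmholtz operator on smooth functions. -/
def helm (μ : ℝ) : Module.End ℝ smoothSub :=
  dirD (1, 0) ^ 2 + dirD (0, 1) ^ 2 + μ ^ 2 • (1 : Module.End ℝ smoothSub)

theorem helm_apply (μ : ℝ) (g : smoothSub) (x : ℝ × ℝ) :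
    (helm μ g : ℝ × ℝ → ℝ) x = lap g x + μ ^ 2 * (g : ℝ × ℝ → ℝ) x := rfl

theorem commute_helm (μ : ℝ) (v : ℝ × ℝ) : Commute (helm μ) (dirD v) :=
  ((((commute_dirD _ v).pow_left 2).add_left ((commute_dirD _ v).pow_left 2)).add_left
    ((Commute.one_left _).smul_left _))

theorem pow_dirD_eq_zero {U : Set (ℝ × ℝ)} (hU : IsOpen U) (v : ℝ × ℝ) (k : ℕ) {g : smoothSub}
    (hg : ∀ x ∈ U, (g : ℝ × ℝ → ℝ) x = 0) : ∀ x ∈ U, ((dirD v ^ k) g : ℝ × ℝ → ℝ) x = 0 := by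
  induction k with
  | zero => exact hg
  | succ k ih =>
    intro x hx
    rw [pow_succ', Module.End.mul_apply, dirD_apply]
    have : ((dirD v ^ k) g : ℝ × ℝ → ℝ) =ᶠ[nhds x] fun _ => 0 :=
      Filter.eventually_of_mem (hU.mem_nhds hx) ih
    rw [this.fderiv_eq]
    simp

theorem abs_pow_dirD_le {μ C : ℝ} (hC : ∀ w : ℝ × ℝ → ℝ, ContDiff ℝ (⊤ : ℕ∞) w → ∀ x r M, 0 < r →
      r ≤ 1 → (∀ y ∈ Metric.ball x r, lap w y + μ ^ 2 * w y = 0) →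
      (∀ y ∈ Metric.ball x r, |w y| ≤ M) → ∀ v, |fderiv ℝ w x v| ≤ C * ‖v‖ / r * M)
    {g : smoothSub} {p : ℝ × ℝ} {ρ M ε : ℝ} (hε : 0 < ε) (hε1 : ε ≤ 1)
    (hg : ∀ x ∈ Metric.ball p ρ, lap g x + μ ^ 2 * (g : ℝ × ℝ → ℝ) x = 0)
    (hM : ∀ x ∈ Metric.ball p ρ, |(g : ℝ × ℝ → ℝ) x| ≤ M) (v : ℝ × ℝ) (k : ℕ) :
    ∀ x, dist x p + k * ε < ρ → |((dirD v ^ k) g : ℝ × ℝ → ℝ) x| ≤ (C * ‖v‖ / ε) ^ k * M := by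
  induction k with
  | zero => intro x hx; simpa using hM x (by simpa using hx)
  | succ k ih =>
    intro x hx
    push_cast at hx
    rw [pow_succ', Module.End.mul_apply, dirD_apply, pow_succ', mul_assoc]
    have hball : ∀ y ∈ Metric.ball x ε, dist y p + k * ε < ρ := fun y hy => by
      have := dist_triangle y x p
      have := Metric.mem_ball.1 hy
      linarith
    refine hC _ ((dirD v ^ k) g).2 x ε _ hε hε1 (fun y hy => ?_) (fun y hy => ih y (hball y hy)) v
    have h1 := pow_dirD_eq_zero Metric.isOpen_ball v k (g := helm μ g)
      (U := Metric.ball p ρ) hg y (by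
      have := hball y hy
      have : 0 ≤ k * ε := by positivity
      exact Metric.mem_ball.2 (by linarith))
    rw [← Module.End.mul_apply, ← ((commute_helm μ v).pow_right k).eq, Module.End.mul_apply,
      helm_apply] at h1
    exact h1

theorem hasDerivAt_pow_dirD (v : ℝ × ℝ) (g : smoothSub) (p : ℝ × ℝ) (k : ℕ) (t : ℝ) :
    HasDerivAt (fun t : ℝ => ((dirD v ^ k) g : ℝ × ℝ → ℝ) (p + t • v))
      (((dirD v ^ (k + 1)) g : ℝ × ℝ → ℝ) (p + t • v)) t := by
  rw [pow_succ', Module.End.mul_apply, dirD_apply]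
  have h1 : HasDerivAt (fun t : ℝ => p + t • v) v t := by
    simpa using ((hasDerivAt_id t).smul_const v).const_add p
  exact (differentiable_smoothSub ((dirD v ^ k) g) _).hasFDerivAt.comp_hasDerivAt t h1

theorem abs_le_of_derivs_eq_zero {h : ℕ → ℝ → ℝ} (hd : ∀ k t, HasDerivAt (h k) (h (k + 1) t) t)
    (h0 : ∀ k, h k 0 = 0) {n : ℕ} {K : ℝ} (hK : ∀ t ∈ Icc (0 : ℝ) 1, |h n t| ≤ K)
    (j : ℕ) (hj : j ≤ n) :
    ∀ t ∈ Icc (0 : ℝ) 1, |h (n - j) t| ≤ K * t ^ j / j.factorial := by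
  induction j with
  | zero =>
    intro t ht
    simpa using hK t ht
  | succ j ih =>
    have e : n - j = n - (j + 1) + 1 := by omega
    rw [e] at ih
    refine image_norm_le_of_norm_deriv_right_le_deriv_boundary
      (f' := h (n - (j + 1) + 1)) (B' := fun t => K * t ^ j / j.factorial)
      (fun t _ => (hd _ t).continuousAt.continuousWithinAt)
      (fun t _ => (hd _ t).hasDerivWithinAt) (by simp [h0]) (fun t => ?_)
      fun t ht => ih (by omega) t (Ico_subset_Icc_self ht)
    refine (((hasDerivAt_pow (j + 1) t).const_mul K).div_const _).congr_deriv ?_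
    have : (j.factorial : ℝ) ≠ 0 := by positivity
    rw [Nat.factorial_succ]
    push_cast
    field_simp

theorem pos_of_derivs {h : ℕ → ℝ → ℝ} (hd : ∀ k t, HasDerivAt (h k) (h (k + 1) t) t) {n : ℕ}
    (h0 : ∀ k < n, h k 0 = 0) (hn : 0 < h n 0) : ∃ r > 0, ∀ t, 0 < t → t ≤ r → 0 < h 0 t := by
  suffices H : ∀ j ≤ n, ∃ r > 0, ∀ t, 0 < t → t ≤ r → 0 < h (n - j) t by
    simpa using H n le_rfl
  intro j
  induction j with
  | zero =>
    intro _
    have := (hd n 0).continuousAt.eventually (lt_mem_nhds hn)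
    obtain ⟨r, hr, hb⟩ := Metric.eventually_nhds_iff.1 this
    refine ⟨r / 2, by positivity, fun t ht htr => hb ?_⟩
    rw [Real.dist_eq, sub_zero, abs_of_pos ht]
    linarith
  | succ j ih =>
    intro hj
    obtain ⟨r, hr, hb⟩ := ih (by omega)
    have e : n - j = n - (j + 1) + 1 := by omega
    rw [e] at hb
    refine ⟨r, hr, fun t ht htr => ?_⟩
    have hm : StrictMonoOn (h (n - (j + 1))) (Icc 0 r) := by
      refine strictMonoOn_of_deriv_pos (convex_Icc _ _)
        (fun t _ => (hd _ t).continuousAt.continuousWithinAt) fun t ht => ?_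
      rw [interior_Icc] at ht
      rw [(hd _ t).deriv]
      exact hb t ht.1 ht.2.le
    have := hm ⟨le_rfl, hr.le⟩ ⟨ht.le, htr⟩ ht
    rwa [h0 _ (by omega)] at this

/-- A solution of the Helmholtz equation all of whose directional derivatives vanish at a point
vanishes in a neighbourhood of that point. -/
theorem eventually_eq_zero_of_pow_dirD_eq_zero {μ ρ : ℝ} {g : smoothSub} {p : ℝ × ℝ} (hρ : 0 < ρ)
    (hg : ∀ x ∈ Metric.ball p ρ, lap g x + μ ^ 2 * (g : ℝ × ℝ → ℝ) x = 0)
    (h0 : ∀ v k, ((dirD v ^ k) g : ℝ × ℝ → ℝ) p = 0) :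
    ∀ᶠ x in nhds p, (g : ℝ × ℝ → ℝ) x = 0 := by
  obtain ⟨C, hC0, hC⟩ := exists_abs_fderiv_le μ
  wlog hρ1 : ρ ≤ 1 generalizing ρ
  · exact this one_pos (fun x hx => hg x (Metric.ball_subset_ball (le_of_not_ge hρ1) hx)) le_rfl
  have hgc : Continuous (g : ℝ × ℝ → ℝ) := (differentiable_smoothSub g).continuous
  obtain ⟨M, hM⟩ := (isCompact_closedBall p ρ).exists_bound_of_continuousOn hgc.continuousOn
  have hM0 : 0 ≤ M := (norm_nonneg _).trans (hM p (Metric.mem_closedBall_self hρ.le))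
  set δ := min (ρ / 2) (ρ / (4 * C * Real.exp 1)) with hδ
  have hδ0 : 0 < δ := lt_min (by positivity) (by positivity)
  refine Filter.eventually_of_mem (Metric.ball_mem_nhds p hδ0) fun x hx => ?_
  set v := x - p with hv
  have hvn : ‖v‖ < δ := by rw [hv, ← dist_eq_norm]; exact hx
  have hv1 : ‖v‖ < ρ / 2 := hvn.trans_le (min_le_left _ _)
  have hv2 : ‖v‖ ≤ ρ / (4 * C * Real.exp 1) := hvn.le.trans (min_le_right _ _)
  have hbound : ∀ n : ℕ, |(g : ℝ × ℝ → ℝ) x| ≤ (1 / 2) ^ n * M := by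
    intro n
    rcases Nat.eq_zero_or_pos n with rfl | hn
    · simpa using hM x (Metric.mem_closedBall.2 (by
        have := Metric.mem_ball.1 hx
        have := min_le_left (ρ / 2) (ρ / (4 * C * Real.exp 1))
        linarith))
    have hn' : (0 : ℝ) < n := by exact_mod_cast hn
    have hn1 : (1 : ℝ) ≤ n := by exact_mod_cast hn
    set ε := ρ / (2 * n) with hε
    have hε0 : 0 < ε := by positivity
    have hε1 : ε ≤ 1 := by
      rw [hε, div_le_one (by positivity)]
      linarith
    have hnε : n * ε = ρ / 2 := by rw [hε]; field_simp
    have h1 := abs_le_of_derivs_eq_zero (h := fun k t => ((dirD v ^ k) g : ℝ × ℝ → ℝ) (p + t • v))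
      (hasDerivAt_pow_dirD v g p) (fun k => by simpa using h0 v k) (n := n)
      (K := (C * ‖v‖ / ε) ^ n * M) (fun t ht => by
        refine abs_pow_dirD_le hC hε0 hε1 hg
          (fun y hy => hM y (Metric.ball_subset_closedBall hy)) v n _ ?_
        rw [hnε, dist_eq_norm, add_sub_cancel_left, norm_smul, Real.norm_eq_abs, abs_of_nonneg ht.1]
        have : t * ‖v‖ ≤ 1 * ‖v‖ := mul_le_mul_of_nonneg_right ht.2 (norm_nonneg _)
        linarith) n le_rfl 1 ⟨zero_le_one, le_rfl⟩
    simp only [Nat.sub_self, pow_zero, one_smul, one_pow, mul_one, Module.End.one_apply] at h1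
    rw [hv, add_sub_cancel] at h1
    refine h1.trans ?_
    rw [← hv, div_le_iff₀ (by positivity)]
    have h2 : C * ‖v‖ / ε ≤ n / (2 * Real.exp 1) := by
      rw [div_le_iff₀ hε0, hε]
      calc C * ‖v‖ ≤ C * (ρ / (4 * C * Real.exp 1)) := by gcongr
        _ = n / (2 * Real.exp 1) * (ρ / (2 * n)) := by field_simp; norm_num
    have h3 : (n : ℝ) ^ n ≤ Real.exp 1 ^ n * n.factorial := by
      have := Real.pow_div_factorial_le_exp (x := (n : ℝ)) hn'.le n
      rw [div_le_iff₀ (by positivity)] at this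
      rwa [← Real.exp_nat_mul, mul_one]
    calc (C * ‖v‖ / ε) ^ n * M ≤ (n / (2 * Real.exp 1)) ^ n * M := by gcongr
      _ = (1 / 2) ^ n * M * ((n : ℝ) ^ n / Real.exp 1 ^ n) := by
        rw [div_pow, mul_pow, one_div, inv_pow]
        field_simp
      _ ≤ (1 / 2) ^ n * M * n.factorial := by
        gcongr
        rw [div_le_iff₀ (by positivity)]
        linarith
  have hlim : Filter.Tendsto (fun n : ℕ => ((1 : ℝ) / 2) ^ n * M) Filter.atTop (nhds 0) := by
    simpa using (tendsto_pow_atTop_nhds_zero_of_lt_one (r := (1 : ℝ) / 2) (by norm_num)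
      (by norm_num)).mul_const M
  exact abs_nonpos_iff.1 (ge_of_tendsto' hlim hbound)

/-- The mixed partial derivative `∂₂ʲ∂₁ⁱ` of `g` at `p`. -/
def mixedD (g : smoothSub) (p : ℝ × ℝ) (i j : ℕ) : ℝ :=
  ((dirD (0, 1) ^ j * dirD (1, 0) ^ i) g : ℝ × ℝ → ℝ) p

theorem pow_dirD_apply_eq_sum (v : ℝ × ℝ) (n : ℕ) (g : smoothSub) (p : ℝ × ℝ) :
    ((dirD v ^ n) g : ℝ × ℝ → ℝ) p =
      ∑ j ∈ Finset.range (n + 1), v.2 ^ j * v.1 ^ (n - j) * n.choose j * mixedD g p (n - j) j := by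
  have hc : Commute (v.2 • dirD (0, 1)) (v.1 • dirD (1, 0)) :=
    ((commute_dirD _ _).smul_left _).smul_right _
  rw [dirD_eq v, add_comm, hc.add_pow, LinearMap.sum_apply]
  have : ∀ (s : Finset ℕ) (G : ℕ → smoothSub),
      ((∑ j ∈ s, G j : smoothSub) : ℝ × ℝ → ℝ) p = ∑ j ∈ s, (G j : ℝ × ℝ → ℝ) p := fun s G => by
    simp
  rw [this]
  refine Finset.sum_congr rfl fun j _ => ?_
  rw [smul_pow, smul_pow, smul_mul_smul_comm, ← nsmul_eq_mul', LinearMap.smul_apply,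
    LinearMap.smul_apply, ← Nat.cast_smul_eq_nsmul ℝ]
  simp only [Submodule.coe_smul, Pi.smul_apply, smul_eq_mul, mixedD]
  ring

theorem mixedD_helm {μ ρ : ℝ} {g : smoothSub} {p : ℝ × ℝ} (hρ : 0 < ρ)
    (hg : ∀ x ∈ Metric.ball p ρ, lap g x + μ ^ 2 * (g : ℝ × ℝ → ℝ) x = 0) (i j : ℕ) :
    mixedD g p (i + 2) j + mixedD g p i (j + 2) + μ ^ 2 * mixedD g p i j = 0 := by
  have h1 := pow_dirD_eq_zero Metric.isOpen_ball (1, 0) i (g := helm μ g) (U := Metric.ball p ρ) hg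
  have h2 := pow_dirD_eq_zero Metric.isOpen_ball (0, 1) j h1 p (Metric.mem_ball_self hρ)
  rw [← h2]
  have hc : dirD (1, 0) ^ i * dirD (0, 1) ^ 2 = dirD (0, 1) ^ 2 * dirD (1, 0) ^ i :=
    ((commute_dirD _ _).pow_pow i 2).eq
  have e : dirD (0, 1) ^ j * dirD (1, 0) ^ i * helm μ =
      dirD (0, 1) ^ j * dirD (1, 0) ^ (i + 2) + dirD (0, 1) ^ (j + 2) * dirD (1, 0) ^ i +
        μ ^ 2 • (dirD (0, 1) ^ j * dirD (1, 0) ^ i) := by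
    rw [helm, mul_add, mul_add, mul_smul_comm, mul_one, pow_add, pow_add, mul_assoc, mul_assoc, hc,
      mul_assoc]
  rw [← Module.End.mul_apply, ← Module.End.mul_apply, e]
  rfl

/-- At a zero of order `n ≥ 2`, a non-trivial solution of the Helmholtz equation takes alternating
signs along rays making equal angles `π / n`. -/
theorem exists_alternating_rays {μ ρ : ℝ} {g : smoothSub} {p : ℝ × ℝ} (hρ : 0 < ρ)
    (hg : ∀ x ∈ Metric.ball p ρ, lap g x + μ ^ 2 * (g : ℝ × ℝ → ℝ) x = 0)
    (h0 : (g : ℝ × ℝ → ℝ) p = 0) (h1 : fderiv ℝ (g : ℝ × ℝ → ℝ) p (1, 0) = 0)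
    (h2 : fderiv ℝ (g : ℝ × ℝ → ℝ) p (0, 1) = 0)
    (hne : ¬ ∀ᶠ x in nhds p, (g : ℝ × ℝ → ℝ) x = 0) :
    ∃ a b r : ℝ, 0 < b ∧ 3 * b < 2 * π ∧ 0 < r ∧ ∀ k : ℕ, k < 4 → ∀ t : ℝ, 0 < t → t ≤ r →
      0 < (-1) ^ k * (g : ℝ × ℝ → ℝ) (p + t • (Real.cos (a + k * b), Real.sin (a + k * b))) := by
  have hex : ∃ n, ∃ j ≤ n, mixedD g p (n - j) j ≠ 0 := by
    by_contra! hcon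
    refine hne (eventually_eq_zero_of_pow_dirD_eq_zero hρ hg fun v k => ?_)
    rw [pow_dirD_apply_eq_sum]
    refine Finset.sum_eq_zero fun j hj => ?_
    rw [hcon k j (by simpa [Nat.lt_succ_iff] using hj), mul_zero]
  classical
  obtain ⟨n, hn, hmin⟩ : ∃ n, (∃ j ≤ n, mixedD g p (n - j) j ≠ 0) ∧
      ∀ k < n, ∀ j ≤ k, mixedD g p (k - j) j = 0 :=
    ⟨Nat.find hex, Nat.find_spec hex, fun k hk => by simpa using Nat.find_min hex hk⟩
  have hn2 : 2 ≤ n := by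
    obtain ⟨j, hj, hne0⟩ := hn
    by_contra! hlt
    interval_cases n
    · obtain rfl : j = 0 := by omega
      exact hne0 h0
    · interval_cases j
      · exact hne0 h1
      · exact hne0 h2
  set B : ℕ → ℝ := fun j => mixedD g p (n - j) j with hB
  have hrec : ∀ j, j + 2 ≤ n → B (j + 2) = -B j := by
    intro j hj
    have h3 := mixedD_helm hρ hg (n - (j + 2)) j
    rw [show n - (j + 2) + 2 = n - j by omega, show n - (j + 2) = n - 2 - j by omega,
      hmin (n - 2) (by omega) j (by omega)] at h3
    simp only [hB, show n - (j + 2) = n - 2 - j by omega]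
    linarith
  set c : ℂ := ⟨B 0, -B 1⟩ with hc
  have hBc : ∀ j ≤ n, B j = (c * Complex.I ^ j).re := by
    have : ∀ j, (j ≤ n → B j = (c * Complex.I ^ j).re) ∧
        (j + 1 ≤ n → B (j + 1) = (c * Complex.I ^ (j + 1)).re) := by
      intro j
      induction j with
      | zero => simp [hc]
      | succ j ih =>
        refine ⟨ih.2, fun hj => ?_⟩
        rw [add_assoc] at hj ⊢
        rw [hrec j hj, ih.1 (by omega), pow_add, Complex.I_sq]
        simp
    exact fun j => (this j).1
  have hc0 : c ≠ 0 := by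
    rintro h
    obtain ⟨j, hj, hne0⟩ := hn
    apply hne0
    have := hBc j hj
    rw [h] at this
    simpa using this
  have hlead : ∀ θ : ℝ, ((dirD (Real.cos θ, Real.sin θ) ^ n) g : ℝ × ℝ → ℝ) p =
      ‖c‖ * Real.cos (c.arg + n * θ) := by
    intro θ
    have e1 : ((dirD (Real.cos θ, Real.sin θ) ^ n) g : ℝ × ℝ → ℝ) p =
        (c * ((Real.sin θ : ℂ) * Complex.I + (Real.cos θ : ℂ)) ^ n).re := by
      rw [pow_dirD_apply_eq_sum, add_pow, Finset.mul_sum, Complex.re_sum]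
      refine Finset.sum_congr rfl fun j hj => ?_
      change _ * B j = _
      rw [hBc j (by simpa [Nat.lt_succ_iff] using hj)]
      have : c * (((Real.sin θ : ℂ) * Complex.I) ^ j * (Real.cos θ : ℂ) ^ (n - j) *
          (n.choose j : ℂ)) =
          ((Real.sin θ ^ j * Real.cos θ ^ (n - j) * n.choose j : ℝ) : ℂ) * (c * Complex.I ^ j) := by
        push_cast
        ring
      rw [this, Complex.re_ofReal_mul]
    have e2 : (Real.sin θ : ℂ) * Complex.I + (Real.cos θ : ℂ) = Complex.exp (θ * Complex.I) := by
      rw [Complex.exp_mul_I, Complex.ofReal_sin, Complex.ofReal_cos]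
      ring
    rw [e1, e2, ← Complex.exp_nat_mul]
    nth_rw 1 [← Complex.norm_mul_exp_arg_mul_I c]
    rw [mul_assoc, ← Complex.exp_add, Complex.re_ofReal_mul,
      show (c.arg : ℂ) * Complex.I + n * (θ * Complex.I) = ((c.arg + n * θ : ℝ) : ℂ) * Complex.I by
        push_cast; ring, Complex.exp_ofReal_mul_I_re]
  have hlow : ∀ v, ∀ k < n, ((dirD v ^ k) g : ℝ × ℝ → ℝ) p = 0 := by
    intro v k hk
    rw [pow_dirD_apply_eq_sum]
    refine Finset.sum_eq_zero fun j hj => ?_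
    rw [hmin k hk j (by simpa [Nat.lt_succ_iff] using hj), mul_zero]
  have hn0 : (0 : ℝ) < n := by positivity
  have hray : ∀ k : ℕ, ∃ r > 0, ∀ t : ℝ, 0 < t → t ≤ r →
      0 < (-1) ^ k * (g : ℝ × ℝ → ℝ) (p + t • (Real.cos (-c.arg / n + k * (π / n)),
        Real.sin (-c.arg / n + k * (π / n)))) := by
    intro k
    set θ := -c.arg / n + k * (π / n) with hθ
    set v : ℝ × ℝ := (Real.cos θ, Real.sin θ)
    have := pos_of_derivs (h := fun i t => (-1) ^ k * ((dirD v ^ i) g : ℝ × ℝ → ℝ) (p + t • v))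
      (fun i t => (hasDerivAt_pow_dirD v g p i t).const_mul _) (n := n)
      (fun i hi => by simp only [zero_smul, add_zero]; rw [hlow v i hi, mul_zero]) (by
        simp only [zero_smul, add_zero]
        rw [hlead, hθ, show c.arg + n * (-c.arg / n + k * (π / n)) = k * π by field_simp; ring,
          Real.cos_nat_mul_pi]
        have : (-1 : ℝ) ^ k * (‖c‖ * (-1) ^ k) = ‖c‖ * ((-1) ^ k * (-1) ^ k) := by ring
        rw [this, ← mul_pow]
        simpa using hc0)
    exact this
  choose r hr hpos using hray
  refine ⟨-c.arg / n, π / n, min (min (r 0) (r 1)) (min (r 2) (r 3)), by positivity, ?_,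
    lt_min (lt_min (hr 0) (hr 1)) (lt_min (hr 2) (hr 3)), fun k hk t ht htr => hpos k t ht ?_⟩
  · have : (2 : ℝ) ≤ n := by exact_mod_cast hn2
    rw [mul_div_assoc', div_lt_iff₀ hn0]
    nlinarith [Real.pi_pos]
  · simp only [le_min_iff] at htr
    interval_cases k
    exacts [htr.1.1, htr.1.2, htr.2.1, htr.2.2]

/-- Unique continuation. -/
theorem IsSmoothSol.eq_zero_of_eventually {μ : ℝ} {u : ℝ × ℝ → ℝ} {U : Set (ℝ × ℝ)}
    (hU : IsPreconnected U) (hu : IsSmoothSol μ u U) {x₀ : ℝ × ℝ} (hx₀ : x₀ ∈ U)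
    (h0 : ∀ᶠ x in nhds x₀, u x = 0) : ∀ x ∈ U, u x = 0 := by
  have key : U ⊆ {y | ∀ᶠ x in nhds y, u x = 0} := by
    refine hU.subset_of_closure_inter_subset (isOpen_setOfPred_eventually_nhds) ⟨x₀, hx₀, h0⟩ ?_
    rintro y ⟨hy, hyU⟩
    obtain ⟨r, hr, -, w, hw, huw, hpde⟩ := hu y hyU
    have hwz : ∀ z ∈ Metric.ball y r, (∀ᶠ x in nhds z, u x = 0) → ∀ᶠ x in nhds z, w x = 0 := by
      intro z hz h
      filter_upwards [h, Metric.isOpen_ball.mem_nhds hz] with x hx hxb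
      rw [← huw x hxb, hx]
    have hv := eventually_eq_zero_of_pow_dirD_eq_zero (g := ⟨w, hw⟩) hr hpde fun v k => by
      have hcont : Continuous ((dirD v ^ k) ⟨w, hw⟩ : ℝ × ℝ → ℝ) :=
        (differentiable_smoothSub _).continuous
      have hcl : IsClosed {z | ((dirD v ^ k) ⟨w, hw⟩ : ℝ × ℝ → ℝ) z = 0} :=
        isClosed_singleton.preimage hcont
      have hyc : y ∈ closure (Metric.ball y r ∩ {z | ∀ᶠ x in nhds z, u x = 0}) :=
        Metric.isOpen_ball.inter_closure ⟨Metric.mem_ball_self hr, hy⟩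
      refine (hcl.closure_subset_iff.2 ?_) hyc
      rintro z ⟨hzb, hz⟩
      obtain ⟨V, hV, hVo, hzV⟩ := eventually_nhds_iff.1 (hwz z hzb hz)
      exact pow_dirD_eq_zero hVo v k (g := ⟨w, hw⟩) hV z hzV
    filter_upwards [hv, Metric.ball_mem_nhds y hr] with x hx hxb
    rw [huw x hxb]
    exact hx
  exact fun x hx => (key hx).self_of_nhds

section Truncation

theorem inner_L2V_eq_integral (f g : L2V) :
    inner ℝ f g = ∫ x, (f x 0 * g x 0 + f x 1 * g x 1 + f x 2 * g x 2) := by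
  rw [inner_L2V, ← integral_add (integrable_mul_apply f g 0 0) (integrable_mul_apply f g 1 1),
    ← integral_add (f := fun x => f x 0 * g x 0 + f x 1 * g x 1)
      ((integrable_mul_apply f g 0 0).add (integrable_mul_apply f g 1 1))
      (integrable_mul_apply f g 2 2)]

theorem integral_norm_mul_norm_le (f g : L2V) :
    Integrable (fun x => ‖f x‖ * ‖g x‖) ∧ ∫ x, ‖f x‖ * ‖g x‖ ≤ ‖f‖ * ‖g‖ := by
  have hn : ∀ h : L2V, ‖((Lp.memLp h).norm.toLp _ : L2R)‖ = ‖h‖ := fun h => by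
    rw [Lp.norm_toLp, eLpNorm_norm, Lp.norm_def]
  have key := real_inner_le_norm ((Lp.memLp f).norm.toLp _ : L2R) ((Lp.memLp g).norm.toLp _)
  rw [hn, hn, L2.inner_def] at key
  refine ⟨(Lp.memLp f).norm.integrable_mul (Lp.memLp g).norm, le_of_eq_of_le ?_ key⟩
  refine integral_congr_ae ?_
  filter_upwards [(Lp.memLp f).norm.coeFn_toLp, (Lp.memLp g).norm.coeFn_toLp] with x h1 h2
  rw [h1, h2]
  simp [mul_comm]

theorem mem_sobolev_of_orthogonal {ω : Set (ℝ × ℝ)} {f : L2V}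
    (h : ∀ z : L2V, (∀ v : testSub ω, inner ℝ (jetL ω v) z = 0) → inner ℝ f z = 0) :
    f ∈ sobolev ω := by
  rw [sobolev, ← Submodule.orthogonal_orthogonal_eq_closure, Submodule.mem_orthogonal']
  intro z hz
  exact h z fun v => (Submodule.mem_orthogonal _ _).1 hz _ ⟨v, rfl⟩

variable {ω A B : Set (ℝ × ℝ)} {u w : ℝ × ℝ → ℝ} {G H : ℝ → ℝ} {δ : ℝ}

theorem indicator_eventuallyEq_zero (hu : ContDiffOn ℝ (⊤ : ℕ∞) u ω) (ho : IsOpen ω)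
    (hw : testFun ω w) (hB : IsOpen B) (hAB : Disjoint A B)
    (hP : {x | x ∈ ω ∧ 0 < u x} = A ∪ B) (hδ : 0 < δ) (hG : ∀ s ≤ δ, G s = 0)
    (hH : ∀ s ≤ δ, H s = 0) {x : ℝ × ℝ} (hx : x ∉ A) :
    A.indicator (fun x => G (u x) * H (w x)) =ᶠ[nhds x] fun _ => 0 := by
  classical
  by_cases hxω : x ∈ ω
  · by_cases hxB : x ∈ B
    · filter_upwards [hB.mem_nhds hxB] with y hy
      rw [indicator_of_notMem (hAB.notMem_of_mem_right hy)]
    · have hux : u x ≤ 0 := by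
        by_contra! hpos
        have : x ∈ A ∪ B := hP ▸ ⟨hxω, hpos⟩
        exact this.elim hx hxB
      have hc : ContinuousAt u x := hu.continuousOn.continuousAt (ho.mem_nhds hxω)
      filter_upwards [hc.eventually (gt_mem_nhds (hux.trans_lt hδ))] with y hy
      rw [indicator_apply, hG _ hy.le, zero_mul, ite_self]
  · have : x ∉ tsupport w := fun h => hxω (hw.2.2 h)
    filter_upwards [notMem_tsupport_iff_eventuallyEq.1 this] with y hy
    rw [indicator_apply, hy, Pi.zero_apply, hH 0 hδ.le, mul_zero, ite_self]

theorem indicator_eventuallyEq_self (hA : IsOpen A) {x : ℝ × ℝ} (hx : x ∈ A) (g : ℝ × ℝ → ℝ) :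
    A.indicator g =ᶠ[nhds x] g :=
  Filter.eventually_of_mem (hA.mem_nhds hx) fun _ hy => indicator_of_mem hy _

theorem testFun_indicator (hu : ContDiffOn ℝ (⊤ : ℕ∞) u ω) (ho : IsOpen ω) (hw : testFun ω w)
    (hA : IsOpen A) (hB : IsOpen B) (hAB : Disjoint A B) (hP : {x | x ∈ ω ∧ 0 < u x} = A ∪ B)
    (hδ : 0 < δ) (hG : ∀ s ≤ δ, G s = 0) (hH : ∀ s ≤ δ, H s = 0)
    (hGs : ContDiff ℝ (⊤ : ℕ∞) G) (hHs : ContDiff ℝ (⊤ : ℕ∞) H) :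
    testFun ω (A.indicator fun x => G (u x) * H (w x)) := by
  have hs : tsupport (A.indicator fun x => G (u x) * H (w x)) ⊆ tsupport w := by
    refine closure_mono fun x hx => ?_
    by_contra hx'
    rw [Function.mem_support, not_not] at hx'
    apply hx
    classical
    rw [indicator_apply, hx', hH 0 hδ.le, mul_zero, ite_self]
  refine ⟨contDiff_iff_contDiffAt.2 fun x => ?_, hw.2.1.of_isClosed_subset (isClosed_tsupport _) hs,
    hs.trans hw.2.2⟩
  by_cases hx : x ∈ A
  · have hxω : x ∈ ω := (hP.symm.subset (Or.inl hx) : x ∈ {x | x ∈ ω ∧ 0 < u x}).1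
    refine ContDiffAt.congr_of_eventuallyEq ?_ (indicator_eventuallyEq_self hA hx _)
    exact (hGs.contDiffAt.comp x (hu.contDiffAt (ho.mem_nhds hxω))).mul
      (hHs.contDiffAt.comp x hw.1.contDiffAt)
  · exact contDiffAt_const.congr_of_eventuallyEq
      (indicator_eventuallyEq_zero hu ho hw hB hAB hP hδ hG hH hx)

theorem fderiv_indicator (hu : ContDiffOn ℝ (⊤ : ℕ∞) u ω) (ho : IsOpen ω) (hw : testFun ω w)
    (hA : IsOpen A) (hAω : A ⊆ ω)
    (hGs : ContDiff ℝ (⊤ : ℕ∞) G) (hHs : ContDiff ℝ (⊤ : ℕ∞) H) {x : ℝ × ℝ} (hx : x ∈ A)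
    (v : ℝ × ℝ) :
    fderiv ℝ (A.indicator fun x => G (u x) * H (w x)) x v =
      deriv G (u x) * H (w x) * fderiv ℝ u x v + G (u x) * deriv H (w x) * fderiv ℝ w x v := by
  rw [(indicator_eventuallyEq_self hA hx _).fderiv_eq]
  have h1 : HasFDerivAt u (fderiv ℝ u x) x :=
    ((hu.contDiffAt (ho.mem_nhds (hAω hx))).differentiableAt (by simp)).hasFDerivAt
  have h2 : HasFDerivAt w (fderiv ℝ w x) x := (hw.1.differentiable (by simp) x).hasFDerivAt
  have h3 : HasDerivAt G (deriv G (u x)) (u x) := (hGs.differentiable (by simp) _).hasDerivAt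
  have h4 : HasDerivAt H (deriv H (w x)) (w x) := (hHs.differentiable (by simp) _).hasDerivAt
  have h5 : HasFDerivAt (fun x => G (u x) * H (w x)) _ x :=
    (h3.comp_hasFDerivAt x h1).mul (h4.comp_hasFDerivAt x h2)
  rw [h5.fderiv]
  simp
  ring

/-- The weak form of the truncation identity: passing to the limit along an approximating
sequence. -/
theorem integral_truncation_eq_zero (ho : IsOpen ω) {f : L2V} (hf : f ∈ sobolev ω)
    (hu : ContDiffOn ℝ (⊤ : ℕ∞) u ω) (hfu : ∀ᵐ x, x ∈ ω → f x = jet u x)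
    (hA : IsOpen A) (hB : IsOpen B) (hAB : Disjoint A B) (hP : {x | x ∈ ω ∧ 0 < u x} = A ∪ B)
    (hδ : 0 < δ) (hG : ∀ s ≤ δ, G s = 0) (hH : ∀ s ≤ δ, H s = 0)
    (hGs : ContDiff ℝ (⊤ : ℕ∞) G) (hHs : ContDiff ℝ (⊤ : ℕ∞) H) {K : ℝ}
    (hG1 : ∀ s, |G s| ≤ |s|) (hG2 : ∀ s, |G s| ≤ K) (hG3 : ∀ s, |deriv G s| ≤ K)
    (hH1 : ∀ s, |H s| ≤ 1) (hH2 : ∀ s, |deriv H s| ≤ K)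
    {z : L2V} (hz : ∀ v : testSub ω, inner ℝ (jetL ω v) z = 0) :
    ∫ x in A, (G (f x 0) * H (f x 0) * z x 0 +
      (deriv G (f x 0) * H (f x 0) + G (f x 0) * deriv H (f x 0)) *
        (f x 1 * z x 1 + f x 2 * z x 2)) = 0 := by
  have hK : 0 ≤ K := (abs_nonneg _).trans (hG2 0)
  have hAω : A ⊆ ω := fun x hx => (hP.symm.subset (Or.inl hx) : x ∈ {x | x ∈ ω ∧ 0 < u x}).1
  obtain ⟨w, hwf, hwae⟩ := exists_seq_tendsto_sobolev hf
  have hw : ∀ n, testFun ω (w n) := fun n => (w n).2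
  set X : ℕ → ℝ × ℝ → ℝ := fun n x => G (f x 0) * H ((w n : ℝ × ℝ → ℝ) x) * z x 0 +
      (deriv G (f x 0) * H ((w n : ℝ × ℝ → ℝ) x) + G (f x 0) * deriv H ((w n : ℝ × ℝ → ℝ) x)) *
        (f x 1 * z x 1 + f x 2 * z x 2) with hX
  set Y : ℕ → ℝ × ℝ → ℝ := fun n x => G (f x 0) * deriv H ((w n : ℝ × ℝ → ℝ) x) *
    ((jetL ω (w n) - f) x 1 * z x 1 + (jetL ω (w n) - f) x 2 * z x 2) with hY
  have hGc := hGs.continuous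
  have hHc := hHs.continuous
  have hG'c : Continuous (deriv G) := hGs.continuous_deriv (by simp)
  have hH'c : Continuous (deriv H) := hHs.continuous_deriv (by simp)
  have hwc : ∀ n, Continuous (w n : ℝ × ℝ → ℝ) := fun n => (hw n).1.continuous
  have hm : ∀ (h : L2V) i, AEStronglyMeasurable (fun x => h x i) (volume.restrict A) :=
    fun h i => (memLp_apply h i).1.restrict
  have hmw : ∀ {g : ℝ → ℝ}, Continuous g → ∀ n,
      AEStronglyMeasurable (fun x => g ((w n : ℝ × ℝ → ℝ) x)) (volume.restrict A) :=
    fun hg n => (hg.comp (hwc n)).aestronglyMeasurable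
  have hmf : ∀ {g : ℝ → ℝ}, Continuous g →
      AEStronglyMeasurable (fun x => g (f x 0)) (volume.restrict A) :=
    fun hg => hg.comp_aestronglyMeasurable (hm f 0)
  have hXm : ∀ n, AEStronglyMeasurable (X n) (volume.restrict A) := fun n =>
    (((hmf hGc).mul (hmw hHc n)).mul (hm z 0)).add
      ((((hmf hG'c).mul (hmw hHc n)).add ((hmf hGc).mul (hmw hH'c n))).mul
        (((hm f 1).mul (hm z 1)).add ((hm f 2).mul (hm z 2))))
  have hYm : ∀ n, AEStronglyMeasurable (Y n) (volume.restrict A) := fun n =>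
    ((hmf hGc).mul (hmw hH'c n)).mul
      (((hm _ 1).mul (hm z 1)).add ((hm _ 2).mul (hm z 2)))
  have hap : ∀ (h : L2V) x i, |h x i| ≤ ‖h x‖ := fun h x i => PiLp.norm_apply_le (h x) i
  have hpr : ∀ (h : L2V) x i, |h x i * z x i| ≤ ‖h x‖ * ‖z x‖ := fun h x i => by
    rw [abs_mul]
    exact mul_le_mul (hap h x i) (hap z x i) (abs_nonneg _) (norm_nonneg _)
  have hpr2 : ∀ (h : L2V) x, |h x 1 * z x 1 + h x 2 * z x 2| ≤ 2 * (‖h x‖ * ‖z x‖) := fun h x => by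
    refine (abs_add_le _ _).trans ?_
    linarith [hpr h x 1, hpr h x 2]
  have hXb : ∀ n x, ‖X n x‖ ≤ (1 + 2 * (K + K * K)) * (‖f x‖ * ‖z x‖) := by
    intro n x
    rw [Real.norm_eq_abs, hX]
    refine (abs_add_le _ _).trans ?_
    have h1 : |G (f x 0) * H ((w n : ℝ × ℝ → ℝ) x) * z x 0| ≤ ‖f x‖ * ‖z x‖ := by
      rw [abs_mul, abs_mul]
      calc |G (f x 0)| * |H ((w n : ℝ × ℝ → ℝ) x)| * |z x 0| ≤ ‖f x‖ * 1 * ‖z x‖ := by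
            gcongr
            · exact (hG1 _).trans (hap f x 0)
            · exact hH1 _
            · exact hap z x 0
        _ = ‖f x‖ * ‖z x‖ := by ring
    have h2 : |deriv G (f x 0) * H ((w n : ℝ × ℝ → ℝ) x) +
        G (f x 0) * deriv H ((w n : ℝ × ℝ → ℝ) x)| ≤ K + K * K := by
      refine (abs_add_le _ _).trans ?_
      rw [abs_mul, abs_mul]
      refine add_le_add ?_ ?_
      · simpa using mul_le_mul (hG3 _) (hH1 _) (abs_nonneg _) hK
      · exact mul_le_mul (hG2 _) (hH2 _) (abs_nonneg _) hK
    have h3 := mul_le_mul h2 (hpr2 f x) (abs_nonneg _) (by positivity)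
    refine (add_le_add h1 ((abs_mul _ _).trans_le h3)).trans ?_
    linarith
  have hYb : ∀ n x, ‖Y n x‖ ≤ 2 * (K * K) * (‖(jetL ω (w n) - f) x‖ * ‖z x‖) := by
    intro n x
    rw [Real.norm_eq_abs, hY, abs_mul, abs_mul]
    have h1 : |G (f x 0)| * |deriv H ((w n : ℝ × ℝ → ℝ) x)| ≤ K * K :=
      mul_le_mul (hG2 _) (hH2 _) (abs_nonneg _) hK
    have h3 := mul_le_mul h1 (hpr2 (jetL ω (w n) - f) x) (abs_nonneg _) (by positivity)
    linarith
  have hXi : ∀ n, Integrable (X n) (volume.restrict A) := fun n =>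
    (((integral_norm_mul_norm_le f z).1.const_mul _).restrict).mono' (hXm n) (.of_forall (hXb n))
  have hYi : ∀ n, Integrable (Y n) (volume.restrict A) := fun n =>
    (((integral_norm_mul_norm_le _ z).1.const_mul _).restrict).mono' (hYm n) (.of_forall (hYb n))
  have hsum : ∀ n, (∫ x in A, X n x) + ∫ x in A, Y n x = 0 := by
    intro n
    have ht := testFun_indicator hu ho (hw n) hA hB hAB hP hδ hG hH hGs hHs
    rw [← hz ⟨_, ht⟩, inner_L2V_eq_integral, ← integral_add (hXi n) (hYi n),
      ← integral_indicator hA.measurableSet]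
    refine integral_congr_ae ?_
    filter_upwards [hfu, coeFn_jetL (ω := ω) ⟨_, ht⟩, coeFn_jetL (w n),
      Lp.coeFn_sub (jetL ω (w n)) f] with x h1 h2 h3 h4
    rw [h2]
    by_cases hx : x ∈ A
    · have h5 : ∀ i, (jetL ω (w n) - f) x i = jet (w n) x i - f x i := fun i => by
        rw [h4, Pi.sub_apply, h3]
        rfl
      rw [indicator_of_mem hx]
      simp only [hX, hY, h5]
      simp only [h1 (hAω hx), jet_zero, jet_one, jet_two,
        fderiv_indicator hu ho (hw n) hA hAω hGs hHs hx]
      rw [indicator_of_mem hx]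
      ring
    · have h5 := indicator_eventuallyEq_zero hu ho (hw n) hB hAB hP hδ hG hH hx
      rw [indicator_of_notMem hx]
      simp only [jet_zero, jet_one, jet_two, h5.fderiv_eq, h5.self_of_nhds]
      simp
  have hY0 : Filter.Tendsto (fun n => ∫ x in A, Y n x) Filter.atTop (nhds 0) := by
    have hlim : Filter.Tendsto (fun n => 2 * (K * K) * (‖jetL ω (w n) - f‖ * ‖z‖)) Filter.atTop
        (nhds 0) := by
      have := (((tendsto_iff_norm_sub_tendsto_zero.1 hwf).mul_const ‖z‖).const_mul (2 * (K * K)))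
      simpa using this
    refine squeeze_zero_norm (fun n => ?_) hlim
    have hi := (integral_norm_mul_norm_le (jetL ω (w n) - f) z)
    refine (norm_integral_le_integral_norm _).trans ?_
    calc ∫ x in A, ‖Y n x‖ ≤ ∫ x in A, 2 * (K * K) * (‖(jetL ω (w n) - f) x‖ * ‖z x‖) :=
          integral_mono (hYi n).norm (hi.1.const_mul _).restrict (hYb n)
      _ ≤ ∫ x, 2 * (K * K) * (‖(jetL ω (w n) - f) x‖ * ‖z x‖) :=
          setIntegral_le_integral (hi.1.const_mul _) (.of_forall fun x => by positivity)
      _ ≤ _ := by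
          rw [integral_const_mul]
          exact mul_le_mul_of_nonneg_left hi.2 (by positivity)
  have hX0 : Filter.Tendsto (fun n => ∫ x in A, X n x) Filter.atTop (nhds (∫ x in A,
      (G (f x 0) * H (f x 0) * z x 0 +
      (deriv G (f x 0) * H (f x 0) + G (f x 0) * deriv H (f x 0)) *
        (f x 1 * z x 1 + f x 2 * z x 2)))) := by
    refine tendsto_integral_of_dominated_convergence _ hXm
      ((integral_norm_mul_norm_le f z).1.const_mul _).restrict (fun n => .of_forall (hXb n)) ?_
    filter_upwards [ae_restrict_of_ae hwae] with x hx
    have h0 : Filter.Tendsto (fun n => (w n : ℝ × ℝ → ℝ) x) Filter.atTop (nhds (f x 0)) := by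
      have := ((PiLp.continuous_apply 2 (fun _ : Fin 3 => ℝ) 0).tendsto (f x)).comp hx
      exact this
    have h1 := (hHc.tendsto _).comp h0
    have h2 := (hH'c.tendsto _).comp h0
    exact ((h1.const_mul _).mul_const _).add (((h1.const_mul _).add (h2.const_mul _)).mul_const _)
  have := hX0.add hY0
  simp only [hsum, add_zero] at this
  exact tendsto_nhds_unique this tendsto_const_nhds

end Truncation

/-- A smooth cut-off vanishing on `s ≤ κ⁻¹` and equal to one on `2 κ⁻¹ ≤ s`. -/
def lowCut (κ s : ℝ) : ℝ := smoothTransition (κ * s - 1)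

/-- A smooth bounded truncation of the positive part. -/
def truncPos (κ s : ℝ) : ℝ := lowCut κ s * (κ * sin (s / κ))

theorem contDiff_lowCut (κ : ℝ) : ContDiff ℝ (⊤ : ℕ∞) (lowCut κ) :=
  smoothTransition.contDiff.comp ((contDiff_const.mul contDiff_id).sub contDiff_const)

theorem contDiff_truncPos (κ : ℝ) : ContDiff ℝ (⊤ : ℕ∞) (truncPos κ) :=
  (contDiff_lowCut κ).mul (contDiff_const.mul (contDiff_sin.comp (contDiff_id.div_const κ)))

theorem exists_bound_deriv_smoothTransition :
    ∃ C : ℝ, 0 ≤ C ∧ (∀ s, |deriv smoothTransition s| ≤ C) ∧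
      ∀ s, s ∉ Icc (0 : ℝ) 1 → deriv smoothTransition s = 0 := by
  have h0 : ∀ s, s ∉ Icc (0 : ℝ) 1 → deriv smoothTransition s = 0 := by
    intro s hs
    rcases lt_or_ge s 0 with h | h
    · have : smoothTransition =ᶠ[nhds s] fun _ => 0 := by
        filter_upwards [Iio_mem_nhds h] with t ht
        exact smoothTransition.zero_of_nonpos (le_of_lt ht)
      rw [this.deriv_eq, deriv_const]
    · have h1 : 1 < s := by
        by_contra! h2
        exact hs ⟨h, h2⟩
      have : smoothTransition =ᶠ[nhds s] fun _ => 1 := by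
        filter_upwards [Ioi_mem_nhds h1] with t ht
        exact smoothTransition.one_of_one_le (le_of_lt ht)
      rw [this.deriv_eq, deriv_const]
  have hc : Continuous (deriv smoothTransition) :=
    (smoothTransition.contDiff (n := 1)).continuous_deriv le_rfl
  obtain ⟨C, hC⟩ := (isCompact_Icc (a := (0 : ℝ)) (b := 1)).exists_bound_of_continuousOn
    hc.continuousOn
  refine ⟨max C 0, le_max_right _ _, fun s => ?_, h0⟩
  by_cases hs : s ∈ Icc (0 : ℝ) 1
  · exact (hC s hs).trans (le_max_left _ _)
  · rw [h0 s hs, abs_zero]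
    exact le_max_right _ _

theorem hasDerivAt_lowCut (κ s : ℝ) :
    HasDerivAt (lowCut κ) (deriv smoothTransition (κ * s - 1) * κ) s := by
  have h1 : HasDerivAt smoothTransition (deriv smoothTransition (κ * s - 1)) (κ * s - 1) :=
    ((smoothTransition.contDiff (n := 1)).differentiable (by simp) _).hasDerivAt
  have h2 : HasDerivAt (fun t : ℝ => κ * t - 1) κ s := by
    simpa using ((hasDerivAt_id s).const_mul κ).sub_const 1
  exact h1.comp s h2

theorem hasDerivAt_truncPos {κ : ℝ} (hκ : 0 < κ) (s : ℝ) :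
    HasDerivAt (truncPos κ) (deriv smoothTransition (κ * s - 1) * κ * (κ * sin (s / κ)) +
      lowCut κ s * cos (s / κ)) s := by
  have h2 : HasDerivAt (fun t : ℝ => κ * sin (t / κ)) (cos (s / κ)) s := by
    refine ((((hasDerivAt_id s).div_const κ).sin).const_mul κ).congr_deriv ?_
    simp only [id]
    field_simp
  exact (hasDerivAt_lowCut κ s).mul h2

theorem abs_lowCut_le (κ s : ℝ) : |lowCut κ s| ≤ 1 := by
  rw [lowCut, abs_of_nonneg (smoothTransition.nonneg _)]
  exact smoothTransition.le_one _

theorem lowCut_eq_zero {κ s : ℝ} (hκ : 0 < κ) (hs : s ≤ κ⁻¹) : lowCut κ s = 0 := by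
  refine smoothTransition.zero_of_nonpos ?_
  have := mul_le_mul_of_nonneg_left hs hκ.le
  rw [mul_inv_cancel₀ hκ.ne'] at this
  linarith

theorem abs_mul_sin_div_le {κ : ℝ} (hκ : 0 < κ) (s : ℝ) : |κ * sin (s / κ)| ≤ |s| := by
  rw [abs_mul, abs_of_pos hκ]
  calc κ * |sin (s / κ)| ≤ κ * |s / κ| := mul_le_mul_of_nonneg_left abs_sin_le_abs hκ.le
    _ = |s| := by rw [abs_div, abs_of_pos hκ]; field_simp

theorem abs_truncPos_le_abs {κ : ℝ} (hκ : 0 < κ) (s : ℝ) : |truncPos κ s| ≤ |s| := by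
  rw [truncPos, abs_mul]
  simpa using mul_le_mul (abs_lowCut_le κ s) (abs_mul_sin_div_le hκ s) (abs_nonneg _) zero_le_one

theorem abs_truncPos_le {κ : ℝ} (hκ : 0 < κ) (s : ℝ) : |truncPos κ s| ≤ κ := by
  rw [truncPos, abs_mul, abs_mul, abs_of_pos hκ]
  have h1 : κ * |sin (s / κ)| ≤ κ := by
    simpa using mul_le_mul_of_nonneg_left (abs_sin_le_one (s / κ)) hκ.le
  simpa using mul_le_mul (abs_lowCut_le κ s) h1 (by positivity) zero_le_one

theorem abs_deriv_lowCut_mul_le {κ C : ℝ} (hκ : 0 < κ) (hC0 : 0 ≤ C)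
    (hC : ∀ s, |deriv smoothTransition s| ≤ C)
    (h0 : ∀ s, s ∉ Icc (0 : ℝ) 1 → deriv smoothTransition s = 0) {s t : ℝ} (ht : |t| ≤ |s|) :
    |deriv smoothTransition (κ * s - 1) * κ * t| ≤ 2 * C := by
  by_cases hs : κ * s - 1 ∈ Icc (0 : ℝ) 1
  · have h1 : 0 ≤ s := by
      by_contra! h
      nlinarith [hs.1]
    rw [mul_assoc, abs_mul, abs_mul, abs_of_pos hκ]
    rw [abs_of_nonneg h1] at ht
    have h2 : κ * |t| ≤ 2 := (mul_le_mul_of_nonneg_left ht hκ.le).trans (by linarith [hs.2])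
    calc _ ≤ C * 2 := mul_le_mul (hC _) h2 (by positivity) hC0
      _ = 2 * C := by ring
  · rw [h0 _ hs]
    simpa using hC0

theorem abs_deriv_truncPos_le {κ C : ℝ} (hκ : 0 < κ) (hC0 : 0 ≤ C)
    (hC : ∀ s, |deriv smoothTransition s| ≤ C)
    (h0 : ∀ s, s ∉ Icc (0 : ℝ) 1 → deriv smoothTransition s = 0) (s : ℝ) :
    |deriv (truncPos κ) s| ≤ 2 * C + 1 := by
  rw [(hasDerivAt_truncPos hκ s).deriv]
  refine (abs_add_le _ _).trans (add_le_add
    (abs_deriv_lowCut_mul_le hκ hC0 hC h0 (abs_mul_sin_div_le hκ s)) ?_)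
  rw [abs_mul]
  simpa using mul_le_mul (abs_lowCut_le κ s) (abs_cos_le_one (s / κ)) (abs_nonneg _) zero_le_one

theorem abs_deriv_truncPos_mul_lowCut_le {κ C : ℝ} (hκ : 0 < κ) (hC0 : 0 ≤ C)
    (hC : ∀ s, |deriv smoothTransition s| ≤ C)
    (h0 : ∀ s, s ∉ Icc (0 : ℝ) 1 → deriv smoothTransition s = 0) (s : ℝ) :
    |deriv (truncPos κ) s * lowCut κ s + truncPos κ s * deriv (lowCut κ) s| ≤ 4 * C + 1 := by
  have h1 : |deriv (truncPos κ) s * lowCut κ s| ≤ 2 * C + 1 := by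
    rw [abs_mul]
    simpa using mul_le_mul (abs_deriv_truncPos_le hκ hC0 hC h0 s) (abs_lowCut_le κ s)
      (abs_nonneg _) (by positivity)
  have h2 : |truncPos κ s * deriv (lowCut κ) s| ≤ 2 * C := by
    rw [(hasDerivAt_lowCut κ s).deriv, mul_comm]
    exact abs_deriv_lowCut_mul_le hκ hC0 hC h0 (abs_truncPos_le_abs hκ s)
  refine (abs_add_le _ _).trans ?_
  linarith

theorem eventually_truncPos_eq {s : ℝ} (hs : 0 < s) : ∀ᶠ n : ℕ in Filter.atTop,
    truncPos (n + 1) s * lowCut (n + 1) s = (n + 1) * sin (s / (n + 1)) ∧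
      deriv (truncPos (n + 1)) s * lowCut (n + 1) s + truncPos (n + 1) s *
        deriv (lowCut (n + 1)) s = cos (s / (n + 1)) := by
  obtain ⟨C, -, -, h0⟩ := exists_bound_deriv_smoothTransition
  obtain ⟨N, hN⟩ := exists_nat_gt (2 / s)
  filter_upwards [Filter.eventually_ge_atTop N] with n hn
  have h1 : (2 : ℝ) < ((n : ℝ) + 1) * s := by
    rw [div_lt_iff₀ hs] at hN
    have : (N : ℝ) ≤ n := by exact_mod_cast hn
    nlinarith
  have hκ : (0 : ℝ) < n + 1 := by positivity
  have hc : lowCut (n + 1) s = 1 := smoothTransition.one_of_one_le (by linarith)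
  have hd : deriv smoothTransition ((n + 1) * s - 1) = 0 := h0 _ fun h => by linarith [h.2]
  rw [(hasDerivAt_truncPos hκ s).deriv, (hasDerivAt_lowCut _ s).deriv, truncPos, hc, hd]
  constructor <;> ring

theorem tendsto_mul_sin_div (s : ℝ) :
    Filter.Tendsto (fun n : ℕ => ((n : ℝ) + 1) * sin (s / (n + 1))) Filter.atTop (nhds s) := by
  have h1 : HasDerivAt (fun t : ℝ => sin (s * t)) s 0 := by
    have := ((hasDerivAt_id (0 : ℝ)).const_mul s).sin
    simpa using this
  have h2 : Filter.Tendsto (fun n : ℕ => 1 / ((n : ℝ) + 1)) Filter.atTop (nhdsWithin 0 {0}ᶜ) :=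
    tendsto_nhdsWithin_iff.2 ⟨tendsto_one_div_add_atTop_nhds_zero_nat,
      .of_forall fun n => (by positivity : (1 : ℝ) / (n + 1) ≠ 0)⟩
  have h3 := (hasDerivAt_iff_tendsto_slope_zero.1 h1).comp h2
  refine h3.congr fun n => ?_
  simp [div_eq_mul_inv]

theorem tendsto_cos_div (s : ℝ) :
    Filter.Tendsto (fun n : ℕ => cos (s / (n + 1))) Filter.atTop (nhds 1) := by
  have h2 : Filter.Tendsto (fun n : ℕ => s * (1 / ((n : ℝ) + 1))) Filter.atTop (nhds (s * 0)) :=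
    tendsto_one_div_add_atTop_nhds_zero_nat.const_mul s
  have h3 := (continuous_cos.tendsto _).comp h2
  simp only [mul_zero, cos_zero] at h3
  refine h3.congr fun n => ?_
  simp [div_eq_mul_inv]

/-- Restricting a square integrable jet to a measurable set. -/
def restrictL {A : Set (ℝ × ℝ)} (hA : MeasurableSet A) (f : L2V) : L2V :=
  ((Lp.memLp f).indicator hA).toLp _

theorem coeFn_restrictL {A : Set (ℝ × ℝ)} (hA : MeasurableSet A) (f : L2V) :
    restrictL hA f =ᵐ[volume] A.indicator f :=
  MemLp.coeFn_toLp _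

theorem inner_restrictL {A : Set (ℝ × ℝ)} (hA : MeasurableSet A) (f z : L2V) :
    inner ℝ (restrictL hA f) z = ∫ x in A, (f x 0 * z x 0 + f x 1 * z x 1 + f x 2 * z x 2) := by
  rw [inner_L2V_eq_integral, ← integral_indicator hA]
  refine integral_congr_ae ?_
  filter_upwards [coeFn_restrictL hA f] with x hx
  rw [hx]
  by_cases h : x ∈ A <;> simp [h]

/-- The restriction of a Sobolev function to a union of components of its positivity set is again
a Sobolev function vanishing on the boundary. -/
theorem restrictL_mem_sobolev {ω A B : Set (ℝ × ℝ)} {u : ℝ × ℝ → ℝ} (ho : IsOpen ω) {f : L2V}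
    (hf : f ∈ sobolev ω) (hu : ContDiffOn ℝ (⊤ : ℕ∞) u ω)
    (hfu : ∀ᵐ x, x ∈ ω → f x = jet u x) (hA : IsOpen A) (hB : IsOpen B) (hAB : Disjoint A B)
    (hP : {x | x ∈ ω ∧ 0 < u x} = A ∪ B) : restrictL hA.measurableSet f ∈ sobolev ω := by
  refine mem_sobolev_of_orthogonal fun z hz => ?_
  rw [inner_restrictL]
  obtain ⟨C, hC0, hC, h0⟩ := exists_bound_deriv_smoothTransition
  set X : ℕ → ℝ × ℝ → ℝ := fun n x =>
    truncPos (n + 1) (f x 0) * lowCut (n + 1) (f x 0) * z x 0 +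
      (deriv (truncPos (n + 1)) (f x 0) * lowCut (n + 1) (f x 0) +
        truncPos (n + 1) (f x 0) * deriv (lowCut (n + 1)) (f x 0)) *
        (f x 1 * z x 1 + f x 2 * z x 2) with hX
  have hX0 : ∀ n, ∫ x in A, X n x = 0 := by
    intro n
    have hκ : (0 : ℝ) < n + 1 := by positivity
    have hK : ∀ s, |deriv (lowCut (n + 1)) s| ≤ C * (n + 1) := fun s => by
      rw [(hasDerivAt_lowCut _ s).deriv, abs_mul, abs_of_pos hκ]
      exact mul_le_mul_of_nonneg_right (hC _) hκ.le
    refine integral_truncation_eq_zero (K := (n + 1) + (2 * C + 1) + C * (n + 1)) ho hf hu hfu hA hB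
      hAB hP (inv_pos.2 hκ) (fun s hs => ?_) (fun s hs => lowCut_eq_zero hκ hs)
      (contDiff_truncPos _) (contDiff_lowCut _) (abs_truncPos_le_abs hκ)
      (fun s => (abs_truncPos_le hκ s).trans ?_)
      (fun s => (abs_deriv_truncPos_le hκ hC0 hC h0 s).trans ?_) (abs_lowCut_le _)
      (fun s => (hK s).trans ?_) hz
    · rw [truncPos, lowCut_eq_zero hκ hs, zero_mul]
    all_goals nlinarith [mul_nonneg hC0 hκ.le]
  have hm : ∀ (h : L2V) i, AEStronglyMeasurable (fun x => h x i) (volume.restrict A) :=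
    fun h i => (memLp_apply h i).1.restrict
  have hmf : ∀ {g : ℝ → ℝ}, Continuous g →
      AEStronglyMeasurable (fun x => g (f x 0)) (volume.restrict A) :=
    fun hg => hg.comp_aestronglyMeasurable (hm f 0)
  have hXm : ∀ n, AEStronglyMeasurable (X n) (volume.restrict A) := fun n =>
    (((hmf (contDiff_truncPos _).continuous).mul (hmf (contDiff_lowCut _).continuous)).mul
      (hm z 0)).add
      ((((hmf ((contDiff_truncPos _).continuous_deriv (by simp))).mul
        (hmf (contDiff_lowCut _).continuous)).add ((hmf (contDiff_truncPos _).continuous).mul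
        (hmf ((contDiff_lowCut _).continuous_deriv (by simp))))).mul
        (((hm f 1).mul (hm z 1)).add ((hm f 2).mul (hm z 2))))
  have hap : ∀ (h : L2V) x i, |h x i| ≤ ‖h x‖ := fun h x i => PiLp.norm_apply_le (h x) i
  have hpr : ∀ x i, |f x i * z x i| ≤ ‖f x‖ * ‖z x‖ := fun x i => by
    rw [abs_mul]
    exact mul_le_mul (hap f x i) (hap z x i) (abs_nonneg _) (norm_nonneg _)
  have hXb : ∀ n x, ‖X n x‖ ≤ (1 + (4 * C + 1) * 2) * (‖f x‖ * ‖z x‖) := by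
    intro n x
    have hκ : (0 : ℝ) < n + 1 := by positivity
    rw [Real.norm_eq_abs, hX]
    refine (abs_add_le _ _).trans ?_
    have h1 : |truncPos (n + 1) (f x 0) * lowCut (n + 1) (f x 0) * z x 0| ≤ ‖f x‖ * ‖z x‖ := by
      rw [abs_mul, abs_mul]
      calc _ ≤ ‖f x‖ * 1 * ‖z x‖ := by
            gcongr
            · exact (abs_truncPos_le_abs hκ _).trans (hap f x 0)
            · exact abs_lowCut_le _ _
            · exact hap z x 0
        _ = ‖f x‖ * ‖z x‖ := by ring
    have h2 : |f x 1 * z x 1 + f x 2 * z x 2| ≤ 2 * (‖f x‖ * ‖z x‖) :=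
      (abs_add_le _ _).trans (by linarith [hpr x 1, hpr x 2])
    have h3 := mul_le_mul (abs_deriv_truncPos_mul_lowCut_le hκ hC0 hC h0 (f x 0)) h2
      (abs_nonneg _) (by positivity)
    refine (add_le_add h1 ((abs_mul _ _).trans_le h3)).trans ?_
    linarith
  have hlim : Filter.Tendsto (fun n => ∫ x in A, X n x) Filter.atTop
      (nhds (∫ x in A, (f x 0 * z x 0 + f x 1 * z x 1 + f x 2 * z x 2))) := by
    refine tendsto_integral_of_dominated_convergence _ hXm
      ((integral_norm_mul_norm_le f z).1.const_mul _).restrict (fun n => .of_forall (hXb n)) ?_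
    filter_upwards [ae_restrict_of_ae hfu, ae_restrict_mem hA.measurableSet] with x hx hxA
    have hxP : x ∈ {x | x ∈ ω ∧ 0 < u x} := hP ▸ Or.inl hxA
    have hpos : 0 < f x 0 := by
      rw [hx hxP.1]
      exact hxP.2
    have h1 := ((tendsto_mul_sin_div (f x 0)).mul_const (z x 0)).add
      ((tendsto_cos_div (f x 0)).mul_const (f x 1 * z x 1 + f x 2 * z x 2))
    rw [one_mul, ← add_assoc] at h1
    refine h1.congr' ?_
    filter_upwards [eventually_truncPos_eq hpos] with n hn
    simp only [hX, hn.1, hn.2]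
  simp only [hX0] at hlim
  exact tendsto_nhds_unique hlim tendsto_const_nhds

theorem inner_restrictL_self {A : Set (ℝ × ℝ)} (hA : MeasurableSet A) (f : L2V) :
    inner ℝ (restrictL hA f) (restrictL hA f) = inner ℝ (restrictL hA f) f := by
  rw [inner_restrictL, inner_restrictL]
  refine setIntegral_congr_ae hA ?_
  filter_upwards [coeFn_restrictL hA f] with x hx hxA
  rw [hx, indicator_of_mem hxA]

theorem inner_restrictL_of_disjoint {A B : Set (ℝ × ℝ)} (hA : MeasurableSet A)
    (hB : MeasurableSet B) (hAB : Disjoint A B) (f : L2V) :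
    inner ℝ (restrictL hA f) (restrictL hB f) = 0 := by
  rw [inner_restrictL]
  refine setIntegral_eq_zero_of_ae_eq_zero ?_
  filter_upwards [coeFn_restrictL hB f] with x hx hxA
  rw [hx, indicator_of_notMem (disjoint_left.1 hAB hxA)]
  simp

theorem inner_solOp_restrictL_self {ω A : Set (ℝ × ℝ)} (hA : MeasurableSet A) (f w : sobolev ω)
    (hw : (w : L2V) = restrictL hA f) :
    inner ℝ (solOp ω w) w = inner ℝ (solOp ω f) w := by
  rw [inner_solOp, inner_solOp]
  refine integral_congr_ae ?_
  filter_upwards [coeFn_restrictL hA (f : L2V)] with x hx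
  rw [hw, hx]
  by_cases h : x ∈ A <;> simp [h]

theorem inner_solOp_restrictL_of_disjoint {ω A B : Set (ℝ × ℝ)} (hA : MeasurableSet A)
    (hB : MeasurableSet B) (hAB : Disjoint A B) (f w v : sobolev ω)
    (hw : (w : L2V) = restrictL hA f) (hv : (v : L2V) = restrictL hB f) :
    inner ℝ (solOp ω w) v = 0 := by
  rw [inner_solOp, ← integral_zero (ℝ × ℝ) ℝ (μ := volume)]
  refine integral_congr_ae ?_
  filter_upwards [coeFn_restrictL hA (f : L2V), coeFn_restrictL hB (f : L2V)] with x hx hx'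
  rw [hw, hv, hx, hx']
  by_cases h : x ∈ A
  · simp [h, disjoint_left.1 hAB h]
  · simp [h]

theorem exists_ne_zero_mul_add_mul_eq_zero (α β : ℝ) :
    ∃ s t : ℝ, (s ≠ 0 ∨ t ≠ 0) ∧ s * α + t * β = 0 := by
  by_cases h : β = 0
  · exact ⟨0, 1, .inr one_ne_zero, by simp [h]⟩
  · exact ⟨β, -α, .inl h, by ring⟩

/-- If an eigenvector `f` for the second largest eigenvalue splits off two orthogonal pieces `w`
and `v`, then some combination of the pieces is an eigenvector too. -/
theorem exists_eigenvector_combination {H : Type*} [NormedAddCommGroup H] [InnerProductSpace ℝ H]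
    (T : H →L[ℝ] H) (hT : (T : H →ₗ[ℝ] H).IsSymmetric) {e f w v : H} {a m : ℝ} (he : T e = a • e)
    (hmax : ∀ y, inner ℝ e y = 0 → inner ℝ (T y) y ≤ m * ‖y‖ ^ 2) (hf : T f = m • f)
    (hw : inner ℝ w w = inner ℝ f w) (hv : inner ℝ v v = inner ℝ f v) (hwv : inner ℝ w v = 0)
    (hTw : inner ℝ (T w) w = inner ℝ (T f) w) (hTv : inner ℝ (T v) v = inner ℝ (T f) v)
    (hTwv : inner ℝ (T w) v = 0) :
    ∃ s t : ℝ, (s ≠ 0 ∨ t ≠ 0) ∧ T (s • w + t • v) = m • (s • w + t • v) := by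
  obtain ⟨s, t, hst, h0⟩ := exists_ne_zero_mul_add_mul_eq_zero (inner ℝ e w) (inner ℝ e v)
  have hTvw : inner ℝ (T v) w = 0 := by
    rw [← hTwv, real_inner_comm, hT.apply_clm w v]
  refine ⟨s, t, hst, eigenvector_of_rayleigh_eq T hT he hmax ?_ ?_⟩
  · rw [inner_add_right, real_inner_smul_right, real_inner_smul_right, h0]
  · rw [hf, real_inner_smul_left] at hTw hTv
    rw [← real_inner_self_eq_norm_sq]
    simp only [map_add, map_smul, inner_add_left, inner_add_right, real_inner_smul_left,
      real_inner_smul_right, hTw, hTv, hTwv, hTvw, hwv, real_inner_comm w v, hw, hv]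
    ring

/-- Courant's nodal theorem for an eigenfunction of the second eigenvalue: if it takes a negative
value then its positivity set is connected. -/
theorem isPreconnected_pos_of_solOp_eq {ω : Set (ℝ × ℝ)} (ho : IsOpen ω) (hc : IsPreconnected ω)
    {e₀ f : sobolev ω} {a m μ : ℝ} (hm : 0 < m) (hμ : μ ^ 2 = 1 / m - 1)
    (he₀ : solOp ω e₀ = a • e₀)
    (hmax : ∀ x, inner ℝ e₀ x = 0 → inner ℝ (solOp ω x) x ≤ m * ‖x‖ ^ 2)
    (hf : solOp ω f = m • f) {u : ℝ × ℝ → ℝ} (hu : IsSmoothSol μ u ω)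
    (hfu : ∀ᵐ x, x ∈ ω → (f : L2V) x 0 = u x) (hneg : ∃ x ∈ ω, u x < 0) :
    IsPreconnected {x | x ∈ ω ∧ 0 < u x} := by
  have hus := hu.contDiffOn
  have hPo : IsOpen {x | x ∈ ω ∧ 0 < u x} := hus.continuousOn.isOpen_inter_preimage ho isOpen_Ioi
  have hNo : IsOpen {x | x ∈ ω ∧ u x < 0} := hus.continuousOn.isOpen_inter_preimage ho isOpen_Iio
  set P := {x | x ∈ ω ∧ 0 < u x} with hP
  have hjet : ∀ᵐ x, x ∈ ω → (f : L2V) x = jet u x := by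
    filter_upwards [hfu, sobolev_ae_eq_fderiv ho f.2 hus hfu] with x h0 h1 hx
    ext i
    fin_cases i
    exacts [h0 hx, (h1 hx).1, (h1 hx).2]
  rw [isPreconnected_iff_subset_of_disjoint]
  intro U V hU hV hPUV hUV
  by_contra! hcon
  have hAo : IsOpen (P ∩ U) := hPo.inter hU
  have hBo : IsOpen (P ∩ V) := hPo.inter hV
  have hAB : Disjoint (P ∩ U) (P ∩ V) := by
    rw [disjoint_iff_inter_eq_empty, ← inter_inter_distrib_left, hUV]
  have hun : P = P ∩ U ∪ P ∩ V := by
    rw [← inter_union_distrib_left, inter_eq_left.2 hPUV]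
  obtain ⟨p, hpP, hpU⟩ := not_subset.1 hcon.1
  obtain ⟨q, hqP, hqV⟩ := not_subset.1 hcon.2
  have hqA : q ∈ P ∩ U := ⟨hqP, (hPUV hqP).resolve_right hqV⟩
  have hpB : p ∈ P ∩ V := ⟨hpP, (hPUV hpP).resolve_left hpU⟩
  set A := P ∩ U with hA
  set B := P ∩ V with hB
  have hAm := hAo.measurableSet
  have hBm := hBo.measurableSet
  obtain ⟨w, hw⟩ : ∃ w : sobolev ω, (w : L2V) = restrictL hAm f :=
    ⟨⟨_, restrictL_mem_sobolev ho f.2 hus hjet hAo hBo hAB hun⟩, rfl⟩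
  obtain ⟨v, hv⟩ : ∃ v : sobolev ω, (v : L2V) = restrictL hBm f :=
    ⟨⟨_, restrictL_mem_sobolev ho f.2 hus hjet hBo hAo hAB.symm (hun.trans (union_comm _ _))⟩, rfl⟩
  have hself : ∀ {D : Set (ℝ × ℝ)} (hD : MeasurableSet D) (w : sobolev ω),
      (w : L2V) = restrictL hD f → inner ℝ w w = inner ℝ f w := fun hD w hw => by
    rw [Submodule.coe_inner, Submodule.coe_inner, hw, inner_restrictL_self, real_inner_comm]
  obtain ⟨s, t, hst, hTy⟩ := exists_eigenvector_combination (solOp ω) (isSymmetric_solOp ω) he₀ hmax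
    hf (hself hAm w hw) (hself hBm v hv)
    (by rw [Submodule.coe_inner, hw, hv, inner_restrictL_of_disjoint hAm hBm hAB])
    (inner_solOp_restrictL_self hAm f w hw) (inner_solOp_restrictL_self hBm f v hv)
    (inner_solOp_restrictL_of_disjoint hAm hBm hAB f w v hw hv)
  obtain ⟨y, hy⟩ : ∃ y, y = s • w + t • v := ⟨_, rfl⟩
  rw [← hy] at hTy
  obtain ⟨g, hg, hyg⟩ := exists_isSmoothSol ho hm hμ hTy
  have hyv : ∀ᵐ x, (y : L2V) x 0 =
      s * A.indicator (fun x => (f : L2V) x 0) x + t * B.indicator (fun x => (f : L2V) x 0) x := by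
    have h1 : (y : L2V) = s • restrictL hAm (f : L2V) + t • restrictL hBm (f : L2V) := by
      rw [hy, Submodule.coe_add, Submodule.coe_smul, Submodule.coe_smul, hw, hv]
    rw [h1]
    filter_upwards [Lp.coeFn_add (s • restrictL hAm (f : L2V)) (t • restrictL hBm (f : L2V)),
      Lp.coeFn_smul s (restrictL hAm (f : L2V)), Lp.coeFn_smul t (restrictL hBm (f : L2V)),
      coeFn_restrictL hAm (f : L2V), coeFn_restrictL hBm (f : L2V)] with x h2 h3 h4 h5 h6
    rw [h2, Pi.add_apply, h3, h4, Pi.smul_apply, Pi.smul_apply, h5, h6]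
    by_cases hxA : x ∈ A <;> by_cases hxB : x ∈ B <;> simp [hxA, hxB]
  obtain ⟨x₀, hx₀, hx₀u⟩ := hneg
  have hgN : EqOn g (fun _ => 0) {x | x ∈ ω ∧ u x < 0} := by
    refine Measure.eqOn_open_of_ae_eq (μ := volume) ?_ hNo
      (hg.contDiffOn.continuousOn.mono fun x hx => hx.1) continuousOn_const
    refine (ae_restrict_iff' hNo.measurableSet).2 ?_
    filter_upwards [hyg, hyv] with x h1 h2 hx
    have hxP : x ∉ P := fun h => lt_asymm h.2 hx.2
    rw [← h1 hx.1, h2, indicator_of_notMem fun h => hxP h.1, indicator_of_notMem fun h => hxP h.1]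
    simp
  have hg0 := hg.eq_zero_of_eventually hc hx₀
    (Filter.eventually_of_mem (hNo.mem_nhds ⟨hx₀, hx₀u⟩) hgN)
  have hcon2 : ∀ (c : ℝ) (D : Set (ℝ × ℝ)), IsOpen D → D ⊆ P → D.Nonempty →
      (∀ᵐ x, x ∈ D → (y : L2V) x 0 = c * (f : L2V) x 0) → c = 0 := by
    intro c D hD hDP ⟨z, hz⟩ hyc
    have h1 : EqOn (fun x => c * u x) (fun _ => 0) D := by
      refine Measure.eqOn_open_of_ae_eq (μ := volume) ?_ hD
        (continuousOn_const.mul (hus.continuousOn.mono fun x hx => (hDP hx).1)) continuousOn_const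
      refine (ae_restrict_iff' hD.measurableSet).2 ?_
      filter_upwards [hyg, hyc, hfu] with x h1 h2 h3 hx
      have hxω := (hDP hx).1
      rw [← h3 hxω, ← h2 hx, h1 hxω, hg0 x hxω]
    exact (mul_eq_zero.1 (h1 hz)).resolve_right (hDP hz).2.ne'
  have hs : s = 0 := hcon2 s A hAo inter_subset_left ⟨q, hqA⟩ <| by
    filter_upwards [hyv] with x hx hxA
    rw [hx, indicator_of_mem hxA, indicator_of_notMem (disjoint_left.1 hAB hxA)]
    ring
  have ht : t = 0 := hcon2 t B hBo inter_subset_left ⟨p, hpB⟩ <| by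
    filter_upwards [hyv] with x hx hxB
    rw [hx, indicator_of_mem hxB, indicator_of_notMem (disjoint_right.1 hAB hxB)]
    ring
  exact hst.elim (fun h => h hs) fun h => h ht

theorem ae_sum_smul_apply {ι : Type*} (s : Finset ι) (c : ι → ℝ) (e : ι → L2V) :
    ∀ᵐ x, (∑ i ∈ s, c i • e i : L2V) x 0 = ∑ i ∈ s, c i * e i x 0 := by
  classical
  induction s using Finset.induction_on with
  | empty =>
    filter_upwards [Lp.coeFn_zero E3 2 (volume : Measure (ℝ × ℝ))] with x hx
    rw [Finset.sum_empty, Finset.sum_empty, hx]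
    rfl
  | insert i s hi ih =>
    rw [Finset.sum_insert hi]
    filter_upwards [ih, Lp.coeFn_add (c i • e i) (∑ i ∈ s, c i • e i), Lp.coeFn_smul (c i) (e i)]
      with x h1 h2 h3
    rw [h2, Pi.add_apply, PiLp.add_apply, h1, h3, Finset.sum_insert hi]
    rfl

theorem map_sum_smul_eq {H ι : Type*} [NormedAddCommGroup H] [InnerProductSpace ℝ H] [Fintype ι]
    (T : H →L[ℝ] H) {m : ℝ} {e : ι → H} (he : ∀ i, T (e i) = m • e i) (c : ι → ℝ) :
    T (∑ i, c i • e i) = m • ∑ i, c i • e i := by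
  rw [map_sum, Finset.smul_sum]
  refine Finset.sum_congr rfl fun i _ => ?_
  rw [map_smul, he, smul_comm]

/-- Among four functions differentiable at `p`, some non-trivial linear combination vanishes at `p`
together with its first derivatives. -/
theorem exists_combination_vanishing {u : Fin 4 → ℝ × ℝ → ℝ} {p : ℝ × ℝ}
    (hu : ∀ i, DifferentiableAt ℝ (u i) p) :
    ∃ c : Fin 4 → ℝ, c ≠ 0 ∧ ∑ i, c i * u i p = 0 ∧
      fderiv ℝ (fun x => ∑ i, c i * u i x) p (1, 0) = 0 ∧
      fderiv ℝ (fun x => ∑ i, c i * u i x) p (0, 1) = 0 := by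
  obtain ⟨c, hc, h0⟩ := exists_ne_zero_of_lt_finrank (Matrix.mulVecLin (Matrix.of fun j i =>
    (![u i p, fderiv ℝ (u i) p (1, 0), fderiv ℝ (u i) p (0, 1)] : Fin 3 → ℝ) j)) (by simp)
  have key : ∀ v, fderiv ℝ (fun x => ∑ i, c i * u i x) p v = ∑ i, fderiv ℝ (u i) p v * c i := by
    intro v
    have h : HasFDerivAt (fun x => ∑ i, c i * u i x) (∑ i, c i • fderiv ℝ (u i) p) p :=
      HasFDerivAt.fun_sum fun i _ => (hu i).hasFDerivAt.const_mul (c i)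
    rw [h.fderiv, _root_.sum_apply]
    exact Finset.sum_congr rfl fun i _ => mul_comm _ _
  refine ⟨c, hc, ?_, ?_, ?_⟩
  · exact (Finset.sum_congr rfl fun i _ => mul_comm _ _).trans (congrFun h0 0)
  · rw [key]
    exact congrFun h0 1
  · rw [key]
    exact congrFun h0 2

/-- The plane with its origin moved to `p`. -/
def planeHomeomorph (p : ℝ × ℝ) : ℂ ≃ₜ ℝ × ℝ :=
  Complex.equivRealProdCLM.toHomeomorph.trans (Homeomorph.addLeft p)

theorem planeHomeomorph_polar (p : ℝ × ℝ) (t θ : ℝ) :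
    planeHomeomorph p (t * Complex.exp (θ * Complex.I)) = p + t • (Real.cos θ, Real.sin θ) := by
  have h : ∀ z : ℂ, planeHomeomorph p z = p + (z.re, z.im) := fun _ => rfl
  rw [h]
  simp [Complex.exp_mul_I, ← Complex.ofReal_cos, ← Complex.ofReal_sin]

/-- A non-trivial solution of the Helmholtz equation with connected nodal domains has no critical
zero. -/
theorem IsSmoothSol.eventually_eq_zero_of_isPreconnected {μ : ℝ} {u : ℝ × ℝ → ℝ} {ω : Set (ℝ × ℝ)}
    (ho : IsOpen ω) (hu : IsSmoothSol μ u ω)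
    (hP : (∃ x ∈ ω, u x < 0) → IsPreconnected {x | x ∈ ω ∧ 0 < u x})
    (hN : (∃ x ∈ ω, 0 < u x) → IsPreconnected {x | x ∈ ω ∧ u x < 0}) {p : ℝ × ℝ} (hp : p ∈ ω)
    (h0 : u p = 0) (h1 : fderiv ℝ u p (1, 0) = 0) (h2 : fderiv ℝ u p (0, 1) = 0) :
    ∀ᶠ x in nhds p, u x = 0 := by
  by_contra hne
  obtain ⟨ρ, hρ, hρω, w, hw, huw, hpde⟩ := hu p hp
  have hev : u =ᶠ[nhds p] w := Filter.eventually_of_mem (Metric.ball_mem_nhds p hρ) huw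
  rw [hev.fderiv_eq] at h1 h2
  obtain ⟨a, b, r, hb, hb3, hr, hray⟩ := exists_alternating_rays (g := ⟨w, hw⟩) hρ hpde
    (hev.self_of_nhds.symm.trans h0) h1 h2
    fun h => hne (by filter_upwards [hev, h] with x hx h; rw [hx, h])
  have hmem : ∀ k : ℕ, k < 4 → ∀ t : ℝ, 0 < t → t ≤ min r (ρ / 2) →
      p + t • (Real.cos (a + k * b), Real.sin (a + k * b)) ∈ ω ∧
      0 < (-1) ^ k * u (p + t • (Real.cos (a + k * b), Real.sin (a + k * b))) := by
    intro k hk t ht htr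
    have hball : p + t • (Real.cos (a + k * b), Real.sin (a + k * b)) ∈ Metric.ball p ρ := by
      rw [Metric.mem_ball, dist_self_add_left, norm_smul, Real.norm_eq_abs, abs_of_pos ht,
        Prod.norm_mk]
      have hmax : max ‖Real.cos (a + k * b)‖ ‖Real.sin (a + k * b)‖ ≤ 1 :=
        max_le (Real.abs_cos_le_one _) (Real.abs_sin_le_one _)
      calc _ ≤ t * 1 := mul_le_mul_of_nonneg_left hmax ht.le
        _ < ρ := by linarith [min_le_right r (ρ / 2)]
    exact ⟨hρω hball, huw _ hball ▸ hray k hk t ht (htr.trans (min_le_left _ _))⟩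
  have hr' : 0 < min r (ρ / 2) := lt_min hr (half_pos hρ)
  obtain ⟨hx0, hx0'⟩ := hmem 0 (by norm_num) _ hr' le_rfl
  obtain ⟨hx1, hx1'⟩ := hmem 1 (by norm_num) _ hr' le_rfl
  have hPc := hP ⟨_, hx1, by simpa using hx1'⟩
  have hNc := hN ⟨_, hx0, by simpa using hx0'⟩
  have hPo : IsOpen {x | x ∈ ω ∧ 0 < u x} :=
    hu.contDiffOn.continuousOn.isOpen_inter_preimage ho isOpen_Ioi
  have hz : planeHomeomorph p 0 = p := by simp [planeHomeomorph]
  refine false_of_alternating_rays (P := planeHomeomorph p ⁻¹' {x | x ∈ ω ∧ 0 < u x})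
    (N := planeHomeomorph p ⁻¹' {x | x ∈ ω ∧ u x < 0})
    (θ₁ := a + (0 : ℕ) * b) (θ₂ := a + (1 : ℕ) * b) (θ₃ := a + (2 : ℕ) * b) (θ₄ := a + (3 : ℕ) * b)
    (hPo.preimage (planeHomeomorph p).continuous)
    ((planeHomeomorph p).isPreconnected_preimage.2 hPc)
    ((planeHomeomorph p).isPreconnected_preimage.2 hNc) ?_ ?_ ?_ hr' ?_ ?_ ?_ ?_ ?_ ?_ ?_ ?_
  · exact Disjoint.preimage _ (disjoint_left.2 fun x hx hx' => lt_asymm hx.2 hx'.2)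
  · rw [mem_preimage, hz]
    exact fun h => h.2.ne' h0
  · rw [mem_preimage, hz]
    exact fun h => h.2.ne h0
  · push_cast; linarith
  · push_cast; linarith
  · push_cast; linarith
  · push_cast; linarith
  all_goals
    intro t ht htr
    rw [mem_preimage, planeHomeomorph_polar]
  · exact ⟨(hmem 0 (by norm_num) t ht htr).1, by simpa using (hmem 0 (by norm_num) t ht htr).2⟩
  · exact ⟨(hmem 1 (by norm_num) t ht htr).1, by simpa using (hmem 1 (by norm_num) t ht htr).2⟩
  · exact ⟨(hmem 2 (by norm_num) t ht htr).1, by simpa using (hmem 2 (by norm_num) t ht htr).2⟩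
  · exact ⟨(hmem 3 (by norm_num) t ht htr).1,
      by simpa [pow_succ] using (hmem 3 (by norm_num) t ht htr).2⟩

/-- The second Dirichlet eigenvalue of a bounded planar domain has multiplicity at most three. -/
theorem dirichletEV_two_lt_five {ω : Set (ℝ × ℝ)} (ho : IsOpen ω) (hb : Bornology.IsBounded ω)
    (hc : IsConnected ω) : dirichletEV ω 2 < dirichletEV ω 5 := by
  by_contra! hle
  obtain ⟨e, e₀, a, m, hm, hm1, he₀, hmax, hind, -, he⟩ :=
    exists_eigenvectors_of_le ho hc.nonempty hb hle
  obtain ⟨μ, hμ⟩ : ∃ μ : ℝ, μ ^ 2 = 1 / m - 1 :=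
    ⟨√(1 / m - 1), Real.sq_sqrt (by rw [sub_nonneg]; exact (one_le_div hm).2 hm1)⟩
  choose u hu heu using fun i => exists_isSmoothSol ho hm hμ (he i)
  obtain ⟨p, hp⟩ := hc.nonempty
  obtain ⟨c, hc0, h0, h1, h2⟩ := exists_combination_vanishing
    fun i => ((hu i).contDiffAt hp).differentiableAt (by simp)
  obtain ⟨f, hf⟩ : ∃ f : sobolev ω, f = ∑ i, c i • e i := ⟨_, rfl⟩
  have hf0 : f ≠ 0 := fun h => hc0 (funext (Fintype.linearIndependent_iff.1 hind c (hf ▸ h)))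
  have hTf : solOp ω f = m • f := hf ▸ map_sum_smul_eq (solOp ω) he c
  have hU := IsSmoothSol.sum ho hu c
  have hfU : ∀ᵐ x, x ∈ ω → (f : L2V) x 0 = ∑ i, c i * u i x := by
    have hfL : (f : L2V) = ∑ i, c i • (e i : L2V) := by
      rw [hf, Submodule.coe_sum]
      rfl
    rw [hfL]
    filter_upwards [ae_sum_smul_apply Finset.univ c fun i => (e i : L2V),
      ae_all_iff.2 heu] with x h3 h4 hx
    rw [h3]
    exact Finset.sum_congr rfl fun i _ => by rw [h4 i hx]
  have hnegU : ∀ᵐ x, x ∈ ω → ((-f : sobolev ω) : L2V) x 0 = -∑ i, c i * u i x := by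
    filter_upwards [hfU, Lp.coeFn_neg (f : L2V)] with x h3 h4 hx
    rw [Submodule.coe_neg, h4, Pi.neg_apply, PiLp.neg_apply, h3 hx]
  have hTneg : solOp ω (-f) = m • (-f) := by
    rw [map_neg, hTf, smul_neg]
  have hev := hU.eventually_eq_zero_of_isPreconnected ho
    (isPreconnected_pos_of_solOp_eq ho hc.isPreconnected hm hμ he₀ hmax hTf hU hfU)
    (fun ⟨x, hx, hxu⟩ => by
      simpa using isPreconnected_pos_of_solOp_eq ho hc.isPreconnected hm hμ he₀ hmax hTneg
        (hU.neg ho) hnegU ⟨x, hx, by simpa using hxu⟩) hp h0 h1 h2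
  have hz := hU.eq_zero_of_eventually hc.isPreconnected hp hev
  refine hf0 (Subtype.ext (eq_zero_of_valL_eq_zero f.2 (Lp.ext ?_)))
  filter_upwards [coeFn_valL (f : L2V), hfU, sobolev_ae_eq_zero f.2,
    Lp.coeFn_zero ℝ 2 (volume : Measure (ℝ × ℝ))] with x h3 h4 h5 h6
  rw [h3, h6]
  by_cases hx : x ∈ ω
  · rw [h4 hx, hz x hx]
    rfl
  · rw [h5 hx]
    rfl

/-- Cheng's theorem for domains with corners and cracks: if `Ω ⊂ ℝ²` is a
bounded connected open set whose boundary is `C^{1,α}` for some `α > 0` except possibly at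
finitely many corner points of opening `β·π` with `0 < β ≤ 2`, then the multiplicity of the
second Dirichlet eigenvalue is at most `3`, i.e. `λ₂(Ω) < λ₅(Ω)`. -/
theorem multiplicity_second_eigenvalue_le_three
    (Ω : Set (ℝ × ℝ)) (hΩo : IsOpen Ω) (hΩb : Bornology.IsBounded Ω) (hΩc : IsConnected Ω)
    (α : NNReal) (hα : 0 < α) (S : Finset (ℝ × ℝ)) (hS : (S : Set (ℝ × ℝ)) ⊆ frontier Ω)
    (hreg : ∀ p ∈ frontier Ω, p ∉ S → IsLocalSectorModel Ω α p 1)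
    (hcorner : ∀ p ∈ S, ∃ β : ℝ, 0 < β ∧ β ≤ 2 ∧ IsLocalSectorModel Ω α p β) :
    dirichletEV Ω 2 < dirichletEV Ω 5 := by
  exact dirichletEV_two_lt_five hΩo hΩb hΩc
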